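/- Let K be an algebraically closed field of characteristic zero, Z and X algebraic varieties over K, and φ₁, φ₂ : Z → X dominant rational maps whose generic fibres are irreducible. If there exist infinitely many hypersurfaces H on X satisfying φ₁*H = φ₂*H, then there exists g ∈ K(X) \ K with g∘φ₁ = g∘φ₂. -/

import Mathlib

/-!
# Corollary 7.3: the reduced case with irreducible generic fibres

Varieties `Z`, `X` over an algebraically closed field `K` of characteristic zero are
modelled by (affine models with) coordinate rings `S`, `R` (finitely generated `K`-algebra
domains); a dominant rational map `φᵢ : Z → X` is modelled by an injective `K`-algebra
homomorphism `fᵢ : R → S`.  The generic fibre of `φᵢ` is irreducible precisely when the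
function field `K(X)` is relatively algebraically closed in `K(Z)` via `fᵢ` (characteristic
zero); this is expressed denominator-freely by `FracRelAlgClosedVia`.
-/

/-- A prime ideal `P` of a commutative ring has height one. -/
def HeightOnePrime {R : Type*} [CommRing R] (P : Ideal R) : Prop :=
  P.IsPrime ∧ P ≠ ⊥ ∧ ∀ Q : Ideal R, Q.IsPrime → Q < P → Q = ⊥

/-- `I` is the radical vanishing ideal of a nonempty Zariski closed subset of pure
codimension one. -/
def IsHypersurfaceIdeal {R : Type*} [CommRing R] (I : Ideal R) : Prop :=
  I.IsRadical ∧ I ≠ ⊤ ∧ ∀ P ∈ I.minimalPrimes, HeightOnePrime P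

/-- The vanishing ideal of the proper transform of `V(I)` along the dominant map induced
by `f`. -/
def properTransform {R S : Type*} [CommRing R] [CommRing S] (f : R →+* S) (I : Ideal R) :
    Ideal S :=
  sInf {Q : Ideal S | Q ∈ (I.map f).minimalPrimes ∧ Q.comap f ∈ I.minimalPrimes}

/-- `Frac(A)` is relatively algebraically closed in `Frac(B)` via the injective map
`f : A → B` of domains: every fraction `a/b` of elements of `B` which is algebraic over
`Frac(A)` (equivalently satisfies a homogenised polynomial relation with coefficients in
`f(A)`) already lies in `Frac(f(A))`. -/
def FracRelAlgClosedVia {A B : Type*} [CommRing A] [CommRing B] (f : A →+* B) : Prop :=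
  ∀ a b : B, b ≠ 0 →
    (∃ p : Polynomial A, p ≠ 0 ∧
        ∑ i ∈ Finset.range (p.natDegree + 1),
          f (p.coeff i) * a ^ i * b ^ (p.natDegree - i) = 0) →
    ∃ c d : A, d ≠ 0 ∧ a * f d = b * f c

set_option linter.unusedSectionVars false

open MvPolynomial
open scoped WithZero

theorem IsDiscreteValuationRing.of_atPrime_span_singleton {C O : Type*} [CommRing C] [IsDomain C]
    [IsNoetherianRing C] [CommRing O] [IsDomain O] [Algebra C O] (p : C)
    (hp : Prime p) [(Ideal.span {p}).IsPrime] [IsLocalization.AtPrime O (Ideal.span {p})] :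
    IsDiscreteValuationRing O := by
  have hloc : IsLocalRing O := IsLocalization.AtPrime.isLocalRing O (Ideal.span {p})
  have hno : IsNoetherianRing O := IsLocalization.isNoetherianRing (Ideal.span {p}).primeCompl O
    inferInstance
  have hmax : IsLocalRing.maximalIdeal O = Ideal.span {algebraMap C O p} := by
    have := IsLocalization.AtPrime.map_eq_maximalIdeal (Ideal.span {p}) O
    rw [Ideal.map_span, Set.image_singleton] at this
    exact this.symm
  have hinj : Function.Injective (algebraMap C O) :=
    IsLocalization.injective O (Ideal.span {p}).primeCompl_le_nonZeroDivisors
  have hnf : ¬ IsField O := by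
    intro h
    have := IsLocalRing.isField_iff_maximalIdeal_eq.mp h
    rw [hmax, Ideal.span_singleton_eq_bot] at this
    exact hp.ne_zero (hinj (by simpa using this))
  have := (IsDiscreteValuationRing.TFAE O hnf).out 0 4
  rw [this]
  exact ⟨⟨algebraMap C O p, hmax⟩⟩

/-- The discrete valuations of a finite extension `L` of the fraction field of a Noetherian domain
lying over a prime element, given in terms of the localization `O` at this prime element. -/
theorem exists_valuations_over_prime_aux {C O K L : Type*} [CommRing C] [IsDomain C]
    [IsNoetherianRing C] [CommRing O] [IsDomain O] [Field K] [Field L] [CharZero K] [Algebra C O]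
    [Algebra C K] [Algebra O K] [IsFractionRing O K]
    [Algebra C L] [Algebra O L] [Algebra K L] [IsScalarTower O K L]
    [IsScalarTower C O L] (p : C) (hp : Prime p)
    [(Ideal.span {p}).IsPrime] [IsLocalization.AtPrime O (Ideal.span {p})]
    [FiniteDimensional K L] :
    ∃ 𝒮 : Set (Valuation L ℤᵐ⁰), 𝒮.Finite ∧ 𝒮.Nonempty ∧
      (∀ w ∈ 𝒮, (∀ c, w (algebraMap C L c) ≤ 1) ∧ (∀ c, w (algebraMap C L c) < 1 ↔ p ∣ c) ∧
        (∃ π, w π = WithZero.exp (-1 : ℤ)) ∧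
        (∀ u, w u ≤ 1 → ∃ a b, IsIntegral C a ∧ IsIntegral C b ∧ w b = 1 ∧ u * b = a)) ∧
      ∀ s, (∀ w ∈ 𝒮, w s ≤ 1) → ∃ d, ¬ p ∣ d ∧ IsIntegral C (algebraMap C L d * s) := by
  have hdvr : IsDiscreteValuationRing O := IsDiscreteValuationRing.of_atPrime_span_singleton p hp
  set B := integralClosure O L with hB
  have hded : IsDedekindDomain B := integralClosure.isDedekindDomain O K L
  have hfr : IsFractionRing B L := integralClosure.isFractionRing_of_finite_extension K L
  have hCO : Function.Injective (algebraMap C O) :=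
    IsLocalization.injective O (Ideal.span {p}).primeCompl_le_nonZeroDivisors
  have hOL : Function.Injective (algebraMap O L) := by
    rw [IsScalarTower.algebraMap_eq O K L]
    exact (algebraMap K L).injective.comp (IsFractionRing.injective O K)
  have hmax : IsLocalRing.maximalIdeal O = Ideal.span {algebraMap C O p} := by
    have := IsLocalization.AtPrime.map_eq_maximalIdeal (Ideal.span {p}) O
    rw [Ideal.map_span, Set.image_singleton] at this
    exact this.symm
  have hpO : ∀ c : C, ¬ p ∣ c → IsUnit (algebraMap C O c) := by
    intro c hc
    exact IsLocalization.map_units O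
      (⟨c, by simpa [Ideal.primeCompl, Ideal.mem_span_singleton] using hc⟩ :
        (Ideal.span {p}).primeCompl)
  have hpB0 : algebraMap O B (algebraMap C O p) ≠ 0 := by
    intro h
    have := congrArg (algebraMap B L) h
    rw [← IsScalarTower.algebraMap_apply, map_zero] at this
    exact hp.ne_zero (hCO (hOL (by simpa using this)))
  -- every place lies over the maximal ideal
  have hover : ∀ v : IsDedekindDomain.HeightOneSpectrum B, ∀ x : O,
      algebraMap O B x ∈ v.asIdeal ↔ x ∈ IsLocalRing.maximalIdeal O := by
    intro v x
    have hmx : v.asIdeal.IsMaximal := v.isMaximal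
    have : (v.asIdeal.comap (algebraMap O B)).IsMaximal :=
      Ideal.isMaximal_comap_of_isIntegral_of_isMaximal _
    rw [← IsLocalRing.eq_maximalIdeal this]
    rfl
  have hwC : ∀ v : IsDedekindDomain.HeightOneSpectrum B, ∀ c : C,
      v.valuation L (algebraMap C L c) = v.valuation L (algebraMap B L (algebraMap O B
        (algebraMap C O c))) := by
    intro v c
    rw [IsScalarTower.algebraMap_apply C O L, IsScalarTower.algebraMap_apply O B L]
  have hint : ∀ b : B, ∃ d : C, ¬ p ∣ d ∧ IsIntegral C (algebraMap C L d * (b : L)) := by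
    intro b
    obtain ⟨d, hd⟩ := IsIntegral.exists_multiple_integral_of_isLocalization
      (Ideal.span {p}).primeCompl (b : L) b.2
    refine ⟨d, ?_, ?_⟩
    · have := d.2
      simpa [Ideal.primeCompl, Ideal.mem_span_singleton] using this
    · rwa [Submonoid.smul_def, Algebra.smul_def] at hd
  refine ⟨(fun v : IsDedekindDomain.HeightOneSpectrum B => v.valuation L) '' Set.univ, ?_, ?_, ?_,
    ?_⟩
  · refine Set.Finite.image _ ((Ideal.finite_factors (I := Ideal.span {algebraMap O B
      (algebraMap C O p)}) (by simpa using hpB0)).subset ?_)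
    intro v _
    rw [Set.mem_ofPred_eq, Ideal.dvd_span_singleton, hover, hmax]
    exact Ideal.mem_span_singleton_self _
  · refine Set.Nonempty.image _ ?_
    suffices h : Nonempty (IsDedekindDomain.HeightOneSpectrum B) from Set.univ_nonempty
    have hnf : ¬ IsField B := by
      intro h
      obtain ⟨y, hy⟩ := h.mul_inv_cancel hpB0
      have hO : IsField O := isField_of_isIntegral_of_isField (R := O) (S := B)
        (by
          intro a b hab
          apply hOL
          rw [IsScalarTower.algebraMap_apply O B L, hab, ← IsScalarTower.algebraMap_apply]) h
      have := IsLocalRing.isField_iff_maximalIdeal_eq.mp hO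
      rw [hmax, Ideal.span_singleton_eq_bot] at this
      exact hp.ne_zero (hCO (by simpa using this))
    obtain ⟨M, hM⟩ := Ideal.exists_maximal B
    exact ⟨⟨M, hM.isPrime, Ring.ne_bot_of_isMaximal_of_not_isField hM hnf⟩⟩
  · rintro _ ⟨v, -, rfl⟩
    refine ⟨?_, ?_, v.valuation_exists_uniformizer L, ?_⟩
    · intro c
      simp only [hwC]
      exact v.valuation_le_one _
    · intro c
      simp only [hwC]
      rw [v.valuation_lt_one_iff_mem, hover, hmax, Ideal.mem_span_singleton]
      refine ⟨fun h => ?_, fun h => map_dvd _ h⟩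
      by_contra hc
      have h1 := isUnit_of_dvd_unit h (hpO c hc)
      have : algebraMap C O p ∈ IsLocalRing.maximalIdeal O := by
        rw [hmax]; exact Ideal.mem_span_singleton_self _
      exact this h1
    · intro u hu
      obtain ⟨n, d, hnd⟩ := v.exists_primeCompl_mul_eq_of_integer u hu
      obtain ⟨d₁, hd₁, hi₁⟩ := hint n
      obtain ⟨d₂, hd₂, hi₂⟩ := hint d
      have hi : ∀ c : C, IsIntegral C (algebraMap C L c) := fun c => isIntegral_algebraMap
      have hw1 : ∀ c : C, ¬ p ∣ c → v.valuation L (algebraMap C L c) = 1 := by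
        intro c hc
        rw [hwC, v.valuation_eq_one_iff_notMem, hover]
        exact fun h => h (hpO c hc)
      refine ⟨algebraMap C L d₂ * (algebraMap C L d₁ * n), algebraMap C L d₁ *
        (algebraMap C L d₂ * (d : B)), (hi _).mul hi₁, (hi _).mul hi₂, ?_, ?_⟩
      · rw [map_mul, map_mul, hw1 _ hd₁, hw1 _ hd₂, one_mul, one_mul]
        exact (v.valuation_eq_one_iff_notMem).mpr d.2
      · have hnd' : u * ((d : B) : L) = (n : L) := hnd
        rw [← hnd']; ring
  · intro s hs
    obtain ⟨b, rfl⟩ := IsDedekindDomain.HeightOneSpectrum.mem_integers_of_valuation_le_one L s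
      (fun v => hs _ ⟨v, Set.mem_univ _, rfl⟩)
    exact hint b

/-- The discrete valuations of a finite extension `L` of the fraction field of a Noetherian domain
lying over a prime element. -/
theorem exists_valuations_over_prime {C : Type*} (K : Type*) {L : Type*} [CommRing C] [IsDomain C]
    [IsNoetherianRing C] [Field K] [Field L] [CharZero K]
    [Algebra C K] [IsFractionRing C K]
    [Algebra C L] [Algebra K L] [IsScalarTower C K L] [FiniteDimensional K L]
    (p : C) (hp : Prime p) :
    ∃ 𝒮 : Set (Valuation L ℤᵐ⁰), 𝒮.Finite ∧ 𝒮.Nonempty ∧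
      (∀ w ∈ 𝒮, (∀ c, w (algebraMap C L c) ≤ 1) ∧ (∀ c, w (algebraMap C L c) < 1 ↔ p ∣ c) ∧
        (∃ π, w π = WithZero.exp (-1 : ℤ)) ∧
        (∀ u, w u ≤ 1 → ∃ a b, IsIntegral C a ∧ IsIntegral C b ∧ w b = 1 ∧ u * b = a)) ∧
      ∀ s, (∀ w ∈ 𝒮, w s ≤ 1) → ∃ d, ¬ p ∣ d ∧ IsIntegral C (algebraMap C L d * s) := by
  have hpr : (Ideal.span {p}).IsPrime := (Ideal.span_singleton_prime hp.ne_zero).mpr hp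
  have hle : (Ideal.span {p}).primeCompl ≤ nonZeroDivisors C :=
    (Ideal.span {p}).primeCompl_le_nonZeroDivisors
  set O := Localization.subalgebra.ofField K (Ideal.span {p}).primeCompl hle
  have : IsLocalization.AtPrime O (Ideal.span {p}) :=
    Localization.subalgebra.isLocalization_ofField K _ hle
  have : IsFractionRing O K := Localization.subalgebra.isFractionRing_ofField K _ hle
  have : IsScalarTower C O L := IsScalarTower.of_algebraMap_eq fun c => by
    rw [IsScalarTower.algebraMap_apply C K L]; rfl
  exact exists_valuations_over_prime_aux (O := O) (K := K) p hp

section Adjoin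

variable {K L : Type*} [Field K] [Field L] [Algebra K L] {m : ℕ} {t : Fin m → L}

theorem AlgebraicIndependent.uniqueFactorizationMonoid_adjoin (ht : AlgebraicIndependent K t) :
    UniqueFactorizationMonoid (Algebra.adjoin K (Set.range t)) :=
  MulEquiv.uniqueFactorizationMonoid ht.aevalEquiv.toMulEquiv inferInstance

theorem AlgebraicIndependent.isNoetherianRing_adjoin (ht : AlgebraicIndependent K t) :
    IsNoetherianRing (Algebra.adjoin K (Set.range t)) :=
  isNoetherianRing_of_ringEquiv _ ht.aevalEquiv.toRingEquiv

theorem AlgebraicIndependent.isIntegrallyClosed_adjoin (ht : AlgebraicIndependent K t) :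
    IsIntegrallyClosed (Algebra.adjoin K (Set.range t)) :=
  have := ht.uniqueFactorizationMonoid_adjoin
  inferInstance

theorem IsTranscendenceBasis.finiteDimensional_adjoin [Algebra.EssFiniteType K L]
    (ht : IsTranscendenceBasis K t) :
    FiniteDimensional (IntermediateField.adjoin K (Set.range t)) L := by
  have h1 : Algebra.IsAlgebraic (IntermediateField.adjoin K (Set.range t)) L := ht.isAlgebraic_field
  have h2 : Algebra.EssFiniteType (IntermediateField.adjoin K (Set.range t)) L :=
    Algebra.EssFiniteType.of_comp K _ L
  exact Algebra.finite_of_essFiniteType_of_isAlgebraic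

theorem exists_aeval_eq_of_mem_adjoin {a : L} (ha : a ∈ Algebra.adjoin K (Set.range t)) :
    ∃ Q : MvPolynomial (Fin m) K, aeval t Q = a := by
  rw [Algebra.adjoin_range_eq_range_aeval] at ha
  exact ha

theorem aeval_mem_adjoin (Q : MvPolynomial (Fin m) K) :
    aeval t Q ∈ Algebra.adjoin K (Set.range t) := by
  rw [Algebra.adjoin_range_eq_range_aeval]
  exact ⟨Q, rfl⟩

open IntermediateField.algebraAdjoinAdjoin in
theorem AlgebraicIndependent.mem_adjoin_of_isIntegral (ht : AlgebraicIndependent K t)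
    {a : L} (ha : a ∈ IntermediateField.adjoin K (Set.range t))
    (hi : IsIntegral (Algebra.adjoin K (Set.range t)) a) :
    a ∈ Algebra.adjoin K (Set.range t) := by
  have := ht.isIntegrallyClosed_adjoin
  have h : IsIntegral (Algebra.adjoin K (Set.range t))
      (⟨a, ha⟩ : IntermediateField.adjoin K (Set.range t)) := by
    rw [← isIntegral_algebraMap_iff (B := L) (A := IntermediateField.adjoin K (Set.range t))
      (FaithfulSMul.algebraMap_injective _ _)]
    exact hi
  obtain ⟨y, hy⟩ := IsIntegrallyClosed.isIntegral_iff.mp h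
  have := congrArg (algebraMap _ L) hy
  change (y : L) = a at this
  exact this ▸ y.2

open IntermediateField.algebraAdjoinAdjoin in
theorem AlgebraicIndependent.trace_mem_adjoin
    {M : IntermediateField K L} (hM : M = IntermediateField.adjoin K (Set.range t))
    (ht : AlgebraicIndependent K t) [FiniteDimensional M L] {s : L}
    (hi : IsIntegral (Algebra.adjoin K (Set.range t)) s) :
    (Algebra.trace M L s : L) ∈ Algebra.adjoin K (Set.range t) := by
  subst hM
  refine ht.mem_adjoin_of_isIntegral (Subtype.property _) ?_
  have := Algebra.isIntegral_trace (R := Algebra.adjoin K (Set.range t))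
    (L := IntermediateField.adjoin K (Set.range t)) hi
  exact this.map (IsScalarTower.toAlgHom (Algebra.adjoin K (Set.range t))
    (IntermediateField.adjoin K (Set.range t)) L)

/-- A set of discrete valuations of `L` which serves as the set of all places over the prime
divisor defined by `p` on the affine space with coordinates `t`. -/
structure IsPlacesOver (t : Fin m → L) (p : MvPolynomial (Fin m) K)
    (𝒮 : Set (Valuation L ℤᵐ⁰)) : Prop where
  finite : 𝒮.Finite
  nonempty : 𝒮.Nonempty
  aeval_le_one : ∀ w ∈ 𝒮, ∀ c : MvPolynomial (Fin m) K, w (aeval t c) ≤ 1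
  aeval_lt_one_iff : ∀ w ∈ 𝒮, ∀ c : MvPolynomial (Fin m) K, w (aeval t c) < 1 ↔ p ∣ c
  exists_uniformizer : ∀ w ∈ 𝒮, ∃ π, w π = WithZero.exp (-1 : ℤ)
  exists_eq_div : ∀ w ∈ 𝒮, ∀ u, w u ≤ 1 → ∃ a b, IsIntegral (Algebra.adjoin K (Set.range t)) a ∧
    IsIntegral (Algebra.adjoin K (Set.range t)) b ∧ w b = 1 ∧ u * b = a
  exists_isIntegral : ∀ s, (∀ w ∈ 𝒮, w s ≤ 1) → ∃ d : MvPolynomial (Fin m) K, ¬ p ∣ d ∧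
    IsIntegral (Algebra.adjoin K (Set.range t)) (aeval t d * s)

open IntermediateField.algebraAdjoinAdjoin in
theorem IsTranscendenceBasis.exists_isPlacesOver [CharZero K] [Algebra.EssFiniteType K L]
    (ht : IsTranscendenceBasis K t) {p : MvPolynomial (Fin m) K} (hp : Irreducible p) :
    ∃ 𝒮, IsPlacesOver t p 𝒮 := by
  have := ht.1.uniqueFactorizationMonoid_adjoin
  have := ht.1.isNoetherianRing_adjoin
  have := ht.finiteDimensional_adjoin
  have e := ht.1.aevalEquiv
  obtain ⟨𝒮, h1, h2, h3, h4⟩ := exists_valuations_over_prime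
    (C := Algebra.adjoin K (Set.range t)) (IntermediateField.adjoin K (Set.range t)) (L := L)
    (ht.1.aevalEquiv p) (MulEquiv.prime_iff ht.1.aevalEquiv |>.mpr hp.prime)
  refine ⟨𝒮, h1, h2, fun w hw c => ?_, fun w hw c => ?_, fun w hw => (h3 w hw).2.2.1,
    fun w hw => (h3 w hw).2.2.2, fun s hs => ?_⟩
  · rw [← ht.1.algebraMap_aevalEquiv]
    exact (h3 w hw).1 _
  · rw [← ht.1.algebraMap_aevalEquiv, (h3 w hw).2.1, map_dvd_iff]
  · obtain ⟨d, hd, hi⟩ := h4 s hs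
    obtain ⟨c, rfl⟩ := ht.1.aevalEquiv.surjective d
    rw [map_dvd_iff] at hd
    exact ⟨c, hd, hi⟩

end Adjoin

theorem Derivation.map_mvPolynomial_aeval {K L ι : Type*} [Field K] [Field L] [Algebra K L]
    [Fintype ι] (D : Derivation K L L) (x : ι → L) (Q : MvPolynomial ι K) :
    D (aeval x Q) = ∑ i, aeval x (pderiv i Q) * D (x i) := by
  classical
  induction Q using MvPolynomial.induction_on with
  | C a => simp
  | add p q hp hq => simp [hp, hq, add_mul, Finset.sum_add_distrib]
  | mul_X p j hp =>
    simp only [map_mul, aeval_X, D.leibniz, hp, smul_eq_mul, Derivation.leibniz, pderiv_X,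
      map_add, add_mul, Finset.sum_add_distrib, Finset.mul_sum]
    congr 1
    · rw [Finset.sum_eq_single j] <;> simp +contextual [eq_comm]
    · exact Finset.sum_congr rfl fun i _ => by ring

open IntermediateField.algebraAdjoinAdjoin in
theorem exists_finset_integralClosure_adjoin {K L : Type*} [Field K] [Field L] [Algebra K L]
    [CharZero K] [Algebra.EssFiniteType K L] {m : ℕ} {t : Fin m → L}
    (ht : IsTranscendenceBasis K t) :
    ∃ G : Finset L, (∀ g ∈ G, IsIntegral (Algebra.adjoin K (Set.range t)) g) ∧
      ∀ s, IsIntegral (Algebra.adjoin K (Set.range t)) s →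
        s ∈ Submodule.span (Algebra.adjoin K (Set.range t)) (G : Set L) := by
  have := ht.1.isIntegrallyClosed_adjoin
  have := ht.1.isNoetherianRing_adjoin
  have := ht.finiteDimensional_adjoin
  set A := Algebra.adjoin K (Set.range t)
  have hfin : Module.Finite A (integralClosure A L) :=
    IsIntegralClosure.finite A (IntermediateField.adjoin K (Set.range t)) L (integralClosure A L)
  have h := (Module.Finite.iff_fg (N := Subalgebra.toSubmodule (integralClosure A L))).mp hfin
  obtain ⟨G, hG⟩ := h
  refine ⟨G, fun g hg => ?_, fun s hs => ?_⟩
  · have : g ∈ Subalgebra.toSubmodule (integralClosure A L) := hG ▸ Submodule.subset_span hg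
    exact this
  · rw [hG]; exact hs

section FinitePlaces

variable {K L : Type*} [Field K] [Field L] [Algebra K L] {m : ℕ} (t : Fin m → L)

open Classical in
/-- A choice of a complete set of places over the prime divisor defined by `p`. -/
noncomputable def placesOver (p : MvPolynomial (Fin m) K) : Set (Valuation L ℤᵐ⁰) :=
  if h : ∃ 𝒮, IsPlacesOver t p 𝒮 then h.choose else ∅

/-- The places of `L` over the prime divisors of the affine space with coordinates `t`. -/
def finitePlaces (K : Type*) {L : Type*} [Field K] [Field L] [Algebra K L] {m : ℕ}
    (t : Fin m → L) : Set (Valuation L ℤᵐ⁰) :=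
  {w | ∃ a : Associates (MvPolynomial (Fin m) K),
    Irreducible (Quot.out a) ∧ w ∈ placesOver t (Quot.out a)}

variable {t}

theorem Valuation.le_one_of_isIntegral {Γ : Type*} [LinearOrderedCommGroupWithZero Γ]
    (w : Valuation L Γ) {A : Subalgebra K L} (hA : ∀ a ∈ A, w a ≤ 1) {s : L} (hs : IsIntegral A s) :
    w s ≤ 1 := by
  have hle : A.toSubring ≤ w.integer := fun a ha => hA a ha
  have h2 : IsIntegral w.integer s := by
    obtain ⟨p, hp, hp0⟩ := hs
    let f : A →+* w.integer := Subring.inclusion hle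
    refine ⟨p.map f, hp.map f, ?_⟩
    rw [Polynomial.eval₂_map]
    exact hp0
  have := (Valuation.integer.integers w).isIntegrallyClosed
  have h := (Valuation.Integers.mem_of_integral (Valuation.integer.integers w) h2)
  exact h

variable [CharZero K] [Algebra.EssFiniteType K L] (ht : IsTranscendenceBasis K t)

include ht

theorem isPlacesOver_placesOver {p : MvPolynomial (Fin m) K} (hp : Irreducible p) :
    IsPlacesOver t p (placesOver t p) := by
  have h := ht.exists_isPlacesOver hp
  rw [placesOver, dif_pos h]
  exact h.choose_spec

theorem le_one_of_isIntegral_of_mem_finitePlaces {w : Valuation L ℤᵐ⁰} (hw : w ∈ finitePlaces K t)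
    {s : L} (hs : IsIntegral (Algebra.adjoin K (Set.range t)) s) : w s ≤ 1 := by
  obtain ⟨a, ha, hw⟩ := hw
  refine w.le_one_of_isIntegral (fun c hc => ?_) hs
  obtain ⟨Q, rfl⟩ := exists_aeval_eq_of_mem_adjoin hc
  exact (isPlacesOver_placesOver ht ha).aeval_le_one w hw Q

theorem finite_finitePlaces_aeval_ne_one {Q : MvPolynomial (Fin m) K} (hQ : Q ≠ 0) :
    {w ∈ finitePlaces K t | w (aeval t Q) ≠ 1}.Finite := by
  classical
  have hfin : (⋃ p ∈ ((UniqueFactorizationMonoid.factors Q).toFinset.image Associates.mk),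
      (if Irreducible (Quot.out p) then placesOver t (Quot.out p) else ∅)).Finite := by
    refine Set.Finite.biUnion (Finset.finite_toSet _) fun p _ => ?_
    split_ifs with h
    · exact (isPlacesOver_placesOver ht h).finite
    · exact Set.finite_empty
  refine hfin.subset ?_
  rintro w ⟨⟨a, ha, hw⟩, h1⟩
  have hP := isPlacesOver_placesOver ht ha
  have hlt : w (aeval t Q) < 1 := lt_of_le_of_ne (hP.aeval_le_one w hw Q) h1
  rw [hP.aeval_lt_one_iff w hw] at hlt
  obtain ⟨q, hq, hass⟩ := UniqueFactorizationMonoid.exists_mem_factors_of_dvd hQ ha hlt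
  have : Associates.mk q = a := by
    rw [← Associates.mk_eq_mk_iff_associated.mpr hass]
    exact Quot.out_eq a
  simp only [Set.mem_iUnion]
  exact ⟨a, by simpa using ⟨q, hq, this⟩, by rwa [if_pos ha]⟩

theorem exists_aeval_mul_isIntegral (s : L) :
    ∃ c : MvPolynomial (Fin m) K, c ≠ 0 ∧
      IsIntegral (Algebra.adjoin K (Set.range t)) (aeval t c * s) := by
  have := ht.isAlgebraic
  obtain ⟨y, hy, hi⟩ := (Algebra.IsAlgebraic.isAlgebraic (R := Algebra.adjoin K (Set.range t))
    s).exists_integral_multiple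
  obtain ⟨Q, hQ⟩ := exists_aeval_eq_of_mem_adjoin y.2
  refine ⟨Q, ?_, ?_⟩
  · rintro rfl
    exact hy (Subtype.ext (by simpa using hQ.symm))
  · rw [hQ]; exact hi

theorem finite_finitePlaces_one_lt (s : L) :
    {w ∈ finitePlaces K t | 1 < w s}.Finite := by
  obtain ⟨c, hc, hi⟩ := exists_aeval_mul_isIntegral ht s
  refine (finite_finitePlaces_aeval_ne_one ht hc).subset ?_
  rintro w ⟨hw, h1⟩
  refine ⟨hw, fun h => ?_⟩
  have := le_one_of_isIntegral_of_mem_finitePlaces ht hw hi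
  rw [map_mul, h, one_mul] at this
  exact absurd this (not_le.mpr h1)

theorem finite_finitePlaces_ne_one {s : L} (hs : s ≠ 0) :
    {w ∈ finitePlaces K t | w s ≠ 1}.Finite := by
  refine ((finite_finitePlaces_one_lt ht s).union (finite_finitePlaces_one_lt ht s⁻¹)).subset ?_
  rintro w ⟨hw, h1⟩
  rcases lt_or_gt_of_ne h1 with h | h
  · refine Or.inr ⟨hw, ?_⟩
    rw [map_inv₀]
    exact (one_lt_inv₀ (by simpa [zero_lt_iff] using hs)).mpr h
  · exact Or.inl ⟨hw, h⟩

/-- A derivation of `L` preserves the valuation rings of almost all finite places. -/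
theorem finite_finitePlaces_not_derivation_stable (D : Derivation K L L) :
    {w ∈ finitePlaces K t | ¬ ∀ u, w u ≤ 1 → w (D u) ≤ 1}.Finite := by
  obtain ⟨G, hG⟩ := exists_finset_integralClosure_adjoin ht
  have hfin : ((⋃ i : Fin m, {w ∈ finitePlaces K t | 1 < w (D (t i))}) ∪
      ⋃ g ∈ G, {w ∈ finitePlaces K t | 1 < w (D g)}).Finite :=
    (Set.finite_iUnion fun i => finite_finitePlaces_one_lt ht _).union
      (Set.Finite.biUnion G.finite_toSet fun g _ => finite_finitePlaces_one_lt ht _)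
  refine hfin.subset ?_
  rintro w ⟨hw, hns⟩
  by_contra hcon
  simp only [Set.mem_union, Set.mem_iUnion, Set.mem_ofPred_eq, not_or, not_exists, not_and,
    not_lt] at hcon
  obtain ⟨h1, h2⟩ := hcon
  have hint : ∀ s, IsIntegral (Algebra.adjoin K (Set.range t)) s → w s ≤ 1 :=
    fun s hs => le_one_of_isIntegral_of_mem_finitePlaces ht hw hs
  have hA : ∀ Q : MvPolynomial (Fin m) K, w (aeval t Q) ≤ 1 := fun Q =>
    hint _ (isIntegral_algebraMap (x := (⟨_, aeval_mem_adjoin Q⟩ :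
      Algebra.adjoin K (Set.range t))))
  have hDA : ∀ Q : MvPolynomial (Fin m) K, w (D (aeval t Q)) ≤ 1 := by
    intro Q
    rw [Derivation.map_mvPolynomial_aeval]
    refine w.map_sum_le fun i _ => ?_
    rw [map_mul]
    exact mul_le_one' (hA _) (h1 i hw)
  have hB : ∀ s, IsIntegral (Algebra.adjoin K (Set.range t)) s → w (D s) ≤ 1 := by
    intro s hs
    have hs' := hG.2 s hs
    induction hs' using Submodule.span_induction with
    | mem x hx => exact h2 x hx hw
    | zero => simp
    | add x y hx hy ihx ihy =>
      rw [map_add]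
      have hGi : ∀ z ∈ Submodule.span (Algebra.adjoin K (Set.range t)) (G : Set L),
          IsIntegral (Algebra.adjoin K (Set.range t)) z := by
        intro z hz
        have : Submodule.span (Algebra.adjoin K (Set.range t)) (G : Set L) ≤
          Subalgebra.toSubmodule (integralClosure (Algebra.adjoin K (Set.range t)) L) :=
          Submodule.span_le.mpr fun g hg => hG.1 g hg
        exact this hz
      exact (w.map_add _ _).trans (max_le (ihx (hGi _ hx)) (ihy (hGi _ hy)))
    | smul a x hx ihx =>
      have hGi : ∀ z ∈ Submodule.span (Algebra.adjoin K (Set.range t)) (G : Set L),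
          IsIntegral (Algebra.adjoin K (Set.range t)) z := by
        intro z hz
        have : Submodule.span (Algebra.adjoin K (Set.range t)) (G : Set L) ≤
          Subalgebra.toSubmodule (integralClosure (Algebra.adjoin K (Set.range t)) L) :=
          Submodule.span_le.mpr fun g hg => hG.1 g hg
        exact this hz
      obtain ⟨Q, hQ⟩ := exists_aeval_eq_of_mem_adjoin a.2
      have : a • x = aeval t Q * x := by rw [hQ]; rfl
      rw [this, D.leibniz, smul_eq_mul, smul_eq_mul]
      refine (w.map_add _ _).trans (max_le ?_ ?_) <;> rw [map_mul]
      · exact mul_le_one' (hA _) (ihx (hGi _ hx))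
      · exact mul_le_one' (hint _ (hGi _ hx)) (hDA _)
  refine hns fun u hu => ?_
  obtain ⟨q, hq, hwq⟩ := hw
  obtain ⟨a, b, ha, hb, hb1, hab⟩ := (isPlacesOver_placesOver ht hq).exists_eq_div w hwq u hu
  have h3 := congrArg D hab
  rw [D.leibniz, smul_eq_mul, smul_eq_mul] at h3
  have h4 : b * D u = D a - u * D b := by rw [← h3]; ring
  have h5 : w (b * D u) ≤ 1 := by
    rw [h4]
    refine (w.map_sub _ _).trans (max_le (hB a ha) ?_)
    rw [map_mul]
    exact mul_le_one' hu (hB b hb)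
  rwa [map_mul, hb1, one_mul] at h5

end FinitePlaces

section Infinity

variable {K L : Type*} [Field K] [Field L] [Algebra K L] {m : ℕ}

/-- Affine coordinates at infinity. -/
noncomputable def coordInfinity (z : Fin m → L) (j : Fin m) : Fin m → L := fun i =>
  if i = j then (z j)⁻¹ else z i / z j

theorem coordInfinity_self (z : Fin m → L) (j : Fin m) : coordInfinity z j j = (z j)⁻¹ :=
  if_pos rfl

theorem coordInfinity_of_ne (z : Fin m → L) {i j : Fin m} (h : i ≠ j) :
    coordInfinity z j i = z i / z j :=
  if_neg h

variable {z : Fin m → L} (hz : IsTranscendenceBasis K z)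
include hz

theorem adjoin_coordInfinity (j : Fin m) :
    IntermediateField.adjoin K (Set.range (coordInfinity z j)) =
      IntermediateField.adjoin K (Set.range z) := by
  have hz0 : z j ≠ 0 := hz.1.ne_zero j
  apply le_antisymm
  · rw [IntermediateField.adjoin_le_iff]
    rintro _ ⟨i, rfl⟩
    have h : ∀ i, z i ∈ IntermediateField.adjoin K (Set.range z) := fun i =>
      IntermediateField.subset_adjoin _ _ ⟨i, rfl⟩
    by_cases hi : i = j
    · subst hi
      rw [coordInfinity_self]
      exact inv_mem (h _)
    · rw [coordInfinity_of_ne z hi]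
      exact div_mem (h _) (h _)
  · rw [IntermediateField.adjoin_le_iff]
    rintro _ ⟨i, rfl⟩
    have h : ∀ i, coordInfinity z j i ∈
        IntermediateField.adjoin K (Set.range (coordInfinity z j)) := fun i =>
      IntermediateField.subset_adjoin _ _ ⟨i, rfl⟩
    have hj : z j ∈ IntermediateField.adjoin K (Set.range (coordInfinity z j)) := by
      have := inv_mem (h j)
      rwa [coordInfinity_self, inv_inv] at this
    by_cases hi : i = j
    · subst hi; exact hj
    · have := mul_mem (h i) hj
      rwa [coordInfinity_of_ne z hi, div_mul_cancel₀ _ hz0] at this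

open IntermediateField.algebraAdjoinAdjoin in
theorem isTranscendenceBasis_coordInfinity (j : Fin m) :
    IsTranscendenceBasis K (coordInfinity z j) := by
  have h1 : Algebra.IsAlgebraic (IntermediateField.adjoin K (Set.range z)) L :=
    hz.isAlgebraic_field
  rw [← adjoin_coordInfinity hz j] at h1
  have h2 : Algebra.IsAlgebraic (Algebra.adjoin K (Set.range (coordInfinity z j))) L :=
    Algebra.IsAlgebraic.trans _ (IntermediateField.adjoin K (Set.range (coordInfinity z j))) _
  refine Algebra.IsAlgebraic.isTranscendenceBasis_of_lift_le_trdeg_of_finite K _ ?_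
  rw [hz.lift_cardinalMk_eq_trdeg]

/-- The degree of a polynomial is its pole order at infinity. -/
theorem valuation_aeval_of_infinity (j : Fin m) {w : Valuation L ℤᵐ⁰}
    (hw : ∀ c : MvPolynomial (Fin m) K, ¬ X j ∣ c → w (aeval (coordInfinity z j) c) = 1)
    {Q : MvPolynomial (Fin m) K} (hQ : Q ≠ 0) :
    w (aeval z Q) = w (z j) ^ Q.totalDegree := by
  classical
  have hz0 : z j ≠ 0 := hz.1.ne_zero j
  set d := Q.totalDegree with hd
  set σ : (Fin m →₀ ℕ) → (Fin m →₀ ℕ) := fun α => α.update j (d - α.degree) with hσ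
  set Q' : MvPolynomial (Fin m) K := ∑ α ∈ Q.support, monomial (σ α) (Q.coeff α) with hQ'
  have hdeg : ∀ α ∈ Q.support, α.degree ≤ d := fun α hα => by
    rw [hd, Finsupp.degree_eq_sum]
    have := MvPolynomial.le_totalDegree hα
    rwa [Finsupp.sum_fintype _ _ (fun _ => rfl)] at this
  have hsum : ∀ α : Fin m →₀ ℕ, α.degree = α j + ∑ i ∈ Finset.univ.erase j, α i := fun α => by
    rw [Finsupp.degree_eq_sum, Finset.add_sum_erase _ _ (Finset.mem_univ j)]
  have hinj : ∀ α ∈ Q.support, ∀ β ∈ Q.support, σ α = σ β → α = β := by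
    intro α hα β hβ h
    have hne : ∀ i, i ≠ j → α i = β i := fun i hi => by
      have := DFunLike.congr_fun h i
      simpa [hσ, Finsupp.update_apply, hi] using this
    have h2 : ∑ i ∈ Finset.univ.erase j, α i = ∑ i ∈ Finset.univ.erase j, β i :=
      Finset.sum_congr rfl fun i hi => hne i (Finset.ne_of_mem_erase hi)
    have h3 : d - α.degree = d - β.degree := by
      have := DFunLike.congr_fun h j
      simpa [hσ] using this
    have h4 := hdeg α hα
    have h5 := hdeg β hβ
    have h6 := hsum α
    have h7 := hsum β
    ext i
    by_cases hi : i = j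
    · subst hi; omega
    · exact hne i hi
  have hmain : aeval z Q = z j ^ d * aeval (coordInfinity z j) Q' := by
    conv_lhs => rw [Q.as_sum]
    rw [hQ', map_sum, map_sum, Finset.mul_sum]
    refine Finset.sum_congr rfl fun α hα => ?_
    rw [aeval_monomial, aeval_monomial, mul_left_comm]
    congr 1
    rw [Finsupp.prod_fintype _ _ (fun _ => pow_zero _),
      Finsupp.prod_fintype _ _ (fun _ => pow_zero _),
      ← Finset.mul_prod_erase _ _ (Finset.mem_univ j),
      ← Finset.mul_prod_erase _ (fun i => coordInfinity z j i ^ (σ α) i) (Finset.mem_univ j)]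
    have h1 : ∏ i ∈ Finset.univ.erase j, coordInfinity z j i ^ (σ α) i =
        (∏ i ∈ Finset.univ.erase j, z i ^ α i) *
          ((z j) ^ (∑ i ∈ Finset.univ.erase j, α i))⁻¹ := by
      rw [← Finset.prod_pow_eq_pow_sum, ← Finset.prod_inv_distrib, ← Finset.prod_mul_distrib]
      refine Finset.prod_congr rfl fun i hi => ?_
      have hij := Finset.ne_of_mem_erase hi
      rw [coordInfinity_of_ne z hij, div_pow, div_eq_mul_inv]
      simp [hσ, Finsupp.update_apply, hij]
    have h2 : coordInfinity z j j ^ (σ α) j = ((z j) ^ (d - α.degree))⁻¹ := by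
      rw [coordInfinity_self, inv_pow]
      simp [hσ]
    rw [h1, h2]
    have h3 : z j ^ d = z j ^ (α j) * z j ^ (d - α.degree) *
        z j ^ (∑ i ∈ Finset.univ.erase j, α i) := by
      rw [← pow_add, ← pow_add]
      congr 1
      have h4 := hdeg α hα
      have h6 := hsum α
      omega
    rw [h3]
    field_simp
  have hnd : ¬ X j ∣ Q' := by
    rintro ⟨y, hy⟩
    obtain ⟨α, hα, hαd⟩ : ∃ α ∈ Q.support, α.degree = d := by
      have hne : Q.support.Nonempty := by simpa [Finset.nonempty_iff_ne_empty] using hQ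
      obtain ⟨α, hα, h⟩ := Finset.exists_mem_eq_sup Q.support hne (fun s => s.sum fun _ e => e)
      refine ⟨α, hα, ?_⟩
      rw [hd, MvPolynomial.totalDegree, h, Finsupp.degree_eq_sum,
        Finsupp.sum_fintype _ _ (fun _ => rfl)]
    have hc : Q'.coeff (σ α) = Q.coeff α := by
      rw [hQ', coeff_sum, Finset.sum_eq_single α]
      · simp
      · intro β hβ hne
        rw [coeff_monomial, if_neg]
        exact fun h => hne (hinj β hβ α hα h)
      · exact fun h => absurd hα h
    rw [hy, coeff_X_mul', if_neg] at hc
    · exact (mem_support_iff.mp hα) hc.symm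
    · simp [hσ, hαd]
  rw [hmain, map_mul, hw _ hnd, mul_one, map_pow]

end Infinity

section Bounded

variable {K L : Type*} [Field K] [Field L] [Algebra K L] {m : ℕ}

/-- The places of `L` centred in codimension one on the affine space with coordinates `z` or on its
hyperplane at infinity. -/
def allPlaces (K : Type*) {L : Type*} [Field K] [Field L] [Algebra K L] {m : ℕ}
    (z : Fin m → L) (j : Fin m) : Set (Valuation L ℤᵐ⁰) :=
  finitePlaces K z ∪ placesOver (coordInfinity z j) (X j : MvPolynomial (Fin m) K)

theorem exists_pow_mul_le_one {x : ℤᵐ⁰} (hx : x < 1) (hx0 : x ≠ 0) (b : ℤᵐ⁰) :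
    ∃ n : ℕ, x ^ n * b ≤ 1 := by
  obtain ⟨n, hn⟩ := MulArchimedean.arch b ((one_lt_inv₀ (zero_lt_iff.mpr hx0)).mpr hx)
  refine ⟨n, ?_⟩
  rw [inv_pow] at hn
  have := mul_le_mul_right hn (x ^ n)
  rwa [mul_inv_cancel₀ (pow_ne_zero _ hx0)] at this

variable [CharZero K] [Algebra.EssFiniteType K L] {z : Fin m → L} (hz : IsTranscendenceBasis K z)
include hz

theorem exists_aeval_mul_le_one (b : Valuation L ℤᵐ⁰ → ℤᵐ⁰)
    (hb : {w ∈ finitePlaces K z | 1 < b w}.Finite) :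
    ∃ e : MvPolynomial (Fin m) K, e ≠ 0 ∧ ∀ w ∈ finitePlaces K z, w (aeval z e) * b w ≤ 1 := by
  classical
  have key : ∀ w ∈ finitePlaces K z, ∃ e : MvPolynomial (Fin m) K, e ≠ 0 ∧
      w (aeval z e) * b w ≤ 1 := by
    rintro w ⟨a, ha, hw⟩
    have hP := isPlacesOver_placesOver hz ha
    have h1 : w (aeval z (Quot.out a)) < 1 := (hP.aeval_lt_one_iff w hw _).mpr dvd_rfl
    have h0 : w (aeval z (Quot.out a)) ≠ 0 := by
      rw [ne_eq, map_eq_zero]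
      exact (map_ne_zero_iff _ (algebraicIndependent_iff_injective_aeval.mp hz.1)).mpr ha.ne_zero
    obtain ⟨n, hn⟩ := exists_pow_mul_le_one h1 h0 (b w)
    exact ⟨Quot.out a ^ n, pow_ne_zero _ ha.ne_zero, by rwa [map_pow, map_pow]⟩
  choose! e he0 he using key
  refine ⟨∏ w ∈ hb.toFinset, e w, Finset.prod_ne_zero_iff.mpr fun w hw => ?_, fun w hw => ?_⟩
  · exact he0 w ((Set.Finite.mem_toFinset hb).mp hw).1
  · have hle : ∀ Q : MvPolynomial (Fin m) K, w (aeval z Q) ≤ 1 := fun Q =>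
      le_one_of_isIntegral_of_mem_finitePlaces hz hw (isIntegral_algebraMap
        (x := (⟨_, aeval_mem_adjoin Q⟩ : Algebra.adjoin K (Set.range z))))
    by_cases h : 1 < b w
    · have hmem : w ∈ hb.toFinset := (Set.Finite.mem_toFinset hb).mpr ⟨hw, h⟩
      rw [← Finset.mul_prod_erase _ _ hmem, map_mul, map_mul, mul_right_comm]
      exact mul_le_one' (he w hw) (hle _)
    · exact mul_le_one' (hle _) (not_lt.mp h)

theorem infinity_places_facts (j : Fin m) :
    IsPlacesOver (coordInfinity z j) (X j : MvPolynomial (Fin m) K)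
      (placesOver (coordInfinity z j) (X j : MvPolynomial (Fin m) K)) :=
  isPlacesOver_placesOver (isTranscendenceBasis_coordInfinity hz j) (X_prime.irreducible)

theorem infinity_aeval_eq_one (j : Fin m) {w : Valuation L ℤᵐ⁰}
    (hw : w ∈ placesOver (coordInfinity z j) (X j : MvPolynomial (Fin m) K))
    (c : MvPolynomial (Fin m) K) (hc : ¬ X j ∣ c) : w (aeval (coordInfinity z j) c) = 1 := by
  have hP := infinity_places_facts hz j
  refine le_antisymm (hP.aeval_le_one w hw c) (not_lt.mp fun h => hc ?_)
  exact (hP.aeval_lt_one_iff w hw c).mp h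

theorem infinity_one_lt (j : Fin m) {w : Valuation L ℤᵐ⁰}
    (hw : w ∈ placesOver (coordInfinity z j) (X j : MvPolynomial (Fin m) K)) : 1 < w (z j) := by
  have h := ((infinity_places_facts hz j).aeval_lt_one_iff w hw (X j)).mpr dvd_rfl
  rw [aeval_X, coordInfinity_self, map_inv₀] at h
  exact (inv_lt_one₀ (by simpa [zero_lt_iff] using hz.1.ne_zero j)).mp h

theorem exists_infinity_le_pow (j : Fin m) (b : Valuation L ℤᵐ⁰ → ℤᵐ⁰) :
    ∃ N : ℕ, ∀ w ∈ placesOver (coordInfinity z j) (X j : MvPolynomial (Fin m) K),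
      b w ≤ w (z j) ^ N := by
  have key : ∀ w ∈ placesOver (coordInfinity z j) (X j : MvPolynomial (Fin m) K),
      ∃ N : ℕ, b w ≤ w (z j) ^ N := fun w hw =>
    MulArchimedean.arch _ (infinity_one_lt hz j hw)
  choose! N hN using key
  have hfin := (infinity_places_facts hz j).finite
  refine ⟨hfin.toFinset.sup N, fun w hw => (hN w hw).trans ?_⟩
  exact pow_le_pow_right₀ (infinity_one_lt hz j hw).le
    (Finset.le_sup (hfin.mem_toFinset.mpr hw))

/-- If `s` is regular at all finite places and has bounded poles at infinity, then its trace is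
a polynomial of bounded degree. -/
theorem exists_trace_eq_aeval (j : Fin m)
    [FiniteDimensional (IntermediateField.adjoin K (Set.range z)) L] {s : L} {N : ℕ}
    (hs : ∀ w ∈ finitePlaces K z, w s ≤ 1)
    (hs' : ∀ w ∈ placesOver (coordInfinity z j) (X j : MvPolynomial (Fin m) K),
      w s ≤ w (z j) ^ N) :
    ∃ Q : MvPolynomial (Fin m) K, Q.totalDegree ≤ N ∧
      (Algebra.trace (IntermediateField.adjoin K (Set.range z)) L s : L) = aeval z Q := by
  set M := IntermediateField.adjoin K (Set.range z) with hM
  have hinj := algebraicIndependent_iff_injective_aeval.mp hz.1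
  have hz0 : z j ≠ 0 := hz.1.ne_zero j
  have htr : ∀ (c : M) (x : L), (Algebra.trace M L ((c : L) * x) : L) =
      c * (Algebra.trace M L x : L) := fun c x => by
    have : (c : L) * x = c • x := rfl
    rw [this, map_smul, smul_eq_mul]; rfl
  have hAM : ∀ Q : MvPolynomial (Fin m) K, aeval z Q ∈ M := fun Q =>
    IntermediateField.algebra_adjoin_le_adjoin _ _ (aeval_mem_adjoin Q)
  obtain ⟨Q, hQ⟩ : ∃ Q : MvPolynomial (Fin m) K, (Algebra.trace M L s : L) = aeval z Q := by
    obtain ⟨x, hx, y, hy, hxy⟩ := IntermediateField.mem_adjoin_iff_div.mp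
      (Subtype.property (Algebra.trace M L s))
    obtain ⟨x, rfl⟩ := exists_aeval_eq_of_mem_adjoin hx
    obtain ⟨y, rfl⟩ := exists_aeval_eq_of_mem_adjoin hy
    by_cases hy0 : y = 0
    · exact ⟨0, by rw [hxy, hy0]; simp⟩
    obtain ⟨y', x', c', hrel, hyc, hxc⟩ :=
      UniqueFactorizationMonoid.exists_reduced_factors y hy0 x
    have hy'0 : aeval z y' ≠ (0 : L) := (map_ne_zero_iff _ hinj).mpr
      (fun h => hy0 (by rw [← hyc, h, mul_zero]))
    have hc'0 : aeval z c' ≠ (0 : L) := (map_ne_zero_iff _ hinj).mpr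
      (fun h => hy0 (by rw [← hyc, h, zero_mul]))
    have hT : (Algebra.trace M L s : L) * aeval z y' = aeval z x' := by
      rw [hxy, ← hyc, ← hxc, map_mul, map_mul]
      field_simp
    have hunit : IsUnit y' := by
      by_contra hnu
      obtain ⟨q, hq, hqy⟩ := WfDvdMonoid.exists_irreducible_factor hnu
        (fun h => hy'0 (by rw [h, map_zero]))
      set a := Associates.mk q with ha
      have hass : Associated (Quot.out a) q := by
        rw [← Associates.mk_eq_mk_iff_associated]
        exact Quot.out_eq a
      have hirr : Irreducible (Quot.out a) := (hass.irreducible_iff).mpr hq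
      obtain ⟨d, hd, hi⟩ := (isPlacesOver_placesOver hz hirr).exists_isIntegral s
        (fun w hw => hs w ⟨a, hirr, hw⟩)
      have hmem := hz.1.trace_mem_adjoin hM (s := aeval z d * s) hi
      rw [htr ⟨_, hAM d⟩] at hmem
      obtain ⟨c, hc⟩ := exists_aeval_eq_of_mem_adjoin hmem
      have heq : d * x' = c * y' := by
        apply hinj
        rw [map_mul, map_mul, hc, ← hT]
        ring
      have hqd : ¬ q ∣ d := fun h => hd (hass.dvd.trans h)
      have hqx : q ∣ x' := (hq.prime.dvd_or_dvd (heq ▸ hqy.mul_left c)).resolve_left hqd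
      exact hq.not_isUnit (hrel hqy hqx)
    obtain ⟨v, hv⟩ := hunit.exists_right_inv
    refine ⟨x' * v, ?_⟩
    rw [map_mul, ← hT, mul_assoc, ← map_mul, hv, map_one, mul_one]
  refine ⟨Q, ?_, hQ⟩
  by_cases hQ0 : Q = 0
  · simp [hQ0]
  have hti := isTranscendenceBasis_coordInfinity hz j
  have hP := infinity_places_facts hz j
  obtain ⟨d, hd, hi⟩ := hP.exists_isIntegral ((z j)⁻¹ ^ N * s) (fun w hw => by
    rw [map_mul, map_pow, map_inv₀, inv_pow]
    have h1 := pow_pos (zero_lt_one.trans (infinity_one_lt hz j hw)) N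
    have := mul_le_mul_right (hs' w hw) (w (z j) ^ N)⁻¹
    rwa [inv_mul_cancel₀ h1.ne'] at this)
  have hM' : M = IntermediateField.adjoin K (Set.range (coordInfinity z j)) :=
    (adjoin_coordInfinity hz j).symm
  have hmem := hti.1.trace_mem_adjoin hM' (s := aeval (coordInfinity z j) d * ((z j)⁻¹ ^ N * s)) hi
  have hdM : aeval (coordInfinity z j) d * (z j)⁻¹ ^ N ∈ M := by
    refine mul_mem ?_ (pow_mem (inv_mem ?_) _)
    · rw [hM']
      exact IntermediateField.algebra_adjoin_le_adjoin _ _ (aeval_mem_adjoin d)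
    · simpa using hAM (X j)
  rw [← mul_assoc, htr ⟨_, hdM⟩, hQ] at hmem
  obtain ⟨c, hc⟩ := exists_aeval_eq_of_mem_adjoin hmem
  obtain ⟨w, hw⟩ := hP.nonempty
  have h1 := hP.aeval_le_one w hw c
  have hlt := infinity_one_lt hz j hw
  rw [hc] at h1
  simp only [map_mul, map_pow, map_inv₀] at h1
  rw [infinity_aeval_eq_one hz j hw d hd, one_mul,
    valuation_aeval_of_infinity hz j (infinity_aeval_eq_one hz j hw) hQ0] at h1
  have h2 := mul_le_mul_right h1 (w (z j) ^ N)
  rw [← mul_assoc, inv_pow, mul_inv_cancel₀ (pow_ne_zero _ (zero_lt_one.trans hlt).ne'), one_mul,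
    mul_one] at h2
  exact (pow_le_pow_iff_right₀ hlt).mp h2

/-- Elements of `L` with bounded poles form a finite-dimensional space. -/
theorem exists_finiteDimensional_of_bounded (j : Fin m) (b : Valuation L ℤᵐ⁰ → ℤᵐ⁰)
    (hb : {w ∈ allPlaces K z j | 1 < b w}.Finite) :
    ∃ W : Submodule K L, FiniteDimensional K W ∧
      ∀ s, (∀ w ∈ allPlaces K z j, w s ≤ b w) → s ∈ W := by
  classical
  have := hz.finiteDimensional_adjoin
  set M := IntermediateField.adjoin K (Set.range z) with hM
  obtain ⟨e, he0, he⟩ := exists_aeval_mul_le_one hz b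
    (hb.subset fun w hw => ⟨Or.inl hw.1, hw.2⟩)
  obtain ⟨N, hN⟩ := exists_infinity_le_pow hz j b
  obtain ⟨G, B, hB⟩ : ∃ (G : Finset L) (B : Module.Basis G M L),
      ∀ x, IsIntegral (Algebra.adjoin K (Set.range z)) (B x) := by
    open IntermediateField.algebraAdjoinAdjoin in
    exact FiniteDimensional.exists_is_basis_integral (Algebra.adjoin K (Set.range z)) M L
  obtain ⟨N', hN'⟩ := exists_infinity_le_pow hz j (fun w => Finset.univ.sup fun x => w (B x))
  have he0' : aeval z e ≠ (0 : L) :=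
    (map_ne_zero_iff _ (algebraicIndependent_iff_injective_aeval.mp hz.1)).mpr he0
  set N'' := e.totalDegree + N + N'
  let V : Submodule K L := (restrictTotalDegree (Fin m) K N'').map (aeval z).toLinearMap
  let Φ : L →ₗ[K] (G → L) := LinearMap.pi fun x =>
    (M.val.toLinearMap ∘ₗ (Algebra.trace M L).restrictScalars K) ∘ₗ
      LinearMap.mulRight K (aeval z e * B x)
  have hΦ : ∀ s x, Φ s x = (Algebra.trace M L (s * (aeval z e * B x)) : L) := fun s x => rfl
  have hinj : Function.Injective Φ := by
    rw [injective_iff_map_eq_zero]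
    intro s hs
    have h1 : ∀ x, Algebra.trace M L ((s * aeval z e) * B x) = 0 := fun x => by
      have := congrFun hs x
      rw [hΦ, ← mul_assoc] at this
      exact Subtype.ext this
    have h2 : ∀ y, Algebra.trace M L ((s * aeval z e) * y) = 0 := by
      intro y
      have : (Algebra.trace M L) ∘ₗ LinearMap.mulLeft M (s * aeval z e) = 0 :=
        B.ext fun x => h1 x
      exact LinearMap.congr_fun this y
    have h3 : s * aeval z e = 0 := (traceForm_nondegenerate M L).1 _ h2
    exact (mul_eq_zero.mp h3).resolve_right he0'
  let V' : Submodule K (G → L) := Submodule.pi Set.univ fun _ => V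
  refine ⟨V'.comap Φ, ?_, fun s hs => ?_⟩
  · have hV' : FiniteDimensional K V' := by
      let f : V' →ₗ[K] (G → V) := LinearMap.pi fun x =>
        ((LinearMap.proj x).comp V'.subtype).codRestrict V fun v => v.2 x (Set.mem_univ _)
      refine Module.Finite.of_injective f fun u v huv => Subtype.ext (funext fun x => ?_)
      exact congrArg Subtype.val (congrFun huv x)
    refine Module.Finite.of_injective (Φ.restrict (p := V'.comap Φ) (q := V') fun x hx => hx) ?_
    intro u v huv
    exact Subtype.ext (hinj (congrArg Subtype.val huv))
  · refine fun x _ => ?_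
    rw [hΦ]
    obtain ⟨Q, hQ, hQ'⟩ := exists_trace_eq_aeval hz j (s := s * (aeval z e * B x)) (N := N'')
      (fun w hw => by
        rw [← mul_assoc, mul_comm s, map_mul, map_mul]
        refine mul_le_one' ((mul_le_mul_right (hs w (Or.inl hw)) _).trans (he w hw)) ?_
        exact le_one_of_isIntegral_of_mem_finitePlaces hz hw (hB x))
      (fun w hw => by
        have h1 : w (B x) ≤ w (z j) ^ N' :=
          (Finset.le_sup (f := fun x => w (B x)) (Finset.mem_univ x)).trans (hN' w hw)
        have h2 : w s ≤ w (z j) ^ N := (hs w (Or.inr hw)).trans (hN w hw)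
        rw [map_mul, map_mul, valuation_aeval_of_infinity hz j (infinity_aeval_eq_one hz j hw) he0]
        refine (mul_le_mul' h2 (mul_le_mul' le_rfl h1)).trans (le_of_eq ?_)
        rw [← pow_add, ← pow_add]
        congr 1
        omega)
    exact ⟨Q, (mem_restrictTotalDegree _ _ _).mpr hQ, hQ'.symm⟩

end Bounded

theorem IsTranscendenceBasis.exists_derivation {K L ι : Type*} [Field K] [Field L] [Algebra K L]
    [CharZero K] {t : ι → L} (ht : IsTranscendenceBasis K t) (d : ι → L) :
    ∃ D : Derivation K L L, ∀ i, D (t i) = d i := by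
  let A := MvPolynomial ι K
  let M := FractionRing A
  let : Algebra A L := (aeval t).toAlgebra
  have hA : ∀ a : A, algebraMap A L a = aeval t a := fun _ => rfl
  have : IsScalarTower K A L := .of_algebraMap_eq fun x => by
    rw [hA, MvPolynomial.algebraMap_eq, aeval_C]
  have hinj : Function.Injective (algebraMap A L) := algebraicIndependent_iff_injective_aeval.mp ht.1
  have : FaithfulSMul A L := (faithfulSMul_iff_algebraMap_injective A L).mpr hinj
  let : Algebra M L := FractionRing.liftAlgebra A L
  have : IsScalarTower A M L := inferInstance
  have : CharZero M := charZero_of_injective_algebraMap (algebraMap K M).injective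
  have h1 : Algebra.IsAlgebraic (Algebra.adjoin K (Set.range t)) L := ht.isAlgebraic
  have h2 : Algebra.IsAlgebraic A L := by
    refine ⟨fun s => ?_⟩
    obtain ⟨p, hp, hp0⟩ := h1.isAlgebraic s
    let e := ht.1.aevalEquiv
    refine ⟨p.map (e.symm : _ →+* A), ((Polynomial.map_injective (e.symm : _ →+* A) e.symm.injective).ne_iff'
      (Polynomial.map_zero _)).mpr hp, ?_⟩
    rw [Polynomial.aeval_def, Polynomial.eval₂_map, ← hp0, Polynomial.aeval_def]
    congr 1
    ext x
    obtain ⟨y, rfl⟩ := e.surjective x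
    simp [hA, e]
  have : Algebra.IsAlgebraic M L :=
    (IsFractionRing.comap_isAlgebraic_iff (A := A) (K := M) (C := L)).mp h2
  have : Algebra.FormallyEtale A M := Algebra.FormallyEtale.of_isLocalization (nonZeroDivisors A)
  have : Algebra.FormallyEtale M L := Algebra.FormallyEtale.of_isSeparable M L
  have : Algebra.FormallyEtale A L := Algebra.FormallyEtale.comp A M L
  let D₀ : Derivation K A L := mkDerivation K d
  let e := KaehlerDifferential.tensorKaehlerEquivOfFormallyEtale K A L
  let f : TensorProduct A L (Ω[A⁄K]) →ₗ[L] L := D₀.liftKaehlerDifferential.liftBaseChange L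
  refine ⟨(f ∘ₗ e.symm.toLinearMap).compDer (KaehlerDifferential.D K L), fun i => ?_⟩
  have h3 : t i = algebraMap A L (X i) := by rw [hA, aeval_X]
  rw [h3]
  change f (e.symm (KaehlerDifferential.D K L (algebraMap A L (X i)))) = d i
  rw [KaehlerDifferential.tensorKaehlerEquivOfFormallyEtale_symm_D_algebraMap]
  simp only [f, LinearMap.liftBaseChange_tmul, Derivation.liftKaehlerDifferential_comp_D, one_smul]
  exact mkDerivation_X K d i

theorem AlgebraicIndependent.exists_derivation {K L ι : Type*} [Field K] [Field L] [Algebra K L]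
    [CharZero K] {t : ι → L} (ht : AlgebraicIndependent K t) (d : ι → L) :
    ∃ D : Derivation K L L, ∀ i, D (t i) = d i := by
  obtain ⟨s, hs, hb⟩ := exists_isTranscendenceBasis_superset (s := Set.range t) ht.to_subtype_range
  obtain ⟨D, hD⟩ := hb.exists_derivation (Function.extend t d 0 ∘ Subtype.val)
  refine ⟨D, fun i => ?_⟩
  have := hD ⟨t i, hs ⟨i, rfl⟩⟩
  simpa [ht.injective.extend_apply] using this

section Bounds

variable {k Γ : Type*} [Field k] [LinearOrderedCommGroupWithZero Γ] (w : Valuation k Γ)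

theorem Valuation.le_of_isRoot_of_coeff_le {p : Polynomial k} (hp : p.Monic) {ξ : k}
    (hξ : p.IsRoot ξ) {ρ : Γ} (h : ∀ i < p.natDegree, w (p.coeff i) ≤ ρ ^ (p.natDegree - i)) :
    w ξ ≤ ρ := by
  by_contra! hlt
  have hξ0 : w ξ ≠ 0 := (zero_le.trans_lt hlt).ne'
  have h0 := hξ.eq_zero
  rw [Polynomial.eval_eq_sum_range, Finset.sum_range_succ, hp.coeff_natDegree, one_mul] at h0
  have h1 : w (∑ i ∈ Finset.range p.natDegree, p.coeff i * ξ ^ i) < w (ξ ^ p.natDegree) := by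
    refine w.map_sum_lt (by simpa using fun h => absurd h (w.ne_zero_iff.mp hξ0)) fun i hi => ?_
    have hi := Finset.mem_range.mp hi
    rw [map_mul, map_pow, map_pow]
    calc w (p.coeff i) * w ξ ^ i ≤ ρ ^ (p.natDegree - i) * w ξ ^ i :=
          mul_le_mul_left (h i hi) _
      _ < w ξ ^ (p.natDegree - i) * w ξ ^ i := by
          refine mul_lt_mul_of_pos_right (pow_lt_pow_left₀ hlt zero_le (by omega)) ?_
          exact pow_pos (zero_lt_iff.mpr hξ0) _
      _ = w ξ ^ p.natDegree := by rw [← pow_add]; congr 1; omega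
  rw [eq_neg_of_add_eq_zero_left h0, Valuation.map_neg] at h1
  exact lt_irrefl _ h1

theorem Valuation.coeff_divByMonic_X_sub_C_le {p : Polynomial k} {ξ : k} {c : Γ} {a : ℕ}
    (h : ∀ i ∈ Finset.Icc (a + 1) p.natDegree, w ξ ^ (i - (a + 1)) * w (p.coeff i) ≤ c) :
    w ((p /ₘ (Polynomial.X - Polynomial.C ξ)).coeff a) ≤ c := by
  rw [Polynomial.coeff_divByMonic_X_sub_C]
  refine w.map_sum_le fun i hi => ?_
  rw [map_mul, map_pow]
  exact h i hi

theorem Valuation.aeval_le_pow_totalDegree {K ι : Type*} [Field K] [Algebra K k]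
    (hK : ∀ c : K, w (algebraMap K k c) ≤ 1) {x : ι → k} {ρ : Γ} (hρ : 1 ≤ ρ)
    (hx : ∀ i, w (x i) ≤ ρ) (Q : MvPolynomial ι K) :
    w (aeval x Q) ≤ ρ ^ Q.totalDegree := by
  rw [aeval_def, eval₂_eq]
  refine w.map_sum_le fun s hs => ?_
  rw [map_mul, map_prod]
  have h1 : ∏ i ∈ s.support, w (x i ^ s i) ≤ ∏ i ∈ s.support, ρ ^ s i := by
    refine Finset.prod_le_prod' fun i _ => ?_
    rw [map_pow]
    exact pow_le_pow_left₀ zero_le (hx i) _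
  rw [Finset.prod_pow_eq_pow_sum] at h1
  calc _ ≤ 1 * ρ ^ (∑ i ∈ s.support, s i) := mul_le_mul' (hK _) h1
    _ = ρ ^ (∑ i ∈ s.support, s i) := one_mul _
    _ ≤ ρ ^ Q.totalDegree := pow_le_pow_right₀ hρ (le_totalDegree hs)

end Bounds

section Trace

variable {K L : Type*} [Field K] [Field L] [Algebra K L] {m : ℕ} {z : Fin m → L}
  [CharZero K] [Algebra.EssFiniteType K L] (hz : IsTranscendenceBasis K z)
include hz

theorem valuation_infinity_le (j : Fin m) {w : Valuation L ℤᵐ⁰}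
    (hw : w ∈ placesOver (coordInfinity z j) (X j : MvPolynomial (Fin m) K)) (i : Fin m) :
    w (z i) ≤ w (z j) := by
  by_cases hi : i = j
  · rw [hi]
  · have h := (infinity_places_facts hz j).aeval_le_one w hw (X i)
    rw [aeval_X, coordInfinity_of_ne z hi, map_div₀] at h
    exact (div_le_one₀ (zero_lt_one.trans (infinity_one_lt hz j hw))).mp h

theorem valuation_infinity_algebraMap_le (j : Fin m) {w : Valuation L ℤᵐ⁰}
    (hw : w ∈ placesOver (coordInfinity z j) (X j : MvPolynomial (Fin m) K)) (c : K) :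
    w (algebraMap K L c) ≤ 1 := by
  simpa using (infinity_places_facts hz j).aeval_le_one w hw (C c)

theorem exists_trace_eq_aeval_of_isIntegral
    [FiniteDimensional (IntermediateField.adjoin K (Set.range z)) L] {s : L} {N : ℕ}
    (hs : IsIntegral (Algebra.adjoin K (Set.range z)) s)
    (hs' : ∀ j, ∀ w ∈ placesOver (coordInfinity z j) (X j : MvPolynomial (Fin m) K),
      w s ≤ w (z j) ^ N) :
    ∃ Q : MvPolynomial (Fin m) K, Q.totalDegree ≤ N ∧
      (Algebra.trace (IntermediateField.adjoin K (Set.range z)) L s : L) = aeval z Q := by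
  rcases m with - | m
  · obtain ⟨Q, hQ⟩ := exists_aeval_eq_of_mem_adjoin (hz.1.trace_mem_adjoin rfl hs)
    refine ⟨Q, ?_, hQ.symm⟩
    rw [eq_C_of_isEmpty Q, totalDegree_C]
    exact Nat.zero_le _
  · exact exists_trace_eq_aeval hz 0
      (fun w hw => le_one_of_isIntegral_of_mem_finitePlaces hz hw hs) (hs' 0)

/-- The traces of the coefficients of the product of two divided differences are polynomials of
controlled degree. -/
theorem exists_trace_coeff_divByMonic
    [FiniteDimensional (IntermediateField.adjoin K (Set.range z)) L]
    {p : Polynomial (MvPolynomial (Fin m) K)} (hp : p.Monic)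
    (hpdeg : ∀ i < p.natDegree, (p.coeff i).totalDegree ≤ p.natDegree - i)
    {G : Polynomial (MvPolynomial (Fin (m + 1)) K)} (hG : G.Monic) {c : ℕ}
    (hGdeg : ∀ i, (G.coeff i).totalDegree ≤ c) {ξ η : L}
    (hξ : (p.map (aeval z : _ →ₐ[K] L).toRingHom).IsRoot ξ)
    (hη : (G.map (aeval (Fin.cons ξ z : Fin (m + 1) → L) : _ →ₐ[K] L).toRingHom).IsRoot η)
    (a b : ℕ) (ha : a < p.natDegree) :
    ∃ Q : MvPolynomial (Fin m) K,
      Q.totalDegree ≤ (p.natDegree - 1 - a) + c * (G.natDegree + 1) ∧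
      (Algebra.trace (IntermediateField.adjoin K (Set.range z)) L
        ((p.map (aeval z : _ →ₐ[K] L).toRingHom /ₘ
            (Polynomial.X - Polynomial.C ξ)).coeff a *
          (G.map (aeval (Fin.cons ξ z : Fin (m + 1) → L) : _ →ₐ[K] L).toRingHom /ₘ
            (Polynomial.X - Polynomial.C η)).coeff b) : L) = aeval z Q := by
  set x : Fin (m + 1) → L := Fin.cons ξ z with hx
  set A := Algebra.adjoin K (Set.range z)
  set p' := p.map (aeval z : _ →ₐ[K] L).toRingHom with hp'
  set G' := G.map (aeval x : _ →ₐ[K] L).toRingHom with hG'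
  have hp'd : p'.natDegree = p.natDegree := hp.natDegree_map _
  have hG'd : G'.natDegree = G.natDegree := hG.natDegree_map _
  have hp'c : ∀ i, p'.coeff i = aeval z (p.coeff i) := fun i => Polynomial.coeff_map _ _
  have hG'c : ∀ i, G'.coeff i = aeval x (G.coeff i) := fun i => Polynomial.coeff_map _ _
  have hint0 : ∀ Q : MvPolynomial (Fin m) K, IsIntegral A (aeval z Q) := fun Q =>
    isIntegral_algebraMap (x := (⟨_, aeval_mem_adjoin Q⟩ : A))
  have hintroot : ∀ {f : Polynomial L} {r : L}, f.Monic → f.IsRoot r →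
      (∀ i, IsIntegral A (f.coeff i)) → IsIntegral A r := by
    intro f r hf hr hi
    have h1 : IsIntegral (integralClosure A L) r := by
      have hl : f ∈ Polynomial.lifts (algebraMap (integralClosure A L) L) :=
        (Polynomial.lifts_iff_coeff_lifts _).mpr fun i => ⟨⟨_, hi i⟩, rfl⟩
      obtain ⟨g, hg, -, hgm⟩ := Polynomial.lifts_and_natDegree_eq_and_monic hl hf
      exact ⟨g, hgm, by rw [← Polynomial.eval_map, hg]; exact hr⟩
    exact isIntegral_trans _ h1
  have hintξ : IsIntegral A ξ :=
    hintroot (hp.map _) hξ fun i => by rw [hp'c]; exact hint0 _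
  have hintx : ∀ Q : MvPolynomial (Fin (m + 1)) K, IsIntegral A (aeval x Q) := by
    intro Q
    have hxi : ∀ i, IsIntegral A (x i) := by
      intro i
      refine Fin.cases ?_ (fun i => ?_) i
      · simpa [hx] using hintξ
      · simpa [hx] using hint0 (X i)
    induction Q using MvPolynomial.induction_on with
    | C r => rw [aeval_C, ← aeval_C (S₁ := L) (f := z)]; exact hint0 (C r)
    | add f g hf hg => rw [map_add]; exact hf.add hg
    | mul_X f i hf => rw [map_mul, aeval_X]; exact hf.mul (hxi i)
  have hintη : IsIntegral A η :=
    hintroot (hG.map _) hη fun i => by rw [hG'c]; exact hintx _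
  have hintc : ∀ {f : Polynomial L} {r : L} (n : ℕ), IsIntegral A r →
      (∀ i, IsIntegral A (f.coeff i)) →
      IsIntegral A ((f /ₘ (Polynomial.X - Polynomial.C r)).coeff n) := by
    intro f r n hr hf
    rw [Polynomial.coeff_divByMonic_X_sub_C]
    exact IsIntegral.sum _ fun i _ => (hr.pow _).mul (hf i)
  refine exists_trace_eq_aeval_of_isIntegral hz (IsIntegral.mul (hintc _ hintξ fun i => ?_)
    (hintc _ hintη fun i => ?_)) ?_
  · rw [hp'c]; exact hint0 _
  · rw [hG'c]; exact hintx _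
  · intro j w hw
    have hK := valuation_infinity_algebraMap_le hz j hw
    have hzρ := valuation_infinity_le hz j hw
    set ρ := w (z j)
    have hρ : 1 ≤ ρ := (infinity_one_lt hz j hw).le
    have hpρ : ∀ i ≤ p.natDegree, w (p'.coeff i) ≤ ρ ^ (p.natDegree - i) := by
      intro i hi
      rcases hi.lt_or_eq with hi | rfl
      · rw [hp'c]
        exact (w.aeval_le_pow_totalDegree hK hρ hzρ _).trans (pow_le_pow_right₀ hρ (hpdeg i hi))
      · rw [hp'c, hp.coeff_natDegree, map_one, map_one, Nat.sub_self, pow_zero]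
    have hξρ : w ξ ≤ ρ := w.le_of_isRoot_of_coeff_le (hp.map _) hξ fun i hi => by
      rw [hp'd] at hi ⊢
      exact hpρ i hi.le
    have hxρ : ∀ i, w (x i) ≤ ρ := fun i => by
      refine Fin.cases ?_ (fun i => ?_) i
      · simpa [hx] using hξρ
      · simpa [hx] using hzρ i
    have hGρ : ∀ i, w (G'.coeff i) ≤ ρ ^ c := fun i => by
      rw [hG'c]
      exact (w.aeval_le_pow_totalDegree hK hρ hxρ _).trans (pow_le_pow_right₀ hρ (hGdeg i))
    have hηρ : w η ≤ ρ ^ c := w.le_of_isRoot_of_coeff_le (hG.map _) hη fun i hi =>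
      (hGρ i).trans (le_self_pow₀ (one_le_pow₀ hρ) (by omega))
    rw [map_mul, pow_add]
    refine mul_le_mul' (w.coeff_divByMonic_X_sub_C_le fun i hi => ?_)
      (w.coeff_divByMonic_X_sub_C_le fun i hi => ?_)
    · rw [Finset.mem_Icc, hp'd] at hi
      refine (mul_le_mul' (pow_le_pow_left₀ zero_le hξρ _) (hpρ i hi.2)).trans_eq ?_
      rw [← pow_add]; congr 1; omega
    · rw [Finset.mem_Icc, hG'd] at hi
      refine (mul_le_mul' (pow_le_pow_left₀ zero_le hηρ _) (hGρ i)).trans ?_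
      rw [← pow_mul, ← pow_add]
      refine pow_le_pow_right₀ hρ ?_
      rw [← Nat.mul_succ]
      exact Nat.mul_le_mul_left _ (by omega)

end Trace

section FinSucc

variable {K : Type*} [Field K] {n : ℕ}

theorem MvPolynomial.finSuccEquiv_pderiv_zero (Q : MvPolynomial (Fin (n + 1)) K) :
    finSuccEquiv K n (pderiv 0 Q) = Polynomial.derivative (finSuccEquiv K n Q) := by
  induction Q using MvPolynomial.induction_on with
  | C a => simp [finSuccEquiv_apply]
  | add f g hf hg => simp [hf, hg]
  | mul_X f i hf =>
    rw [Derivation.leibniz, map_add, smul_eq_mul, smul_eq_mul, map_mul, map_mul, map_mul, hf,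
      Polynomial.derivative_mul]
    refine Fin.cases ?_ (fun i => ?_) i
    · simp [finSuccEquiv_X_zero]; ring
    · simp [finSuccEquiv_X_succ]; ring

theorem MvPolynomial.aeval_cons_eq_eval {A : Type*} [Field A] [Algebra K A] (ξ : A) (z : Fin n → A)
    (Q : MvPolynomial (Fin (n + 1)) K) :
    aeval (Fin.cons ξ z : Fin (n + 1) → A) Q =
      ((finSuccEquiv K n Q).map (aeval z : _ →ₐ[K] A).toRingHom).eval ξ := by
  induction Q using MvPolynomial.induction_on with
  | C a => simp [finSuccEquiv_apply]
  | add f g hf hg => simp [hf, hg]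
  | mul_X f i hf =>
    rw [map_mul, hf, map_mul, Polynomial.map_mul, Polynomial.eval_mul, aeval_X]
    congr 1
    refine Fin.cases ?_ (fun i => ?_) i
    · simp [finSuccEquiv_X_zero]
    · simp [finSuccEquiv_X_succ]

end FinSucc

section Generic

variable {K L : Type*} [Field K] [Field L] [Algebra K L] {n : ℕ}
  (π : Polynomial (MvPolynomial (Fin (n + 1)) K) →ₐ[K] L)

theorem algHom_polynomial_C (a : MvPolynomial (Fin (n + 1)) K) :
    π (Polynomial.C a) = aeval (Fin.cons (π (Polynomial.C (X 0)))
      (fun i => π (Polynomial.C (X i.succ))) : Fin (n + 1) → L) a := by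
  induction a using MvPolynomial.induction_on with
  | C a =>
    rw [aeval_C, ← π.commutes]; rfl
  | add f g hf hg => rw [Polynomial.C_add, map_add, map_add, hf, hg]
  | mul_X f i hf =>
    rw [Polynomial.C_mul, map_mul, map_mul, hf, aeval_X]
    congr 1
    refine Fin.cases ?_ (fun i => ?_) i <;> simp

theorem algHom_polynomial_eq_eval (Q : Polynomial (MvPolynomial (Fin (n + 1)) K)) :
    π Q = (Q.map (aeval (Fin.cons (π (Polynomial.C (X 0)))
      (fun i => π (Polynomial.C (X i.succ))) : Fin (n + 1) → L) : _ →ₐ[K] L).toRingHom).eval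
        (π Polynomial.X) := by
  induction Q using Polynomial.induction_on' with
  | add f g hf hg => simp [hf, hg]
  | monomial k a =>
    rw [← Polynomial.C_mul_X_pow_eq_monomial, map_mul, map_pow, algHom_polynomial_C,
      Polynomial.map_mul, Polynomial.map_pow, Polynomial.map_C, Polynomial.map_X,
      Polynomial.eval_mul, Polynomial.eval_C, Polynomial.eval_pow, Polynomial.eval_X]
    rfl

variable {π} {q : MvPolynomial (Fin (n + 1)) K} (hq : (finSuccEquiv K n q).Monic)
  (hπ : ∀ a, π (Polynomial.C a) = 0 ↔ q ∣ a)
include hq hπ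

theorem algebraicIndependent_of_monic :
    AlgebraicIndependent K fun i : Fin n => π (Polynomial.C (X i.succ)) := by
  rw [algebraicIndependent_iff_injective_aeval, injective_iff_map_eq_zero]
  intro Q hQ
  have h1 : π (Polynomial.C ((finSuccEquiv K n).symm (Polynomial.C Q))) = 0 := by
    rw [algHom_polynomial_C, aeval_cons_eq_eval, AlgEquiv.apply_symm_apply, Polynomial.map_C,
      Polynomial.eval_C]
    exact hQ
  rw [hπ] at h1
  have h2 := map_dvd (finSuccEquiv K n) h1
  rw [AlgEquiv.apply_symm_apply] at h2
  have h3 : (finSuccEquiv K n q).natDegree ≠ 0 := fun h => by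
    rw [hq.natDegree_eq_zero] at h
    have : q = 1 := (finSuccEquiv K n).injective (by rw [h, map_one])
    have h4 := (hπ 1).mpr (this ▸ dvd_rfl)
    simp at h4
  by_contra hQ0
  obtain ⟨r, hr⟩ := h2
  have hr0 : r ≠ 0 := fun h => hQ0 (by simpa [h] using hr)
  have := congrArg Polynomial.natDegree hr
  rw [Polynomial.natDegree_C, hq.natDegree_mul' hr0] at this
  omega

theorem isTranscendenceBasis_of_monic
    (hfrac : ∀ s : L, ∃ a b, π b ≠ 0 ∧ s = π a / π b)
    {G : Polynomial (MvPolynomial (Fin (n + 1)) K)} (hG : G.Monic) (hG0 : π G = 0) :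
    IsTranscendenceBasis K fun i : Fin n => π (Polynomial.C (X i.succ)) := by
  set z : Fin n → L := fun i => π (Polynomial.C (X i.succ)) with hz
  have hind := algebraicIndependent_of_monic hq hπ
  rw [isTranscendenceBasis_iff_algebraicIndependent_isAlgebraic]
  refine ⟨hind, ?_⟩
  let A := Algebra.adjoin K (Set.range z)
  have hzi : ∀ Q : MvPolynomial (Fin n) K, aeval z Q ∈ integralClosure A L := fun Q =>
    isIntegral_algebraMap (x := (⟨_, aeval_mem_adjoin Q⟩ : A))
  have hroot : ∀ {f : Polynomial L} {r : L}, f.Monic → f.eval r = 0 →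
      (∀ i, f.coeff i ∈ integralClosure A L) → r ∈ integralClosure A L := by
    intro f r hf hr hi
    have h1 : IsIntegral (integralClosure A L) r := by
      have hl : f ∈ Polynomial.lifts (algebraMap (integralClosure A L) L) :=
        (Polynomial.lifts_iff_coeff_lifts _).mpr fun i => ⟨⟨_, hi i⟩, rfl⟩
      obtain ⟨g, hg, -, hgm⟩ := Polynomial.lifts_and_natDegree_eq_and_monic hl hf
      exact ⟨g, hgm, by rw [← Polynomial.eval_map, hg]; exact hr⟩
    exact isIntegral_trans _ h1
  have h0 : π (Polynomial.C (X 0)) ∈ integralClosure A L := by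
    refine hroot (f := (finSuccEquiv K n q).map (aeval z : _ →ₐ[K] L).toRingHom) (hq.map _) ?_
      fun i => ?_
    · rw [← aeval_cons_eq_eval, ← algHom_polynomial_C]
      exact (hπ q).mpr dvd_rfl
    · rw [Polynomial.coeff_map]; exact hzi _
  have hC : ∀ a, π (Polynomial.C a) ∈ integralClosure A L := by
    intro a
    induction a using MvPolynomial.induction_on with
    | C a =>
      have : π (Polynomial.C (C a)) = aeval z (C a : MvPolynomial (Fin n) K) := by
        rw [aeval_C, ← π.commutes]; rfl
      rw [this]; exact hzi _
    | add f g hf hg => rw [Polynomial.C_add, map_add]; exact add_mem hf hg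
    | mul_X f i hf =>
      rw [Polynomial.C_mul, map_mul]
      refine mul_mem hf ?_
      refine Fin.cases h0 (fun i => ?_) i
      have := hzi (X i)
      rwa [aeval_X] at this
  have hη : π Polynomial.X ∈ integralClosure A L := by
    refine hroot (hG.map _) ((algHom_polynomial_eq_eval π G).symm.trans hG0) fun i => ?_
    rw [Polynomial.coeff_map]
    change aeval _ (G.coeff i) ∈ _
    rw [← algHom_polynomial_C]
    exact hC _
  have hall : ∀ Q, π Q ∈ integralClosure A L := by
    intro Q
    induction Q using Polynomial.induction_on' with
    | add f g hf hg => rw [map_add]; exact add_mem hf hg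
    | monomial k a =>
      rw [← Polynomial.C_mul_X_pow_eq_monomial, map_mul, map_pow]
      exact mul_mem (hC a) (pow_mem hη k)
  refine ⟨fun s => ?_⟩
  obtain ⟨a, b, hb, rfl⟩ := hfrac s
  have h1 : IsAlgebraic A (π a) := IsIntegral.isAlgebraic (hall a)
  have h2 : IsAlgebraic A (π b) := IsIntegral.isAlgebraic (hall b)
  rw [div_eq_mul_inv]
  exact h1.mul h2.inv

end Generic

theorem Polynomial.derivative_eval_of_isRoot {k : Type*} [Field k] {p : Polynomial k} {r : k}
    (hr : p.IsRoot r) :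
    (p /ₘ (Polynomial.X - Polynomial.C r)).eval r = (Polynomial.derivative p).eval r := by
  have h := Polynomial.mul_divByMonic_eq_iff_isRoot.mpr hr
  conv_rhs => rw [← h]
  simp [Polynomial.derivative_mul]

section Kernel

universe u v

variable {K : Type u} {L : Type u} [Field K] [Field L] [Algebra K L] {n : ℕ}
  [CharZero K] [Algebra.EssFiniteType K L]
  {π : Polynomial (MvPolynomial (Fin (n + 1)) K) →ₐ[K] L}
  {q : MvPolynomial (Fin (n + 1)) K} {G : Polynomial (MvPolynomial (Fin (n + 1)) K)}

theorem exists_trace_kernel (hq : (finSuccEquiv K n q).Monic)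
    (hqd : (finSuccEquiv K n q).natDegree = q.totalDegree)
    (hπ : ∀ a, π (Polynomial.C a) = 0 ↔ q ∣ a)
    (hfrac : ∀ s : L, ∃ a b, π b ≠ 0 ∧ s = π a / π b)
    (hG : G.Monic) (hG0 : π G = 0) {c : ℕ} (hGdeg : ∀ i, (G.coeff i).totalDegree ≤ c) :
    ∃ N : Polynomial (MvPolynomial (Fin (n + 1)) K), N.natDegree ≤ G.natDegree ∧
      (∀ i, (N.coeff i).totalDegree ≤ (q.totalDegree - 1) + c * (G.natDegree + 1)) ∧
      ∀ (Ω : Type u) [Field Ω] [Algebra K Ω] [IsAlgClosed Ω]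
        (π' : Polynomial (MvPolynomial (Fin (n + 1)) K) →ₐ[K] Ω),
        (∀ a, π' (Polynomial.C a) = 0 ↔ q ∣ a) → π' G = 0 →
        ((¬ ∃ σ : L →ₐ[K] Ω, ∀ f, σ (π f) = π' f) → π' N = 0) ∧
        (∀ σ : L →ₐ[K] Ω, (∀ f, σ (π f) = π' f) →
          π' N = π' (Polynomial.C (pderiv 0 q) * Polynomial.derivative G)) := by
  set z : Fin n → L := fun i => π (Polynomial.C (X i.succ)) with hz
  set ξ : L := π (Polynomial.C (X 0)) with hξ
  set η : L := π Polynomial.X with hη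
  have hzt : IsTranscendenceBasis K z := isTranscendenceBasis_of_monic hq hπ hfrac hG hG0
  set p := finSuccEquiv K n q with hp
  have hfd := hzt.finiteDimensional_adjoin
  set M := IntermediateField.adjoin K (Set.range z) with hM
  set pL := p.map (aeval z : _ →ₐ[K] L).toRingHom with hpL
  set gL := G.map (aeval (Fin.cons ξ z : Fin (n + 1) → L) : _ →ₐ[K] L).toRingHom with hgL
  have hpdeg : ∀ i < p.natDegree, (p.coeff i).totalDegree ≤ p.natDegree - i := by
    intro i hi
    by_cases h0 : p.coeff i = 0
    · simp [h0]
    · have := totalDegree_coeff_finSuccEquiv_add_le q i h0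
      rw [hqd]; rw [← hp] at this; omega
  have hpr : pL.IsRoot ξ := by
    rw [Polynomial.IsRoot, hpL, ← aeval_cons_eq_eval, hξ, hz, ← algHom_polynomial_C]
    exact (hπ q).mpr dvd_rfl
  have hGr : gL.IsRoot η := by
    rw [Polynomial.IsRoot, hgL, hη, hξ, hz, ← algHom_polynomial_eq_eval]
    exact hG0
  have hT := fun a b => exists_trace_coeff_divByMonic hzt hq hpdeg hG hGdeg hpr hGr a b
  choose! T hTdeg hTeq using fun a (ha : a < p.natDegree) b => hT a b ha
  set p1 := pL /ₘ (Polynomial.X - Polynomial.C ξ) with hp1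
  set G1 := gL /ₘ (Polynomial.X - Polynomial.C η) with hG1
  have hpLd : pL.natDegree = p.natDegree := hq.natDegree_map _
  have hgLd : gL.natDegree = G.natDegree := hG.natDegree_map _
  have hp0 : p.natDegree ≠ 0 := fun h => by
    rw [hq.natDegree_eq_zero] at h
    rw [hpL, h] at hpr
    simp at hpr
  have hp1d : p1.natDegree < p.natDegree := by
    rw [hp1, Polynomial.natDegree_divByMonic _ (Polynomial.monic_X_sub_C ξ), hpLd,
      Polynomial.natDegree_X_sub_C]
    omega
  have hG1d : G1.natDegree < G.natDegree + 1 := by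
    rw [hG1, Polynomial.natDegree_divByMonic _ (Polynomial.monic_X_sub_C η), hgLd]
    omega
  refine ⟨∑ a ∈ Finset.range p.natDegree, ∑ b ∈ Finset.range (G.natDegree + 1),
    Polynomial.C (rename Fin.succ (T a b) * X 0 ^ a) * Polynomial.X ^ b, ?_, ?_, ?_⟩
  · refine Polynomial.natDegree_sum_le_of_forall_le _ _ fun a _ =>
      Polynomial.natDegree_sum_le_of_forall_le _ _ fun b hb => ?_
    exact (Polynomial.natDegree_C_mul_X_pow_le _ _).trans
      (Nat.lt_succ_iff.mp (Finset.mem_range.mp hb))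
  · intro i
    rw [Polynomial.finsetSum_coeff]
    refine totalDegree_finsetSum_le fun a ha => ?_
    rw [Polynomial.finsetSum_coeff]
    refine totalDegree_finsetSum_le fun b hb => ?_
    rw [Polynomial.coeff_C_mul_X_pow]
    split_ifs
    · refine (totalDegree_mul _ _).trans ?_
      have h1 := (totalDegree_rename_le Fin.succ (T a b)).trans
        (hTdeg a (Finset.mem_range.mp ha) b)
      have h2 : ((X 0 : MvPolynomial (Fin (n + 1)) K) ^ a).totalDegree = a :=
        totalDegree_X_pow _ _
      have := Finset.mem_range.mp ha
      rw [h2, ← hqd]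
      omega
    · simp
  · intro Ω _ _ _ π' hπ' hG'
    set z' : Fin n → Ω := fun i => π' (Polynomial.C (X i.succ)) with hz'
    set ξ' : Ω := π' (Polynomial.C (X 0)) with hξ'
    set η' : Ω := π' Polynomial.X with hη'
    have hzi' : AlgebraicIndependent K z' := algebraicIndependent_of_monic hq hπ'
    let σ1 : FractionRing (MvPolynomial (Fin n) K) →ₐ[K] Ω :=
      IsFractionRing.liftAlgHom (g := (aeval z' : _ →ₐ[K] Ω)) hzi'
    have hπC : ∀ a, π (Polynomial.C a) = aeval (Fin.cons ξ z : Fin (n + 1) → L) a :=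
      algHom_polynomial_C π
    have hπC' : ∀ a, π' (Polynomial.C a) = aeval (Fin.cons ξ' z' : Fin (n + 1) → Ω) a :=
      algHom_polynomial_C π'
    have hπe : ∀ Q, π Q = (Q.map (aeval (Fin.cons ξ z : Fin (n + 1) → L) :
        _ →ₐ[K] L).toRingHom).eval η := algHom_polynomial_eq_eval π
    have hσ1 : ∀ Q, σ1 (algebraMap _ _ Q) = aeval z' Q := fun Q =>
      IsFractionRing.lift_algebraMap (g := (aeval z' : _ →ₐ[K] Ω).toRingHom) hzi' Q
    let σ0 : M →ₐ[K] Ω := σ1.comp hzt.1.aevalEquivField.symm.toAlgHom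
    have hσ0 : ∀ (Q : MvPolynomial (Fin n) K) (s : M), (s : L) = aeval z Q →
        σ0 s = aeval z' Q := by
      intro Q s hs
      have : s = hzt.1.aevalEquivField (algebraMap _ _ Q) := by
        apply Subtype.ext
        rw [hs, hzt.1.aevalEquivField_algebraMap_apply_coe]
      rw [this]
      change σ1 (hzt.1.aevalEquivField.symm _) = _
      rw [AlgEquiv.symm_apply_apply, hσ1]
    let _ : Algebra M Ω := σ0.toRingHom.toAlgebra
    have hσK : ∀ σ : L →ₐ[↥M] Ω, ∀ r : K, σ (algebraMap K L r) = algebraMap K Ω r := by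
      intro σ r
      rw [IsScalarTower.algebraMap_apply K M L]
      exact (σ.commutes _).trans (σ0.commutes r)
    have hσz : ∀ σ : L →ₐ[↥M] Ω, ∀ Q : MvPolynomial (Fin n) K, σ (aeval z Q) = aeval z' Q := by
      intro σ Q
      obtain ⟨s, hs⟩ : ∃ s : M, (s : L) = aeval z Q :=
        ⟨hzt.1.aevalEquivField (algebraMap _ _ Q),
          hzt.1.aevalEquivField_algebraMap_apply_coe Q⟩
      rw [← hs, ← hσ0 Q s hs]
      exact σ.commutes s
    have hσx : ∀ σ : L →ₐ[↥M] Ω, ∀ Q : MvPolynomial (Fin (n + 1)) K, σ (aeval (Fin.cons ξ z : Fin (n + 1) → L) Q) =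
        aeval (Fin.cons (σ ξ) z' : Fin (n + 1) → Ω) Q := by
      intro σ Q
      induction Q using MvPolynomial.induction_on with
      | C r => rw [aeval_C, aeval_C, hσK]
      | add f g hf hg => rw [map_add, map_add, map_add, hf, hg]
      | mul_X f i hf =>
        rw [map_mul, map_mul, map_mul, hf, aeval_X, aeval_X]
        congr 1
        refine Fin.cases (by simp) (fun i => ?_) i
        have := hσz σ (X i)
        simpa using this
    have hN : π' (∑ a ∈ Finset.range p.natDegree, ∑ b ∈ Finset.range (G.natDegree + 1),
        Polynomial.C (rename Fin.succ (T a b) * X 0 ^ a) * Polynomial.X ^ b) =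
        ∑ σ : L →ₐ[↥M] Ω, (p1.map (σ : L →+* Ω)).eval ξ' * (G1.map (σ : L →+* Ω)).eval η' := by
      have h1 : ∀ σ : L →ₐ[↥M] Ω,
          (p1.map (σ : L →+* Ω)).eval ξ' * (G1.map (σ : L →+* Ω)).eval η' =
          ∑ a ∈ Finset.range p.natDegree, ∑ b ∈ Finset.range (G.natDegree + 1),
            σ (p1.coeff a * G1.coeff b) * (ξ' ^ a * η' ^ b) := by
        intro σ
        rw [Polynomial.eval_eq_sum_range' (n := p.natDegree)
            (Polynomial.natDegree_map_le.trans_lt hp1d),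
          Polynomial.eval_eq_sum_range' (n := G.natDegree + 1)
            (Polynomial.natDegree_map_le.trans_lt hG1d), Finset.sum_mul_sum]
        refine Finset.sum_congr rfl fun a _ => ?_
        refine Finset.sum_congr rfl fun b _ => ?_
        rw [Polynomial.coeff_map, Polynomial.coeff_map, map_mul]
        simp only [RingHom.coe_coe]
        ring
      rw [Fintype.sum_congr _ _ h1, map_sum]
      refine Eq.trans ?_ Finset.sum_comm
      refine Finset.sum_congr rfl ?_
      intro a ha
      rw [map_sum]
      refine Eq.trans ?_ Finset.sum_comm
      refine Finset.sum_congr rfl ?_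
      intro b _
      rw [← Finset.sum_mul, ← trace_eq_sum_embeddings]
      have h2 := hσ0 _ _ (hTeq a (Finset.mem_range.mp ha) b)
      change _ = σ0 _ * _
      rw [h2, map_mul, Polynomial.C_mul, map_mul, Polynomial.C_pow, map_pow, map_pow, mul_assoc]
      congr 1
      rw [algHom_polynomial_C, aeval_rename]
      congr 1
    have hpz : ∀ σ : L →ₐ[↥M] Ω, pL.map (σ : L →+* Ω) =
        p.map (aeval z' : _ →ₐ[K] Ω).toRingHom := by
      intro σ
      ext i
      simp only [hpL, Polynomial.coeff_map]
      exact hσz σ _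
    have hGz : ∀ σ : L →ₐ[↥M] Ω, gL.map (σ : L →+* Ω) =
        G.map (aeval (Fin.cons (σ ξ) z' : Fin (n + 1) → Ω) : _ →ₐ[K] Ω).toRingHom := by
      intro σ
      ext i
      simp only [hgL, Polynomial.coeff_map]
      exact hσx σ _
    have hterm : ∀ σ : L →ₐ[↥M] Ω,
        (p1.map (σ : L →+* Ω)).eval ξ' * (G1.map (σ : L →+* Ω)).eval η' ≠ 0 →
        σ ξ = ξ' ∧ σ η = η' := by
      intro σ hσ
      have h1 : σ ξ = ξ' := by
        have h := congrArg (fun f : Polynomial L => (f.map (σ : L →+* Ω)).eval ξ')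
          (Polynomial.mul_divByMonic_eq_iff_isRoot.mpr hpr)
        simp only [Polynomial.map_mul, Polynomial.eval_mul] at h
        rw [hpz, ← aeval_cons_eq_eval] at h
        rw [hξ', hz', ← algHom_polynomial_C, (hπ' q).mpr dvd_rfl, mul_eq_zero] at h
        rcases h with h | h
        · simp only [Polynomial.map_sub, Polynomial.map_X, Polynomial.map_C, Polynomial.eval_sub,
            Polynomial.eval_X, Polynomial.eval_C, sub_eq_zero] at h
          exact h.symm
        · exact absurd h (left_ne_zero_of_mul hσ)
      refine ⟨h1, ?_⟩
      have h := congrArg (fun f : Polynomial L => (f.map (σ : L →+* Ω)).eval η')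
        (Polynomial.mul_divByMonic_eq_iff_isRoot.mpr hGr)
      simp only [Polynomial.map_mul, Polynomial.eval_mul] at h
      rw [hGz, h1] at h
      rw [hη', hξ', hz', ← algHom_polynomial_eq_eval, hG', mul_eq_zero] at h
      rcases h with h | h
      · simp only [Polynomial.map_sub, Polynomial.map_X, Polynomial.map_C, Polynomial.eval_sub,
          Polynomial.eval_X, Polynomial.eval_C, sub_eq_zero] at h
        exact h.symm
      · exact absurd h (right_ne_zero_of_mul hσ)
    have hcomp : ∀ σ : L →ₐ[↥M] Ω, σ ξ = ξ' → σ η = η' → ∀ f, σ (π f) = π' f := by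
      intro σ h1 h2 f
      induction f using Polynomial.induction_on' with
      | add f g hf hg => rw [map_add, map_add, map_add, hf, hg]
      | monomial k a =>
        rw [← Polynomial.C_mul_X_pow_eq_monomial, map_mul, map_pow, map_mul, map_pow, map_mul,
          map_pow]
        rw [← hη, ← hη', h2, hπC, hπC', hσx, h1]
    rw [hN]
    refine ⟨fun hno => Finset.sum_eq_zero fun σ _ => ?_, fun σ hσ => ?_⟩
    · by_contra hne
      obtain ⟨h1, h2⟩ := hterm σ hne
      refine hno ⟨{ (σ : L →+* Ω) with commutes' := hσK σ }, hcomp σ h1 h2⟩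
    · have hσM : σ.comp (IsScalarTower.toAlgHom K M L) = σ0 := by
        refine IntermediateField.algHom_ext_of_eq_adjoin K hM ?_
        rintro x ⟨i, rfl⟩
        rw [hσ0 (X i) _ (by rw [aeval_X]), aeval_X]
        exact hσ _
      let τ : L →ₐ[↥M] Ω := { (σ : L →+* Ω) with
        commutes' := fun s => DFunLike.congr_fun hσM s }
      have hτ : ∀ s, τ s = σ s := fun _ => rfl
      rw [Finset.sum_eq_single τ]
      · have e1 : ξ' = (τ : L →+* Ω) ξ := (hσ _).symm
        have e2 : η' = (τ : L →+* Ω) η := (hσ _).symm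
        rw [e1, e2, Polynomial.eval_map_apply, Polynomial.eval_map_apply,
          Polynomial.derivative_eval_of_isRoot hpr, Polynomial.derivative_eval_of_isRoot hGr,
          ← map_mul]
        change σ _ = _
        rw [← hσ]
        congr 1
        rw [map_mul, hπC, aeval_cons_eq_eval, finSuccEquiv_pderiv_zero, hπe, hpL, hgL, Polynomial.derivative_map,
          Polynomial.derivative_map]
      · intro ρ _ hρ
        by_contra hne
        obtain ⟨h1, h2⟩ := hterm ρ hne
        refine hρ (AlgHom.ext fun s => ?_)
        obtain ⟨a, b, hb, rfl⟩ := hfrac s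
        rw [map_div₀, map_div₀, hcomp ρ h1 h2, hcomp ρ h1 h2, hτ, hτ, hσ, hσ]
      · simp

end Kernel

section PrimeKernel

universe u

theorem essFiniteType_fractionRing (K B : Type*) [CommRing K] [CommRing B] [Algebra K B]
    [Algebra.FiniteType K B] : Algebra.EssFiniteType K (FractionRing B) := by
  have : Algebra.EssFiniteType B (FractionRing B) :=
    Algebra.EssFiniteType.of_isLocalization _ (nonZeroDivisors B)
  exact Algebra.EssFiniteType.comp K B _

/-- The map from a `K`-algebra to the residue field at a prime ideal. -/
noncomputable def toResidueFractionRing (K : Type*) {B : Type*} [Field K] [CommRing B]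
    [Algebra K B] (P : Ideal B) [P.IsPrime] : B →ₐ[K] FractionRing (B ⧸ P) :=
  (IsScalarTower.toAlgHom K (B ⧸ P) (FractionRing (B ⧸ P))).comp (Ideal.Quotient.mkₐ K P)

theorem toResidueFractionRing_eq_zero (K : Type*) {B : Type*} [Field K] [CommRing B]
    [Algebra K B] (P : Ideal B) [P.IsPrime] (b : B) :
    toResidueFractionRing K P b = 0 ↔ b ∈ P := by
  change algebraMap (B ⧸ P) (FractionRing (B ⧸ P)) (Ideal.Quotient.mk P b) = 0 ↔ _
  rw [FaithfulSMul.algebraMap_eq_zero_iff, Ideal.Quotient.eq_zero_iff_mem]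

theorem exists_eq_toResidueFractionRing_div (K : Type*) {B : Type*} [Field K] [CommRing B]
    [Algebra K B] (P : Ideal B) [P.IsPrime] (s : FractionRing (B ⧸ P)) :
    ∃ a b : B, toResidueFractionRing K P b ≠ 0 ∧
      s = toResidueFractionRing K P a / toResidueFractionRing K P b := by
  obtain ⟨a, b, hb, rfl⟩ := IsFractionRing.div_surjective (A := B ⧸ P) s
  obtain ⟨a, rfl⟩ := Ideal.Quotient.mk_surjective a
  obtain ⟨b, rfl⟩ := Ideal.Quotient.mk_surjective b
  refine ⟨a, b, ?_, rfl⟩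
  change algebraMap (B ⧸ P) (FractionRing (B ⧸ P)) (Ideal.Quotient.mk P b) ≠ 0
  rw [ne_eq, FaithfulSMul.algebraMap_eq_zero_iff]
  exact nonZeroDivisors.ne_zero hb

variable {K : Type u} [Field K] [CharZero K] {n : ℕ}
  {q : MvPolynomial (Fin (n + 1)) K} {G : Polynomial (MvPolynomial (Fin (n + 1)) K)}

theorem exists_prime_kernel_of_monic (hq : (finSuccEquiv K n q).Monic)
    (hqd : (finSuccEquiv K n q).natDegree = q.totalDegree)
    (hG : G.Monic) {c : ℕ} (hGdeg : ∀ i, (G.coeff i).totalDegree ≤ c)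
    {P : Ideal (Polynomial (MvPolynomial (Fin (n + 1)) K))} [P.IsPrime]
    (hP : ∀ a, Polynomial.C a ∈ P ↔ q ∣ a) (hGP : G ∈ P) :
    ∃ N : Polynomial (MvPolynomial (Fin (n + 1)) K), N.natDegree ≤ G.natDegree ∧
      (∀ i, (N.coeff i).totalDegree ≤ (q.totalDegree - 1) + c * (G.natDegree + 1)) ∧
      N - Polynomial.C (pderiv 0 q) * Polynomial.derivative G ∈ P ∧
      ∀ P' : Ideal (Polynomial (MvPolynomial (Fin (n + 1)) K)), P'.IsPrime →
        (∀ a, Polynomial.C a ∈ P' ↔ q ∣ a) → G ∈ P' → P' ≠ P → N ∈ P' := by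
  have : Algebra.EssFiniteType K
      (FractionRing (Polynomial (MvPolynomial (Fin (n + 1)) K) ⧸ P)) := by
    have h2 : Algebra.FiniteType K (Polynomial (MvPolynomial (Fin (n + 1)) K)) :=
      Algebra.FiniteType.trans (S := MvPolynomial (Fin (n + 1)) K) inferInstance inferInstance
    have h3 : Algebra.FiniteType K (Polynomial (MvPolynomial (Fin (n + 1)) K) ⧸ P) :=
      h2.of_surjective (Ideal.Quotient.mkₐ K P) (Ideal.Quotient.mkₐ_surjective K P)
    exact essFiniteType_fractionRing K _
  have hz := toResidueFractionRing_eq_zero K P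
  obtain ⟨N, h1, h2, h3⟩ := exists_trace_kernel (π := toResidueFractionRing K P) hq hqd
    (fun a => (hz _).trans (hP a)) (exists_eq_toResidueFractionRing_div K P) hG
    ((hz G).mpr hGP) hGdeg
  have key : ∀ (P' : Ideal (Polynomial (MvPolynomial (Fin (n + 1)) K))) [P'.IsPrime] (f),
      (IsScalarTower.toAlgHom K _ (AlgebraicClosure
        (FractionRing (Polynomial (MvPolynomial (Fin (n + 1)) K) ⧸ P')))).comp
        (toResidueFractionRing K P') f = 0 ↔ f ∈ P' := fun P' _ f => by
    rw [← toResidueFractionRing_eq_zero K P']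
    exact map_eq_zero (algebraMap (FractionRing
      (Polynomial (MvPolynomial (Fin (n + 1)) K) ⧸ P')) (AlgebraicClosure (FractionRing
      (Polynomial (MvPolynomial (Fin (n + 1)) K) ⧸ P'))))
  refine ⟨N, h1, h2, ?_, fun P' hP' hq' hG' hne => ?_⟩
  · have := (h3 _ _ (fun a => (key P _).trans (hP a)) ((key P _).mpr hGP)).2
      (IsScalarTower.toAlgHom K _ _) (fun f => rfl)
    rw [← sub_eq_zero, ← map_sub, key P] at this
    exact this
  · refine (key P' _).mp ((h3 _ _ (fun a => (key P' _).trans (hq' a))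
      ((key P' _).mpr hG')).1 ?_)
    rintro ⟨σ, hσ⟩
    refine hne (Ideal.ext fun f => ?_)
    rw [← key P', ← hσ, map_eq_zero, hz]

end PrimeKernel

section Direction

universe u

variable {K : Type u} [Field K] {n : ℕ}

theorem MvPolynomial.totalDegree_aeval_le {σ τ : Type*} {f : σ → MvPolynomial τ K}
    (hf : ∀ i, (f i).totalDegree ≤ 1) (Q : MvPolynomial σ K) :
    (aeval f Q).totalDegree ≤ Q.totalDegree := by
  rw [aeval_def, eval₂_eq]
  refine totalDegree_finsetSum_le fun s hs => ?_
  refine (totalDegree_mul _ _).trans ?_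
  rw [algebraMap_eq, totalDegree_C, zero_add]
  refine (totalDegree_finsetProd _ _).trans (le_trans ?_ (le_totalDegree hs))
  exact Finset.sum_le_sum fun i _ => (totalDegree_pow _ _).trans
    ((Nat.mul_le_mul_left _ (hf i)).trans_eq (mul_one _))

theorem MvPolynomial.homogeneousComponent_totalDegree_ne_zero {σ : Type*}
    {Q : MvPolynomial σ K} (hQ : Q ≠ 0) : homogeneousComponent Q.totalDegree Q ≠ 0 := by
  obtain ⟨s, hs, hd⟩ := Finset.exists_mem_eq_sup Q.support (support_nonempty.mpr hQ)
    (fun s => s.sum fun _ e => e)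
  intro h
  have h1 := congrArg (coeff s) h
  rw [coeff_homogeneousComponent, if_pos, coeff_zero] at h1
  · exact mem_support_iff.mp hs h1
  · rw [totalDegree, hd]; rfl

/-- The linear change of variables moving the zeroth coordinate vector to `v`. -/
noncomputable def linearShift (v : Fin (n + 1) → K) :
    MvPolynomial (Fin (n + 1)) K →ₐ[K] MvPolynomial (Fin (n + 1)) K :=
  aeval (Fin.cons (C (v 0) * X 0) fun i => X i.succ + C (v i.succ) * X 0)

theorem linearShift_X_zero (v : Fin (n + 1) → K) : linearShift v (X 0) = C (v 0) * X 0 := by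
  simp [linearShift]

theorem linearShift_X_succ (v : Fin (n + 1) → K) (i : Fin n) :
    linearShift v (X i.succ) = X i.succ + C (v i.succ) * X 0 := by
  simp [linearShift]

theorem linearShift_C (v : Fin (n + 1) → K) (a : K) : linearShift v (C a) = C a :=
  (linearShift v).commutes a

theorem totalDegree_linearShift_le (v : Fin (n + 1) → K) (Q : MvPolynomial (Fin (n + 1)) K) :
    (linearShift v Q).totalDegree ≤ Q.totalDegree := by
  have h : ∀ r : K, (C r * X 0 : MvPolynomial (Fin (n + 1)) K).totalDegree ≤ 1 := fun r => by
    refine (totalDegree_mul _ _).trans ?_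
    rw [totalDegree_C, totalDegree_X]
  refine totalDegree_aeval_le (fun i => ?_) Q
  refine Fin.cases ?_ (fun i => ?_) i
  · simpa using h (v 0)
  · simp only [Fin.cons_succ]
    exact (totalDegree_add _ _).trans (max_le (totalDegree_X _).le (h _))

/-- The inverse direction of `linearShift`. -/
noncomputable def invDirection (v : Fin (n + 1) → K) : Fin (n + 1) → K :=
  Fin.cons (v 0)⁻¹ fun i => -(v 0)⁻¹ * v i.succ

theorem linearShift_invDirection {v : Fin (n + 1) → K} (hv : v 0 ≠ 0) :
    (linearShift v).comp (linearShift (invDirection v)) = AlgHom.id K _ := by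
  refine MvPolynomial.algHom_ext fun i => ?_
  refine Fin.cases ?_ (fun i => ?_) i
  · rw [AlgHom.comp_apply, linearShift_X_zero, map_mul, linearShift_C, linearShift_X_zero,
      ← mul_assoc, ← C_mul]
    simp [invDirection, hv]
  · rw [AlgHom.comp_apply, linearShift_X_succ, map_add, map_mul, linearShift_C,
      linearShift_X_zero, linearShift_X_succ, ← mul_assoc, ← C_mul, AlgHom.id_apply, add_assoc,
      ← add_mul, ← C_add]
    have : v i.succ + invDirection v i.succ * v 0 = 0 := by
      simp only [invDirection, Fin.cons_succ]; field_simp; ring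
    rw [this]; simp

theorem invDirection_invDirection {v : Fin (n + 1) → K} (hv : v 0 ≠ 0) :
    invDirection (invDirection v) = v := by
  ext i
  refine Fin.cases ?_ (fun i => ?_) i
  · simp [invDirection]
  · simp only [invDirection, Fin.cons_succ, Fin.cons_zero]; field_simp

/-- `linearShift` as an automorphism. -/
noncomputable def linearShiftEquiv (v : Fin (n + 1) → K) (hv : v 0 ≠ 0) :
    MvPolynomial (Fin (n + 1)) K ≃ₐ[K] MvPolynomial (Fin (n + 1)) K :=
  AlgEquiv.ofAlgHom (linearShift v) (linearShift (invDirection v))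
    (linearShift_invDirection hv) (by
      have := linearShift_invDirection (v := invDirection v) (by simpa [invDirection] using hv)
      rwa [invDirection_invDirection hv] at this)

theorem pderiv_zero_linearShift (v : Fin (n + 1) → K) (Q : MvPolynomial (Fin (n + 1)) K) :
    pderiv 0 (linearShift v Q) = linearShift v (∑ i, C (v i) * pderiv i Q) := by
  induction Q using MvPolynomial.induction_on with
  | C a => rw [linearShift_C]; simp
  | add f g hf hg =>
    simp only [map_add, mul_add, Finset.sum_add_distrib] at hf hg ⊢
    rw [hf, hg]
  | mul_X f j hf =>
    have h1 : ∑ i, C (v i) * pderiv i (f * X j) =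
        (∑ i, C (v i) * pderiv i f) * X j + C (v j) * f := by
      simp only [Derivation.leibniz, smul_eq_mul, mul_add, Finset.sum_add_distrib]
      rw [add_comm (∑ i, _) (∑ i, _), Finset.sum_mul, Finset.sum_eq_single (f := fun i => C (v i) *
        (f * pderiv i (X j))) j (fun i _ hij => by rw [pderiv_X_of_ne hij.symm]; simp) (by simp),
        pderiv_X_self]
      congr 1
      · exact Finset.sum_congr rfl fun i _ => by ring
      · ring
    have h2 : pderiv 0 (linearShift v (X j)) = C (v j) := by
      refine Fin.cases ?_ (fun j => ?_) j
      · rw [linearShift_X_zero, pderiv_C_mul, pderiv_X_self, mul_one]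
      · rw [linearShift_X_succ, map_add, pderiv_C_mul, pderiv_X_self, mul_one,
          pderiv_X_of_ne (Fin.succ_ne_zero _), zero_add]
    rw [h1, map_mul, Derivation.leibniz, hf, h2, map_add, map_mul, map_mul, linearShift_C,
      smul_eq_mul, smul_eq_mul]
    ring

theorem coeff_finSuccEquiv_linearShift (v : Fin (n + 1) → K)
    (Q : MvPolynomial (Fin (n + 1)) K) :
    (finSuccEquiv K n (linearShift v Q)).coeff Q.totalDegree =
      C (eval v (homogeneousComponent Q.totalDegree Q)) := by
  set d := Q.totalDegree
  obtain ⟨r, hr⟩ : ∃ r, (finSuccEquiv K n (linearShift v Q)).coeff d = C r := by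
    by_cases h : (finSuccEquiv K n (linearShift v Q)).coeff d = 0
    · exact ⟨0, by rw [h, C_0]⟩
    · have h1 := totalDegree_coeff_finSuccEquiv_add_le _ d h
      have h2 := totalDegree_linearShift_le v Q
      exact ⟨_, totalDegree_eq_zero_iff_eq_C.mp (by omega)⟩
  rw [hr]
  congr 1
  let ε : Polynomial (MvPolynomial (Fin n) K) →ₐ[K] Polynomial K :=
    Polynomial.mapAlgHom (aeval (0 : Fin n → K))
  have h1 : (ε.comp (finSuccEquiv K n).toAlgHom).comp (linearShift v) =
      aeval fun i => Polynomial.C (v i) * Polynomial.X := by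
    refine MvPolynomial.algHom_ext fun i => ?_
    refine Fin.cases ?_ (fun i => ?_) i
    · rw [AlgHom.comp_apply, linearShift_X_zero, AlgHom.comp_apply]
      simp [ε, finSuccEquiv_apply]
    · rw [AlgHom.comp_apply, linearShift_X_succ, AlgHom.comp_apply]
      simp [ε, finSuccEquiv_apply]
  have h2 := congrArg (fun f : Polynomial K => f.coeff d) (DFunLike.congr_fun h1 Q)
  have h3 : ((ε.comp (finSuccEquiv K n).toAlgHom).comp (linearShift v) Q).coeff d = r := by
    change (Polynomial.map _ (finSuccEquiv K n (linearShift v Q))).coeff d = r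
    rw [Polynomial.coeff_map, hr]
    exact aeval_C _ _
  rw [← h3]
  refine h2.trans ?_
  rw [aeval_def, eval₂_eq, Polynomial.finsetSum_coeff, homogeneousComponent_apply, map_sum,
    Finset.sum_filter]
  refine Finset.sum_congr rfl fun s _ => ?_
  have h4 : ∏ i ∈ s.support, (Polynomial.C (v i) * Polynomial.X) ^ s i =
      Polynomial.C (∏ i ∈ s.support, v i ^ s i) * Polynomial.X ^ s.degree := by
    simp only [mul_pow, Finset.prod_mul_distrib, map_prod, map_pow]
    rw [Finset.prod_pow_eq_pow_sum]; rfl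
  rw [h4, ← mul_assoc, ← Polynomial.C_eq_algebraMap, ← Polynomial.C_mul,
    Polynomial.coeff_C_mul_X_pow]
  simp only [eq_comm (a := d)]
  split_ifs
  · rw [eval_monomial]; rfl
  · rfl

end Direction

section Residue

universe u

variable {K : Type u} [Field K] [CharZero K] {n : ℕ}
  {q : MvPolynomial (Fin (n + 1)) K} {G : Polynomial (MvPolynomial (Fin (n + 1)) K)}
  (hG : G.Monic) {c : ℕ} (hGdeg : ∀ i, (G.coeff i).totalDegree ≤ c)
  {P : Ideal (Polynomial (MvPolynomial (Fin (n + 1)) K))} [P.IsPrime]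
  (hP : ∀ a, Polynomial.C a ∈ P ↔ q ∣ a) (hGP : G ∈ P)
include hG hGdeg hP hGP

theorem exists_prime_kernel_direction {v : Fin (n + 1) → K} (hv : v 0 ≠ 0)
    (hqv : eval v (homogeneousComponent q.totalDegree q) ≠ 0) :
    ∃ N : Polynomial (MvPolynomial (Fin (n + 1)) K), N.natDegree ≤ G.natDegree ∧
      (∀ i, (N.coeff i).totalDegree ≤ (q.totalDegree - 1) + c * (G.natDegree + 1)) ∧
      N - Polynomial.C (∑ i, C (v i) * pderiv i q) * Polynomial.derivative G ∈ P ∧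
      ∀ P' : Ideal (Polynomial (MvPolynomial (Fin (n + 1)) K)), P'.IsPrime →
        (∀ a, Polynomial.C a ∈ P' ↔ q ∣ a) → G ∈ P' → P' ≠ P → N ∈ P' := by
  set α := linearShiftEquiv v hv with hα
  have hαa : ∀ a, α a = linearShift v a := fun _ => rfl
  have hαs : ∀ a, α.symm a = linearShift (invDirection v) a := fun _ => rfl
  set r := eval v (homogeneousComponent q.totalDegree q) with hr
  have hCr : IsUnit (C r : MvPolynomial (Fin (n + 1)) K) := (isUnit_iff_ne_zero.mpr hqv).map C
  have hdeg : ∀ a, (α a).totalDegree = a.totalDegree := fun a =>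
    le_antisymm (totalDegree_linearShift_le v a) (by
      conv_lhs => rw [← α.symm_apply_apply a]
      exact totalDegree_linearShift_le _ _)
  set q' : MvPolynomial (Fin (n + 1)) K := C r⁻¹ * α q with hq'
  have hq'r : α q = C r * q' := by
    rw [hq', ← mul_assoc, ← C_mul, mul_inv_cancel₀ hqv, C_1, one_mul]
  have hq'd : q'.totalDegree = q.totalDegree := by
    rw [← hdeg q, hq'r]
    refine le_antisymm ?_ ((totalDegree_mul _ _).trans (by rw [totalDegree_C, zero_add]))
    rw [hq'r.symm, hq']
    exact (totalDegree_mul _ _).trans (by rw [totalDegree_C, zero_add])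
  have hq'c : (finSuccEquiv K n q').coeff q.totalDegree = 1 := by
    have := coeff_finSuccEquiv_linearShift v q
    rw [hq', map_mul, finSuccEquiv_apply, eval₂Hom_C, hαa]
    rw [RingHom.comp_apply, Polynomial.coeff_C_mul, this, ← hr, ← C_mul, inv_mul_cancel₀ hqv, C_1]
  have hq'le : (finSuccEquiv K n q').natDegree ≤ q.totalDegree := by
    refine Polynomial.natDegree_le_iff_coeff_eq_zero.mpr fun i hi => ?_
    by_contra h
    have := totalDegree_coeff_finSuccEquiv_add_le q' i h
    omega
  have hmon : (finSuccEquiv K n q').Monic :=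
    Polynomial.monic_of_natDegree_le_of_coeff_eq_one _ hq'le hq'c
  have hnd : (finSuccEquiv K n q').natDegree = q'.totalDegree := by
    rw [hq'd]
    refine le_antisymm hq'le (Polynomial.le_natDegree_of_ne_zero ?_)
    rw [hq'c]; exact one_ne_zero
  let β := Polynomial.mapAlgEquiv α
  have hβc : ∀ f i, (β f).coeff i = α (f.coeff i) := fun f i => Polynomial.coeff_map _ _
  have hβsc : ∀ f i, (β.symm f).coeff i = α.symm (f.coeff i) := fun f i =>
    Polynomial.coeff_map _ _
  have hβC : ∀ a, β.symm (Polynomial.C a) = Polynomial.C (α.symm a) := fun a =>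
    Polynomial.map_C _
  have hβd : ∀ f, Polynomial.derivative (β f) = β (Polynomial.derivative f) := fun f =>
    Polynomial.derivative_map _ _
  have hβn : ∀ f, (β f).natDegree = f.natDegree := fun f =>
    Polynomial.natDegree_map_eq_of_injective α.injective _
  have hβsn : ∀ f, (β.symm f).natDegree = f.natDegree := fun f =>
    Polynomial.natDegree_map_eq_of_injective α.symm.injective _
  have htrans : ∀ P' : Ideal (Polynomial (MvPolynomial (Fin (n + 1)) K)),
      (∀ a, Polynomial.C a ∈ P' ↔ q ∣ a) →
      ∀ a, Polynomial.C a ∈ P'.comap β.symm ↔ q' ∣ a := by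
    intro P' h a
    rw [Ideal.mem_comap, hβC, h, ← map_dvd_iff α, α.apply_symm_apply, hq'r, hCr.mul_left_dvd]
  have hPp : (P.comap β.symm).IsPrime := Ideal.comap_isPrime _ _
  obtain ⟨N, h1, h2, h3, h4⟩ := exists_prime_kernel_of_monic hmon hnd
    (G := β G) (hG.map _) (c := c) (fun i => by rw [hβc, hdeg]; exact hGdeg i)
    (P := P.comap β.symm) (htrans P hP)
    (by rw [Ideal.mem_comap, β.symm_apply_apply]; exact hGP)
  refine ⟨Polynomial.C (C r) * β.symm N, ?_, fun i => ?_, ?_, fun P' hP' hq' hG' hne => ?_⟩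
  · refine (Polynomial.natDegree_C_mul_le _ _).trans ?_
    rw [hβsn]; rwa [hβn] at h1
  · rw [Polynomial.coeff_C_mul, hβsc, hαs]
    refine (totalDegree_mul _ _).trans ?_
    rw [totalDegree_C, zero_add]
    refine (totalDegree_linearShift_le _ _).trans ((h2 i).trans_eq ?_)
    rw [hq'd, hβn]
  · rw [Ideal.mem_comap, map_sub, map_mul, hβC, hβd, β.symm_apply_apply] at h3
    have h5 : (C r : MvPolynomial (Fin (n + 1)) K) * α.symm (pderiv 0 q') =
        ∑ i, C (v i) * pderiv i q := by
      rw [hq', pderiv_C_mul, map_mul, hαa, pderiv_zero_linearShift, ← hαa, α.symm_apply_apply,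
        hαs, linearShift_C, ← mul_assoc, ← C_mul, mul_inv_cancel₀ hqv, C_1, one_mul]
    have h6 := P.mul_mem_left (Polynomial.C (C r)) h3
    rwa [mul_sub, ← mul_assoc, ← Polynomial.C_mul, h5] at h6
  · refine P'.mul_mem_left _ ?_
    refine h4 (P'.comap β.symm) (Ideal.comap_isPrime _ _) (htrans P' hq') ?_ fun h => hne ?_
    · rw [Ideal.mem_comap, β.symm_apply_apply]; exact hG'
    · exact Ideal.comap_injective_of_surjective _ β.symm.surjective h

/-- The numerators of the logarithmic form along the prime `P`. -/
theorem exists_prime_kernel (hq0 : q ≠ 0) :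
    ∃ N : Fin (n + 1) → Polynomial (MvPolynomial (Fin (n + 1)) K), ∀ j,
      (N j).natDegree ≤ G.natDegree ∧
      (∀ i, ((N j).coeff i).totalDegree ≤ (q.totalDegree - 1) + c * (G.natDegree + 1)) ∧
      N j - Polynomial.C (pderiv j q) * Polynomial.derivative G ∈ P ∧
      ∀ P' : Ideal (Polynomial (MvPolynomial (Fin (n + 1)) K)), P'.IsPrime →
        (∀ a, Polynomial.C a ∈ P' ↔ q ∣ a) → G ∈ P' → P' ≠ P → N j ∈ P' := by
  suffices h : ∀ j, ∃ N : Polynomial (MvPolynomial (Fin (n + 1)) K), N.natDegree ≤ G.natDegree ∧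
      (∀ i, (N.coeff i).totalDegree ≤ (q.totalDegree - 1) + c * (G.natDegree + 1)) ∧
      N - Polynomial.C (pderiv j q) * Polynomial.derivative G ∈ P ∧
      ∀ P' : Ideal (Polynomial (MvPolynomial (Fin (n + 1)) K)), P'.IsPrime →
        (∀ a, Polynomial.C a ∈ P' ↔ q ∣ a) → G ∈ P' → P' ≠ P → N ∈ P' by
    choose N hN using h
    exact ⟨N, hN⟩
  intro j
  set ℓ := homogeneousComponent q.totalDegree q
  have hℓ : ℓ ≠ 0 := homogeneousComponent_totalDegree_ne_zero hq0
  let τ : MvPolynomial (Fin (n + 1)) K ≃ₐ[K] MvPolynomial (Fin (n + 1)) K :=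
    AlgEquiv.ofAlgHom (aeval fun i => X i + C ((Pi.single j 1 : Fin (n + 1) → K) i))
      (aeval fun i => X i - C ((Pi.single j 1 : Fin (n + 1) → K) i))
      (MvPolynomial.algHom_ext fun i => by
        rw [AlgHom.comp_apply, aeval_X, map_sub, aeval_X, aeval_C]; simp [algebraMap_eq])
      (MvPolynomial.algHom_ext fun i => by
        rw [AlgHom.comp_apply, aeval_X, map_add, aeval_X, aeval_C]; simp [algebraMap_eq])
  have hτ : ∀ a (v : Fin (n + 1) → K), eval v (τ a) = eval (v + Pi.single j 1) a := by
    intro a v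
    change eval v (aeval _ a) = _
    induction a using MvPolynomial.induction_on with
    | C r => simp [algebraMap_eq]
    | add f g hf hg => rw [map_add, map_add, map_add, hf, hg]
    | mul_X f i hf => rw [map_mul, map_mul, map_mul, hf, aeval_X]; simp
  have hne : ℓ * X 0 * τ (ℓ * X 0) ≠ 0 :=
    mul_ne_zero (mul_ne_zero hℓ (X_ne_zero _))
      ((map_ne_zero_iff _ τ.injective).mpr (mul_ne_zero hℓ (X_ne_zero _)))
  obtain ⟨v, hv⟩ : ∃ v, eval v (ℓ * X 0 * τ (ℓ * X 0)) ≠ 0 := by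
    by_contra! h
    exact hne (MvPolynomial.funext fun v => by rw [h, map_zero])
  rw [map_mul, hτ, map_mul, map_mul, eval_X, eval_X] at hv
  obtain ⟨N₁, a1, b1, c1, d1⟩ := exists_prime_kernel_direction hG hGdeg hP hGP
    (right_ne_zero_of_mul (left_ne_zero_of_mul hv)) (left_ne_zero_of_mul (left_ne_zero_of_mul hv))
  obtain ⟨N₂, a2, b2, c2, d2⟩ := exists_prime_kernel_direction hG hGdeg hP hGP
    (right_ne_zero_of_mul (right_ne_zero_of_mul hv))
    (left_ne_zero_of_mul (right_ne_zero_of_mul hv))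
  refine ⟨N₂ - N₁, (Polynomial.natDegree_sub_le _ _).trans (max_le a2 a1), fun i => ?_, ?_,
    fun P' e1 e2 e3 e4 => P'.sub_mem (d2 P' e1 e2 e3 e4) (d1 P' e1 e2 e3 e4)⟩
  · rw [Polynomial.coeff_sub]
    exact (totalDegree_sub _ _).trans (max_le (b2 i) (b1 i))
  · have h1 : ∑ i, C ((v + Pi.single j 1 : Fin (n + 1) → K) i) * pderiv i q - ∑ i, C (v i) * pderiv i q =
        pderiv j q := by
      rw [← Finset.sum_sub_distrib, Finset.sum_eq_single j]
      · simp; ring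
      · intro i _ hij; simp [hij]
      · simp
    have := P.sub_mem c2 c1
    rwa [sub_sub_sub_comm, ← sub_mul, ← Polynomial.C_sub, h1] at this

end Residue

section PlaceFacts

variable {K L : Type*} [Field K] [Field L] [Algebra K L] [CharZero K] [Algebra.EssFiniteType K L]
  {m : ℕ}

theorem exists_irreducible_of_mem_finitePlaces (t : Fin m → L) {w : Valuation L ℤᵐ⁰}
    (hw : w ∈ finitePlaces K t) :
    ∃ p : MvPolynomial (Fin m) K, Irreducible p ∧ w ∈ placesOver t p := by
  obtain ⟨a, ha, hw⟩ := hw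
  exact ⟨_, ha, hw⟩

theorem finite_placesOver_infinity {z : Fin m → L} (hz : IsTranscendenceBasis K z) (j : Fin m) :
    (placesOver (coordInfinity z j) (X j : MvPolynomial (Fin m) K)).Finite :=
  (infinity_places_facts hz j).finite

theorem IsPlacesOver.algebraMap_eq_one {t : Fin m → L} {p : MvPolynomial (Fin m) K}
    {𝒮 : Set (Valuation L ℤᵐ⁰)} (h : IsPlacesOver t p 𝒮) (hp : ¬ IsUnit p) {w : Valuation L ℤᵐ⁰}
    (hw : w ∈ 𝒮) {c : K} (hc : c ≠ 0) : w (algebraMap K L c) = 1 := by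
  have h1 := h.aeval_le_one w hw (C c)
  have h2 := (h.aeval_lt_one_iff w hw (C c)).not.mpr fun hd =>
    hp (isUnit_of_dvd_unit hd ((isUnit_iff_ne_zero.mpr hc).map C))
  rw [aeval_C] at h1 h2
  exact le_antisymm h1 (not_lt.mp h2)

theorem IsPlacesOver.exists_succAbove {t : Fin (m + 1) → L} {p : MvPolynomial (Fin (m + 1)) K}
    {𝒮 : Set (Valuation L ℤᵐ⁰)} (h : IsPlacesOver t p 𝒮) (hp : Irreducible p) :
    ∃ i : Fin (m + 1), ∀ w ∈ 𝒮, ∀ Q : MvPolynomial (Fin m) K, Q ≠ 0 →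
      w (aeval (t ∘ i.succAbove) Q) = 1 := by
  obtain ⟨i, hi⟩ : ∃ i, p.degreeOf i ≠ 0 := by
    by_contra! h0
    have h1 : p.vars = ∅ := by
      ext i; simp [mem_vars_iff_degreeOf_ne_zero, h0]
    rw [vars_eq_empty_iff_eq_C] at h1
    rw [h1] at hp
    refine hp.not_isUnit ((isUnit_iff_ne_zero.mpr fun h2 => ?_).map C)
    rw [h2, C_0] at hp
    exact hp.ne_zero rfl
  refine ⟨i, fun w hw Q hQ => ?_⟩
  rw [← aeval_rename]
  refine le_antisymm (h.aeval_le_one w hw _) (not_lt.mp ?_)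
  rw [h.aeval_lt_one_iff w hw]
  rintro ⟨q, hq⟩
  have hR : rename i.succAbove Q ≠ 0 := by
    rw [Ne, map_eq_zero_iff _ (rename_injective _ i.succAbove_right_injective)]; exact hQ
  have h3 := congrArg (degreeOf i) hq
  rw [degreeOf_mul_eq (left_ne_zero_of_mul (hq ▸ hR)) (right_ne_zero_of_mul (hq ▸ hR)),
    Classical.not_not.mp (mem_vars_iff_degreeOf_ne_zero.not.mp fun h4 => ?_)] at h3
  · omega
  · obtain ⟨a, -, ha⟩ := mem_vars_rename _ _ h4
    exact i.succAbove_ne a ha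

variable {z : Fin m → L} (hz : IsTranscendenceBasis K z) (j : Fin m)
include hz

theorem allPlaces_algebraMap {w : Valuation L ℤᵐ⁰} (hw : w ∈ allPlaces K z j) {c : K}
    (hc : c ≠ 0) : w (algebraMap K L c) = 1 := by
  rcases hw with hw | hw
  · obtain ⟨p, hp, hw⟩ := exists_irreducible_of_mem_finitePlaces z hw
    exact (isPlacesOver_placesOver hz hp).algebraMap_eq_one hp.not_isUnit hw hc
  · exact (infinity_places_facts hz j).algebraMap_eq_one (X_prime (R := K)).not_isUnit hw hc

theorem allPlaces_exists_uniformizer {w : Valuation L ℤᵐ⁰} (hw : w ∈ allPlaces K z j) :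
    ∃ π, w π = WithZero.exp (-1 : ℤ) := by
  rcases hw with hw | hw
  · obtain ⟨p, hp, hw⟩ := exists_irreducible_of_mem_finitePlaces z hw
    exact (isPlacesOver_placesOver hz hp).exists_uniformizer w hw
  · exact (infinity_places_facts hz j).exists_uniformizer w hw

theorem finite_allPlaces_ne_one {s : L} (hs : s ≠ 0) : {w ∈ allPlaces K z j | w s ≠ 1}.Finite :=
  ((finite_finitePlaces_ne_one hz hs).union (finite_placesOver_infinity hz j)).subset
    fun _ hw => hw.1.imp (fun h => ⟨h, hw.2⟩) id

theorem finite_allPlaces_not_derivation_stable (D : Derivation K L L) :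
    {w ∈ allPlaces K z j | ¬ ∀ u, w u ≤ 1 → w (D u) ≤ 1}.Finite :=
  ((finite_finitePlaces_not_derivation_stable hz D).union
    (finite_placesOver_infinity hz j)).subset fun _ hw => hw.1.imp (fun h => ⟨h, hw.2⟩) id

end PlaceFacts

theorem allPlaces_exists_succAbove {K L : Type*} [Field K] [Field L] [Algebra K L] [CharZero K]
    [Algebra.EssFiniteType K L] {m : ℕ} {z : Fin (m + 1) → L} (hz : IsTranscendenceBasis K z)
    (j : Fin (m + 1)) {w : Valuation L ℤᵐ⁰} (hw : w ∈ allPlaces K z j) :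
    ∃ (t : Fin (m + 1) → L) (i : Fin (m + 1)), (w ∈ finitePlaces K z → t = z) ∧
      ∀ Q : MvPolynomial (Fin m) K, Q ≠ 0 → w (aeval (t ∘ i.succAbove) Q) = 1 := by
  by_cases h : w ∈ finitePlaces K z
  · obtain ⟨p, hp, hw⟩ := exists_irreducible_of_mem_finitePlaces z h
    obtain ⟨i, hi⟩ := (isPlacesOver_placesOver hz hp).exists_succAbove hp
    exact ⟨z, i, fun _ => rfl, hi w hw⟩
  · obtain ⟨i, hi⟩ := (infinity_places_facts hz j).exists_succAbove (X_prime (R := K)).irreducible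
    exact ⟨_, i, fun h' => (h h').elim, hi w (hw.resolve_left h)⟩

/-- Steinitz exchange for algebraic independence. -/
theorem AlgebraicIndependent.exists_comp_of_isAlgebraic {K E ι : Type*} [Field K] [Field E]
    [Algebra K E] {r : ℕ} {a : Fin r → E} (ha : AlgebraicIndependent K a) {c : ι → E}
    (h : ∀ i, IsAlgebraic (Algebra.adjoin K (Set.range c)) (a i)) :
    ∃ e : Fin r → ι, AlgebraicIndependent K (c ∘ e) := by
  let M := AlgebraicIndependent.matroid K E
  obtain ⟨B, hB⟩ := M.exists_isBasis (Set.range c) (by simp [M])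
  have h1 : M.Indep (Set.range a) := by
    rw [matroid_indep_iff]; exact ha.coe_range
  have h2 : Set.range a ⊆ M.closure (Set.range c) := by
    rintro _ ⟨i, rfl⟩
    rw [matroid_closure_eq]
    exact h i
  have h3 : (r : ℕ∞) ≤ B.encard := by
    have h4 := M.eRk_mono h2
    rw [M.eRk_closure_eq, h1.eRk_eq_encard, ← hB.encard_eq_eRk] at h4
    refine le_trans ?_ (ha.injective.encard_range.trans h4)
    simp
  obtain ⟨B', hB', hc⟩ := Set.exists_subset_encard_eq h3
  have hf : B'.Finite := Set.finite_of_encard_eq_coe hc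
  have := hf.to_subtype
  have e : Fin r ≃ B' := by
    refine (Finite.equivFinOfCardEq ?_).symm
    rw [Nat.card_coe_set_eq, Set.ncard, hc]; rfl
  have hsub : ∀ k, ∃ i, c i = e k := fun k => hB.subset (hB' (e k).2)
  choose f hf using hsub
  refine ⟨f, ?_⟩
  have h5 : AlgebraicIndependent K ((↑) : B' → E) := by
    have := (matroid_indep_iff.mp hB.indep)
    exact this.mono hB'
  have h6 := h5.comp e e.injective
  convert h6 using 1
  exact funext hf

section Residue

variable {K F : Type*} [Field K] [Field F] [Algebra K F] (u : Valuation F ℤᵐ⁰)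

/-- The residue class of an element of the valuation ring, zero elsewhere. -/
noncomputable def Valuation.residue (x : F) : IsLocalRing.ResidueField u.valuationSubring :=
  open Classical in
  if h : u x ≤ 1 then IsLocalRing.residue _ (⟨x, h⟩ : u.valuationSubring) else 0

theorem Valuation.residue_of_le {x : F} (h : u x ≤ 1) :
    u.residue x = IsLocalRing.residue _ (⟨x, h⟩ : u.valuationSubring) := dif_pos h

/-- The residue field of a valuation trivial on `K` is a `K`-algebra. -/
noncomputable abbrev Valuation.residueAlgebra (hK : ∀ c : K, c ≠ 0 → u (algebraMap K F c) = 1) :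
    Algebra K (IsLocalRing.ResidueField u.valuationSubring) :=
  ((IsLocalRing.residue u.valuationSubring).comp
    ((algebraMap K F).codRestrict u.valuationSubring.toSubring fun c => by
      by_cases hc : c = 0
      · rw [hc, map_zero]; exact zero_mem _
      · exact (hK c hc).le)).toAlgebra

theorem Valuation.residue_eq_zero_iff {x : F} (h : u x ≤ 1) : u.residue x = 0 ↔ u x < 1 := by
  rw [u.residue_of_le h, IsLocalRing.residue_eq_zero_iff, IsLocalRing.mem_maximalIdeal,
    mem_nonunits_iff]
  rw [not_iff_comm, not_lt]
  constructor
  · intro h1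
    have h2 : u x = 1 := le_antisymm h h1
    have h3 : x ≠ 0 := by rintro rfl; rw [map_zero] at h2; exact zero_ne_one h2
    refine IsUnit.of_mul_eq_one ⟨x⁻¹, by rw [Valuation.mem_valuationSubring_iff, map_inv₀, h2,
      inv_one]⟩ (Subtype.ext (mul_inv_cancel₀ h3))
  · intro h1
    obtain ⟨y, hy⟩ := h1.exists_right_inv
    have h2 := congrArg (fun v : u.valuationSubring => u v) hy
    have h3 : u x * u y = 1 := by rw [← map_mul]; simpa using h2
    by_contra! h4
    have h5 : u x * u y < 1 := by
      refine lt_of_le_of_lt (mul_le_mul_right y.2 _) ?_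
      rwa [mul_one]
    exact h5.ne h3

theorem Valuation.residue_surjective (y : IsLocalRing.ResidueField u.valuationSubring) :
    ∃ x, u x ≤ 1 ∧ u.residue x = y := by
  obtain ⟨⟨x, hx⟩, rfl⟩ := IsLocalRing.residue_surjective y
  exact ⟨x, hx, u.residue_of_le hx⟩

theorem Valuation.aeval_le_one (hK : ∀ c : K, c ≠ 0 → u (algebraMap K F c) = 1) {ι : Type*}
    {x : ι → F} (hx : ∀ i, u (x i) ≤ 1) (Q : MvPolynomial ι K) : u (aeval x Q) ≤ 1 := by
  induction Q using MvPolynomial.induction_on with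
  | C a =>
    rw [aeval_C]
    by_cases ha : a = 0
    · rw [ha, map_zero, map_zero]; exact zero_le
    · exact (hK a ha).le
  | add p q hp hq => rw [map_add]; exact u.map_add_le hp hq
  | mul_X p i hp => rw [map_mul, map_mul, aeval_X]; exact mul_le_one' hp (hx i)

theorem Valuation.aeval_residue (hK : ∀ c : K, c ≠ 0 → u (algebraMap K F c) = 1) {ι : Type*}
    {x : ι → F} (hx : ∀ i, u (x i) ≤ 1) (Q : MvPolynomial ι K) :
    letI := u.residueAlgebra hK
    aeval (fun i => u.residue (x i)) Q = u.residue (aeval x Q) := by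
  let := u.residueAlgebra hK
  induction Q using MvPolynomial.induction_on with
  | C a =>
    have h := u.aeval_le_one hK hx (C a)
    rw [aeval_C] at h ⊢
    rw [aeval_C, u.residue_of_le h]; rfl
  | add p q hp hq =>
    have h := u.aeval_le_one hK hx (p + q)
    rw [map_add] at h ⊢
    rw [map_add, hp, hq, u.residue_of_le h, u.residue_of_le (u.aeval_le_one hK hx p),
      u.residue_of_le (u.aeval_le_one hK hx q), ← map_add]; rfl
  | mul_X p i hp =>
    have h := u.aeval_le_one hK hx (p * X i)
    rw [map_mul, aeval_X] at h ⊢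
    rw [map_mul, hp, aeval_X, u.residue_of_le h, u.residue_of_le (u.aeval_le_one hK hx p),
      u.residue_of_le (hx i), ← map_mul]; rfl

theorem Valuation.algebraicIndependent_residue_iff
    (hK : ∀ c : K, c ≠ 0 → u (algebraMap K F c) = 1) {ι : Type*}
    {x : ι → F} (hx : ∀ i, u (x i) ≤ 1) :
    letI := u.residueAlgebra hK
    AlgebraicIndependent K (fun i => u.residue (x i)) ↔
      ∀ Q : MvPolynomial ι K, Q ≠ 0 → u (aeval x Q) = 1 := by
  let := u.residueAlgebra hK
  rw [algebraicIndependent_iff]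
  refine forall_congr' fun Q => ?_
  rw [u.aeval_residue hK hx, u.residue_eq_zero_iff (u.aeval_le_one hK hx Q), ← not_imp_not,
    not_lt]
  exact imp_congr_right fun _ => ⟨fun h => le_antisymm (u.aeval_le_one hK hx Q) h, fun h => h.ge⟩

end Residue

section Abhyankar

universe u v

variable {F : Type u} {L : Type v} [Field F] [Field L] [Algebra F L] (w : Valuation L ℤᵐ⁰)

/-- The extension of valuation rings. -/
def Valuation.comapIntegers :
    (w.comap (algebraMap F L)).valuationSubring →+* w.valuationSubring :=
  ((algebraMap F L).comp (Subring.subtype _)).codRestrict w.valuationSubring.toSubring fun x => x.2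

instance : IsLocalHom (w.comapIntegers (F := F)) where
  map_nonunit x hx := by
    have h0 : x ≠ 0 := by
      rintro rfl; rw [map_zero] at hx; exact not_isUnit_zero hx
    obtain ⟨y, hy⟩ := hx.exists_right_inv
    have hy' : algebraMap F L x * (y : L) = 1 := congrArg Subtype.val hy
    have h1 : (y : L) = algebraMap F L (x : F)⁻¹ := by
      rw [map_inv₀]; exact eq_inv_of_mul_eq_one_right hy'
    have h2 : w (algebraMap F L (x : F)⁻¹) ≤ 1 := h1 ▸ y.2
    exact IsUnit.of_mul_eq_one ⟨(x : F)⁻¹, h2⟩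
      (Subtype.ext (mul_inv_cancel₀ fun h => h0 (Subtype.ext h)))

/-- The extension of residue fields. -/
noncomputable abbrev Valuation.comapResidueAlgebra :
    Algebra (IsLocalRing.ResidueField (w.comap (algebraMap F L)).valuationSubring)
      (IsLocalRing.ResidueField w.valuationSubring) :=
  (IsLocalRing.ResidueField.map (w.comapIntegers (F := F))).toAlgebra

/-- Residues which are algebraically independent over the residue field lift to algebraically
independent elements. -/
theorem Valuation.algebraicIndependent_of_residue {ι : Type*} (c : ι → w.valuationSubring)
    (hc : letI := w.comapResidueAlgebra (F := F)
      AlgebraicIndependent (IsLocalRing.ResidueField (w.comap (algebraMap F L)).valuationSubring)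
        (fun i => IsLocalRing.residue w.valuationSubring (c i))) :
    AlgebraicIndependent F (fun i => (c i : L)) := by
  let := w.comapResidueAlgebra (F := F)
  rw [algebraicIndependent_iff]
  intro Q hQ
  by_contra hQ0
  obtain ⟨d, hd, hmax⟩ := Q.support.exists_max_image (fun d => w.comap (algebraMap F L) (Q.coeff d))
    (Finset.nonempty_iff_ne_empty.mpr (support_eq_empty.not.mpr hQ0))
  have hd0 : Q.coeff d ≠ 0 := mem_support_iff.mp hd
  have hle : ∀ e, w.comap (algebraMap F L) ((Q.coeff d)⁻¹ * Q.coeff e) ≤ 1 := by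
    intro e
    by_cases he : e ∈ Q.support
    · rw [map_mul (w.comap (algebraMap F L)), map_inv₀]
      exact inv_mul_le_one_of_le₀ (hmax e he) zero_le
    · rw [notMem_support_iff.mp he, mul_zero, map_zero (w.comap (algebraMap F L))]; exact zero_le
  have hQ' : ∃ Q' : MvPolynomial ι (w.comap (algebraMap F L)).valuationSubring,
      MvPolynomial.map (algebraMap (w.comap (algebraMap F L)).valuationSubring F) Q' = C (Q.coeff d)⁻¹ * Q := by
    change _ ∈ Set.range _
    rw [mem_range_map_iff_coeffs_subset]
    intro x hx
    obtain ⟨e, -, rfl⟩ := mem_coeffs_iff.mp hx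
    rw [coeff_C_mul]
    exact ⟨⟨_, hle e⟩, rfl⟩
  obtain ⟨Q', hQ'⟩ := hQ'
  have h1 : eval₂ w.comapIntegers c Q' = 0 := by
    apply Subtype.ext
    have h2 : ((eval₂ w.comapIntegers c Q' : w.valuationSubring) : L) =
        aeval (fun i => (c i : L)) (MvPolynomial.map (algebraMap (w.comap (algebraMap F L)).valuationSubring F) Q') := by
      rw [aeval_def, eval₂_map]
      exact (eval₂_comp_left w.valuationSubring.subtype w.comapIntegers c Q')
    rw [h2, hQ', map_mul, hQ, mul_zero]; rfl
  have h3 : aeval (fun i => IsLocalRing.residue w.valuationSubring (c i))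
      (MvPolynomial.map (IsLocalRing.residue (w.comap (algebraMap F L)).valuationSubring) Q') = 0 := by
    have h2 := congrArg (IsLocalRing.residue w.valuationSubring) h1
    rw [eval₂_comp_left, map_zero] at h2
    rw [aeval_def, eval₂_map, ← h2]
    rfl
  have h4 := (algebraicIndependent_iff.mp hc) _ h3
  have h5 := congrArg (coeff d) h4
  rw [coeff_map, coeff_zero, IsLocalRing.residue_eq_zero_iff, IsLocalRing.mem_maximalIdeal,
    mem_nonunits_iff] at h5
  refine h5 ?_
  have h6 := congrArg (coeff d) hQ'
  rw [coeff_map, coeff_C_mul, inv_mul_cancel₀ hd0] at h6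
  have h7 : coeff d Q' = 1 := Subtype.ext h6
  rw [h7]; exact isUnit_one

open Cardinal in
theorem Valuation.exists_residually_independent {K : Type*} [Field K] [Algebra K F] [Algebra K L]
    [IsScalarTower K F L] (hK : ∀ c : K, c ≠ 0 → w (algebraMap K L c) = 1) {m n : ℕ}
    (hL : Algebra.trdeg K L = (m + 1 : ℕ)) (hF : Algebra.trdeg K F = (n + 1 : ℕ))
    {b : Fin m → L} (hb : ∀ i, w (b i) ≤ 1)
    (hb' : ∀ Q : MvPolynomial (Fin m) K, Q ≠ 0 → w (aeval b Q) = 1) :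
    ∃ s : Fin n → F, (∀ i, w (algebraMap F L (s i)) ≤ 1) ∧
      ∀ Q : MvPolynomial (Fin n) K, Q ≠ 0 → w (algebraMap F L (aeval s Q)) = 1 := by
  set u := w.comap (algebraMap F L) with hu
  have hKu : ∀ c : K, c ≠ 0 → u (algebraMap K F c) = 1 := fun c hc => by
    rw [hu, Valuation.comap_apply, ← IsScalarTower.algebraMap_apply, hK c hc]
  let := w.comapResidueAlgebra (F := F)
  let := u.residueAlgebra hKu
  let := w.residueAlgebra hK
  have : IsScalarTower K (IsLocalRing.ResidueField u.valuationSubring)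
      (IsLocalRing.ResidueField w.valuationSubring) := by
    refine IsScalarTower.of_algebraMap_eq fun c => ?_
    change IsLocalRing.residue _ _ = IsLocalRing.residue _ _
    congr 1
    exact Subtype.ext (IsScalarTower.algebraMap_apply K F L c)
  have h1 := (w.algebraicIndependent_residue_iff hK hb).mpr hb'
  have h2 := h1.lift_cardinalMk_le_trdeg
  have h3 := lift_trdeg_add_eq K (IsLocalRing.ResidueField u.valuationSubring)
    (IsLocalRing.ResidueField w.valuationSubring)
  have h4 := lift_trdeg_add_eq K F L
  rw [hL, hF] at h4
  have h5 : Algebra.trdeg (IsLocalRing.ResidueField u.valuationSubring)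
    (IsLocalRing.ResidueField w.valuationSubring) ≤ Algebra.trdeg F L := by
    obtain ⟨ι, x, hx⟩ := exists_isTranscendenceBasis'
      (IsLocalRing.ResidueField u.valuationSubring) (IsLocalRing.ResidueField w.valuationSubring)
    have h6 : ∀ i, ∃ c, IsLocalRing.residue w.valuationSubring c = x i := fun i =>
      IsLocalRing.residue_surjective _
    choose c hc using h6
    have h7 := w.algebraicIndependent_of_residue (F := F) c (by simpa only [hc] using hx.1)
    rw [← hx.cardinalMk_eq_trdeg]
    exact h7.cardinalMk_le_trdeg
  have h8 : (n : Cardinal) ≤ Algebra.trdeg K (IsLocalRing.ResidueField u.valuationSubring) := by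
    by_contra! hA
    obtain ⟨a, ha⟩ := Cardinal.lt_aleph0.mp (hA.trans (Cardinal.natCast_lt_aleph0 (n := n)))
    obtain ⟨d, hd⟩ : ∃ d : ℕ, Algebra.trdeg F L = d := by
      refine Cardinal.lt_aleph0.mp (Cardinal.lift_lt_aleph0.mp
        (lt_of_le_of_lt ?_ (Cardinal.natCast_lt_aleph0 (n := m + 1))))
      rw [Cardinal.lift_natCast, Cardinal.lift_natCast] at h4
      rw [← h4]
      exact le_add_self
    obtain ⟨b, hb⟩ := Cardinal.lt_aleph0.mp
      (h5.trans_lt (hd ▸ (Cardinal.natCast_lt_aleph0 (n := d))))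
    rw [hb, hd] at h5
    rw [hd] at h4
    rw [ha] at hA
    rw [ha, hb] at h3
    rw [Cardinal.mk_fin] at h2
    simp only [Cardinal.lift_natCast, Cardinal.lift_uzero] at h2 h3 h4
    rw [← Cardinal.lift_le.{u}, ← h3, Cardinal.lift_natCast] at h2
    norm_cast at h2 h4 h5 hA
    lia
  obtain ⟨ι, x, hx⟩ := exists_isTranscendenceBasis' K
      (IsLocalRing.ResidueField u.valuationSubring)
  rw [← hx.cardinalMk_eq_trdeg] at h8
  obtain ⟨e⟩ : Nonempty (Fin n ↪ ι) := by
    rw [← Cardinal.lift_mk_le', Cardinal.mk_fin, Cardinal.lift_natCast]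
    simpa using h8
  choose s hs hs' using u.residue_surjective
  refine ⟨fun i => s (x (e i)), fun i => hs _, ?_⟩
  refine (u.algebraicIndependent_residue_iff hKu fun i => hs _).mp ?_
  simp only [hs']
  exact hx.1.comp e e.injective

end Abhyankar

theorem aeval_mul_of_isHomogeneous {K A σ : Type*} [CommRing K] [CommRing A]
    [Algebra K A] {H : MvPolynomial σ K} {d : ℕ} (hH : H.IsHomogeneous d) (a : A) (x : σ → A) :
    aeval (fun i => a * x i) H = a ^ d * aeval x H := by
  rw [aeval_def, aeval_def, eval₂_eq, eval₂_eq, Finset.mul_sum]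
  refine Finset.sum_congr rfl fun s hs => ?_
  have h := hH (mem_support_iff.mp hs)
  simp_rw [mul_pow]
  rw [Finset.prod_mul_distrib, Finset.prod_pow_eq_pow_sum]
  have h2 : ∑ i ∈ s.support, s i = d := by
    rw [← h, Finsupp.weight_apply, Finsupp.sum]; simp
  rw [h2]; ring

theorem isIntegral_of_monic_finSuccEquiv {K E : Type*} [Field K] [Field E] [Algebra K E] {N : ℕ}
    {P : MvPolynomial (Fin (N + 1)) K} (hP : (finSuccEquiv K N P).Monic) {ξ : E} {c : Fin N → E}
    (h : aeval (Fin.cons ξ c : Fin (N + 1) → E) P = 0) :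
    IsIntegral (Algebra.adjoin K (Set.range c)) ξ := by
  let f : MvPolynomial (Fin N) K →ₐ[K] Algebra.adjoin K (Set.range c) :=
    (aeval c).codRestrict _ aeval_mem_adjoin
  refine ⟨(finSuccEquiv K N P).map f.toRingHom, hP.map _, ?_⟩
  rw [MvPolynomial.aeval_cons_eq_eval] at h
  rw [Polynomial.eval₂_map, ← h, Polynomial.eval_map]
  rfl

section Visible

variable {K F : Type*} [Field K] [Field F] [Algebra K F]

/-- The ratios of the family `l` have at least `r` algebraically independent residues. -/
def Visible (K : Type*) {F : Type*} [Field K] [Field F] [Algebra K F] (u : Valuation F ℤᵐ⁰)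
    (r : ℕ) {N : ℕ} (l : Fin N → F) : Prop :=
  ∃ k, l k ≠ 0 ∧ (∀ i, u (l i) ≤ u (l k)) ∧ ∃ e : Fin r → Fin N,
    ∀ Q : MvPolynomial (Fin r) K, Q ≠ 0 → u (aeval (fun a => l (e a) / l k) Q) = 1

theorem exists_linear_projection [Infinite K] {N d : ℕ} (l : Fin (N + 1) → F)
    {H : MvPolynomial (Fin (N + 1)) K} (hd : H.IsHomogeneous d) (hH : H ≠ 0)
    (hl : aeval l H = 0) :
    ∃ (v : Fin (N + 1) → K) (ξ : F) (l' : Fin N → F) (P : MvPolynomial (Fin (N + 1)) K),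
      v 0 ≠ 0 ∧ l 0 = v 0 • ξ ∧ (∀ i, l i.succ = l' i + v i.succ • ξ) ∧
      (finSuccEquiv K N P).Monic ∧
      (∀ τ, aeval (Fin.cons (τ * ξ) (fun i => τ * l' i) : Fin (N + 1) → F) P = 0) ∧
      ((∀ i, l' i = 0) → ξ = 0) := by
  have hne : H * X 0 ≠ 0 := mul_ne_zero hH (X_ne_zero _)
  obtain ⟨v, hv⟩ : ∃ v, eval v (H * X 0) ≠ 0 := by
    by_contra! h
    exact hne (MvPolynomial.funext fun v => by rw [h, map_zero])
  rw [map_mul, eval_X] at hv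
  have hv0 := right_ne_zero_of_mul hv
  have hHv := left_ne_zero_of_mul hv
  set ξ : F := (v 0)⁻¹ • l 0 with hξ
  have h0 : l 0 = v 0 • ξ := by rw [hξ, smul_smul, mul_inv_cancel₀ hv0, one_smul]
  set l' : Fin N → F := fun i => l i.succ - v i.succ • ξ with hl'
  have hs : ∀ i : Fin N, l i.succ = l' i + v i.succ • ξ := fun i => (sub_add_cancel _ _).symm
  have hdeg : H.totalDegree = d := hd.totalDegree hH
  have hshift : ∀ τ, aeval (Fin.cons (τ * ξ) (fun i => τ * l' i) : Fin (N + 1) → F)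
      (linearShift v H) = 0 := by
    intro τ
    have h1 : (aeval (Fin.cons (τ * ξ) (fun i => τ * l' i) : Fin (N + 1) → F)).comp
        (linearShift v) = aeval (fun i => τ * l i) := by
      refine MvPolynomial.algHom_ext fun i => ?_
      refine Fin.cases ?_ (fun i => ?_) i
      · rw [AlgHom.comp_apply, linearShift_X_zero, map_mul, aeval_C, aeval_X, aeval_X, h0,
          Fin.cons_zero, Algebra.smul_def]
        ring
      · rw [AlgHom.comp_apply, linearShift_X_succ, map_add, map_mul, aeval_C, aeval_X, aeval_X,
          aeval_X, hs, Fin.cons_zero, Fin.cons_succ, Algebra.smul_def]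
        ring
    rw [← AlgHom.comp_apply, h1, aeval_mul_of_isHomogeneous hd, hl, mul_zero]
  have hco : (finSuccEquiv K N (linearShift v H)).coeff d = C (eval v H) := by
    have := coeff_finSuccEquiv_linearShift v H
    rwa [hdeg, homogeneousComponent_of_mem hd, if_pos rfl] at this
  have hnd : (finSuccEquiv K N (linearShift v H)).natDegree ≤ d := by
    rw [natDegree_finSuccEquiv]
    exact (degreeOf_le_totalDegree _ _).trans ((totalDegree_linearShift_le _ _).trans hdeg.le)
  have hC : ∀ c : K, finSuccEquiv K N (C c) = Polynomial.C (C c) := fun c => by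
    simp [finSuccEquiv_apply]
  refine ⟨v, ξ, l', C (eval v H)⁻¹ * linearShift v H, hv0, h0, hs, ?_, fun τ => ?_, fun h => ?_⟩
  · refine Polynomial.monic_of_natDegree_le_of_coeff_eq_one d ?_ ?_
    · rw [map_mul, hC]
      exact (Polynomial.natDegree_C_mul_le _ _).trans hnd
    · rw [map_mul, hC, Polynomial.coeff_C_mul, hco, ← C_mul, inv_mul_cancel₀ hHv, C_1]
  · rw [map_mul, hshift, mul_zero]
  · have h1 : l = fun i => ξ * algebraMap K F (v i) := by
      funext i
      refine Fin.cases ?_ (fun i => ?_) i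
      · rw [h0, Algebra.smul_def, mul_comm]
      · rw [hs, h, zero_add, Algebra.smul_def, mul_comm]
    rw [h1, aeval_mul_of_isHomogeneous hd] at hl
    have h2 : aeval (fun i => algebraMap K F (v i)) H = algebraMap K F (eval v H) := by
      exact aeval_algebraMap_apply F v H
    rw [h2] at hl
    by_contra hξ0
    exact (mul_ne_zero (pow_ne_zero d hξ0)
      ((map_ne_zero_iff _ (algebraMap K F).injective).mpr hHv)) hl

variable {u : Valuation F ℤᵐ⁰}

theorem Valuation.residue_mul {x y : F} (hx : u x ≤ 1) (hy : u y ≤ 1) :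
    u.residue (x * y) = u.residue x * u.residue y := by
  have h : u (x * y) ≤ 1 := by rw [map_mul]; exact mul_le_one' hx hy
  rw [u.residue_of_le h, u.residue_of_le hx, u.residue_of_le hy, ← map_mul]; rfl

theorem Visible.linear_projection (hK : ∀ c : K, c ≠ 0 → u (algebraMap K F c) = 1) {r N : ℕ}
    {l : Fin (N + 1) → F} (h : Visible K u r l) {v : Fin (N + 1) → K} {ξ : F} {l' : Fin N → F}
    {P : MvPolynomial (Fin (N + 1)) K} (hv : v 0 ≠ 0) (h0 : l 0 = v 0 • ξ)
    (hs : ∀ i, l i.succ = l' i + v i.succ • ξ) (hP : (finSuccEquiv K N P).Monic)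
    (hPl : ∀ τ, aeval (Fin.cons (τ * ξ) (fun i => τ * l' i) : Fin (N + 1) → F) P = 0)
    (hz : (∀ i, l' i = 0) → ξ = 0) : Visible K u r l' := by
  let := u.residueAlgebra hK
  obtain ⟨k, hk, hmax, e, he⟩ := h
  have hsm : ∀ (c : K) (x : F), u (c • x) ≤ u x := fun c x => by
    by_cases hc : c = 0
    · rw [hc, zero_smul, map_zero]; exact zero_le
    · rw [Algebra.smul_def, map_mul, hK c hc, one_mul]
  have hne : ∃ i, l' i ≠ 0 := by
    by_contra! h
    have hξ := hz h
    apply hk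
    revert k
    intro k _ _ _
    refine Fin.cases ?_ (fun i => ?_) k
    · rw [h0, hξ, smul_zero]
    · rw [hs, h, hξ, smul_zero, add_zero]
  obtain ⟨i₀, hi₀⟩ := hne
  have : Nonempty (Fin N) := ⟨i₀⟩
  obtain ⟨k', hk'⟩ := Finite.exists_max fun i => u (l' i)
  have hk'0 : l' k' ≠ 0 := by
    intro h
    have := hk' i₀
    rw [h, map_zero] at this
    exact hi₀ (u.zero_iff.mp (le_zero_iff.mp this))
  set τ := l' k'
  have hle' : ∀ i, u (τ⁻¹ * l' i) ≤ 1 := fun i => by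
    rw [map_mul, map_inv₀]; exact inv_mul_le_one_of_le₀ (hk' i) zero_le
  have hint := isIntegral_of_monic_finSuccEquiv hP (hPl τ⁻¹)
  have hξle : u (τ⁻¹ * ξ) ≤ 1 := by
    refine u.le_one_of_isIntegral (fun a ha => ?_) hint
    obtain ⟨Q, rfl⟩ := exists_aeval_eq_of_mem_adjoin ha
    exact u.aeval_le_one hK hle' Q
  have hcons : ∀ i, u ((Fin.cons (τ⁻¹ * ξ) (fun i => τ⁻¹ * l' i) : Fin (N + 1) → F) i) ≤ 1 :=
    fun i => Fin.cases hξle hle' i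
  set x : Fin (N + 1) → F := Fin.cons (τ⁻¹ * ξ) (fun i => τ⁻¹ * l' i) with hx
  have hres : (fun i => u.residue (x i)) =
      Fin.cons (u.residue (τ⁻¹ * ξ)) (fun i => u.residue (τ⁻¹ * l' i)) := by
    funext i
    exact Fin.cases rfl (fun i => rfl) i
  let A := Algebra.adjoin K (Set.range fun i => u.residue (τ⁻¹ * l' i))
  have hrint : IsIntegral A (u.residue (τ⁻¹ * ξ)) := by
    refine isIntegral_of_monic_finSuccEquiv hP ?_
    have h1 := u.aeval_residue hK hcons P
    rw [hres, hPl, (u.residue_eq_zero_iff (x := 0) (by rw [map_zero]; exact zero_le)).mpr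
      (by rw [map_zero]; exact zero_lt_one)] at h1
    exact h1
  have hC : ∀ c : K, IsIntegral A
      (algebraMap K (IsLocalRing.ResidueField u.valuationSubring) c) := fun c => by
    rw [IsScalarTower.algebraMap_apply K A]
    exact isIntegral_algebraMap
  have hgen : ∀ i, IsIntegral A (u.residue (τ⁻¹ * l' i)) := fun i =>
    isIntegral_algebraMap (x := (⟨_, Algebra.subset_adjoin ⟨i, rfl⟩⟩ : A))
  have hl : ∀ i, ∃ p : MvPolynomial (Fin (N + 1)) K, τ⁻¹ * l i = aeval x p ∧
      IsIntegral A (aeval (fun i => u.residue (x i)) p) := by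
    intro i
    refine Fin.cases ?_ (fun i => ?_) i
    · refine ⟨C (v 0) * X 0, ?_, ?_⟩
      · rw [map_mul, aeval_C, aeval_X, h0, hx, Fin.cons_zero, Algebra.smul_def]; ring
      · rw [map_mul, aeval_C, aeval_X]
        exact (hC _).mul hrint
    · refine ⟨X i.succ + C (v i.succ) * X 0, ?_, ?_⟩
      · rw [map_add, map_mul, aeval_C, aeval_X, aeval_X, hs, hx, Fin.cons_zero, Fin.cons_succ,
          Algebra.smul_def]; ring
      · rw [map_add, map_mul, aeval_C, aeval_X, aeval_X]
        exact (hgen i).add ((hC _).mul hrint)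
  have hlres : ∀ i, u (τ⁻¹ * l i) ≤ 1 ∧ IsIntegral A (u.residue (τ⁻¹ * l i)) := by
    intro i
    obtain ⟨p, h1, h2⟩ := hl i
    rw [u.aeval_residue hK hcons, ← h1] at h2
    exact ⟨h1 ▸ u.aeval_le_one hK hcons p, h2⟩
  have huτ : u τ ≠ 0 := u.ne_zero_iff.mpr hk'0
  have hτle : u τ ≤ u (l k) := by
    have h1 : τ = l k'.succ - v k'.succ • (v 0)⁻¹ • l 0 := by
      rw [hs, h0, smul_smul (v 0)⁻¹, inv_mul_cancel₀ hv, one_smul, add_sub_cancel_right]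
    rw [h1]
    exact u.map_sub_le (hmax _) ((hsm _ _).trans ((hsm _ _).trans (hmax _)))
  have hlk : u (τ⁻¹ * l k) = 1 := by
    refine le_antisymm (hlres k).1 ?_
    rw [map_mul, map_inv₀]
    exact (one_le_inv_mul₀ (zero_lt_iff.mpr huτ)).mpr hτle
  have hrk : u.residue (τ⁻¹ * l k) ≠ 0 := by
    rw [Ne, u.residue_eq_zero_iff hlk.le, hlk]; exact lt_irrefl _
  have hq : ∀ i, u (l i / l k) ≤ 1 := fun i => by
    rw [map_div₀]; exact div_le_one_of_le₀ (hmax i) zero_le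
  have halg : ∀ a, IsAlgebraic A (u.residue (l (e a) / l k)) := by
    intro a
    have h1 : u.residue (l (e a) / l k) * u.residue (τ⁻¹ * l k) = u.residue (τ⁻¹ * l (e a)) := by
      rw [← Valuation.residue_mul (hq _) hlk.le]
      congr 1
      field_simp
    rw [eq_div_of_mul_eq hrk h1, div_eq_mul_inv]
    exact (hlres _).2.isAlgebraic.mul (hlres _).2.isAlgebraic.inv
  obtain ⟨e', he'⟩ := ((u.algebraicIndependent_residue_iff hK fun a => hq (e a)).mpr
    he).exists_comp_of_isAlgebraic halg
  refine ⟨k', hk'0, hk', e', ?_⟩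
  have h2 := (u.algebraicIndependent_residue_iff hK fun a => hle' (e' a)).mp he'
  simpa only [div_eq_inv_mul] using h2

end Visible

section VisibleFamilies

variable {K F : Type*} [Field K] [Field F] [Algebra K F] {u : Valuation F ℤᵐ⁰}

/-- The family of all products of members of two families. -/
def mulFamily {F : Type*} [Mul F] {N N' : ℕ} (l : Fin N → F) (l' : Fin N' → F) :
    Fin (N * N') → F :=
  fun p => l (finProdFinEquiv.symm p).1 * l' (finProdFinEquiv.symm p).2

theorem Visible.exists_ne_zero {r N : ℕ} {l : Fin N → F} (h : Visible K u r l) :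
    ∃ i, l i ≠ 0 := ⟨h.choose, h.choose_spec.1⟩

theorem exists_ne_zero_mulFamily {N N' : ℕ} {l : Fin N → F} {l' : Fin N' → F}
    (h : ∃ i, l i ≠ 0) (h' : ∃ i, l' i ≠ 0) : ∃ i, mulFamily l l' i ≠ 0 := by
  obtain ⟨i, hi⟩ := h
  obtain ⟨j, hj⟩ := h'
  exact ⟨finProdFinEquiv (i, j), by simpa [mulFamily] using ⟨hi, hj⟩⟩

theorem exists_max_ne_zero (u : Valuation F ℤᵐ⁰) {N : ℕ} {l : Fin N → F} (h : ∃ i, l i ≠ 0) :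
    ∃ k, l k ≠ 0 ∧ ∀ i, u (l i) ≤ u (l k) := by
  obtain ⟨i, hi⟩ := h
  have : Nonempty (Fin N) := ⟨i⟩
  obtain ⟨k, hk⟩ := Finite.exists_max fun i => u (l i)
  refine ⟨k, fun h => ?_, hk⟩
  have := hk i
  rw [h, map_zero] at this
  exact hi (u.zero_iff.mp (le_zero_iff.mp this))

theorem Visible.mulFamily_right {r N N' : ℕ} {l : Fin N → F} (h : Visible K u r l)
    {l' : Fin N' → F} (h' : ∃ i, l' i ≠ 0) : Visible K u r (mulFamily l l') := by
  obtain ⟨k, hk, hmax, e, he⟩ := h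
  obtain ⟨k', hk', hmax'⟩ := exists_max_ne_zero u h'
  refine ⟨finProdFinEquiv (k, k'), by simpa [mulFamily] using ⟨hk, hk'⟩, fun i => ?_,
    fun a => finProdFinEquiv (e a, k'), ?_⟩
  · simp only [mulFamily, Equiv.symm_apply_apply, map_mul]
    exact mul_le_mul' (hmax _) (hmax' _)
  · simpa only [mulFamily, Equiv.symm_apply_apply, mul_div_mul_right _ _ hk'] using he

theorem Visible.mulFamily_left {r N N' : ℕ} {l : Fin N → F} (h : Visible K u r l)
    {l' : Fin N' → F} (h' : ∃ i, l' i ≠ 0) : Visible K u r (mulFamily l' l) := by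
  obtain ⟨k, hk, hmax, e, he⟩ := h
  obtain ⟨k', hk', hmax'⟩ := exists_max_ne_zero u h'
  refine ⟨finProdFinEquiv (k', k), by simpa [mulFamily] using ⟨hk', hk⟩, fun i => ?_,
    fun a => finProdFinEquiv (k', e a), ?_⟩
  · simp only [mulFamily, Equiv.symm_apply_apply, map_mul]
    exact mul_le_mul' (hmax' _) (hmax _)
  · simpa only [mulFamily, Equiv.symm_apply_apply, mul_div_mul_left _ _ hk'] using he

theorem Visible.const_mul {r N : ℕ} {l : Fin N → F} (h : Visible K u r l) {c : F} (hc : c ≠ 0) :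
    Visible K u r (fun i => c * l i) := by
  obtain ⟨k, hk, hmax, e, he⟩ := h
  refine ⟨k, mul_ne_zero hc hk, fun i => ?_, e, ?_⟩
  · rw [map_mul, map_mul]; exact mul_le_mul_right (hmax i) _
  · simpa only [mul_div_mul_left _ _ hc] using he

theorem exists_forall_visible {𝒮 B : Set (Valuation F ℤᵐ⁰ × ℕ)} (hB : B.Finite) {N₀ : ℕ}
    {l₀ : Fin N₀ → F} (hl₀ : ∃ i, l₀ i ≠ 0) (h : ∀ p ∈ 𝒮 \ B, Visible K p.1 p.2 l₀)
    (hv : ∀ p ∈ B, ∃ (N : ℕ) (l : Fin N → F), Visible K p.1 p.2 l) :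
    ∃ (N : ℕ) (l : Fin N → F), ∀ p ∈ 𝒮, Visible K p.1 p.2 l := by
  induction B, hB using Set.Finite.induction_on generalizing N₀ l₀ with
  | empty => exact ⟨N₀, l₀, fun p hp => h p ⟨hp, fun h => h⟩⟩
  | @insert b B _ _ ih =>
    obtain ⟨N, l, hl⟩ := hv b (Set.mem_insert _ _)
    refine ih (exists_ne_zero_mulFamily hl₀ hl.exists_ne_zero) (fun p hp => ?_)
      fun p hp => hv p (Set.mem_insert_of_mem _ hp)
    by_cases hpb : p = b
    · subst hpb
      exact hl.mulFamily_left hl₀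
    · exact (h p ⟨hp.1, fun h => h.elim hpb hp.2⟩).mulFamily_right hl.exists_ne_zero

theorem exists_visible_of_no_relation [Infinite K] {𝒮 : Set (Valuation F ℤᵐ⁰ × ℕ)}
    (hK : ∀ p ∈ 𝒮, ∀ c : K, c ≠ 0 → p.1 (algebraMap K F c) = 1) {N : ℕ} {l : Fin N → F}
    (h : ∀ p ∈ 𝒮, Visible K p.1 p.2 l) :
    ∃ (N : ℕ) (l : Fin N → F), (∀ p ∈ 𝒮, Visible K p.1 p.2 l) ∧
      ∀ (d : ℕ) (H : MvPolynomial (Fin N) K), H.IsHomogeneous d → aeval l H = 0 → H = 0 := by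
  induction N with
  | zero =>
    refine ⟨0, l, h, fun d H _ h0 => ?_⟩
    rw [eq_C_of_isEmpty H, aeval_C] at h0
    rw [eq_C_of_isEmpty H, (map_eq_zero_iff _ (algebraMap K F).injective).mp h0, C_0]
  | succ N ih =>
    by_cases hr : ∀ (d : ℕ) (H : MvPolynomial (Fin (N + 1)) K), H.IsHomogeneous d →
        aeval l H = 0 → H = 0
    · exact ⟨N + 1, l, h, hr⟩
    push Not at hr
    obtain ⟨d, H, hd, hl, hH⟩ := hr
    obtain ⟨v, ξ, l', P, hv, h0, hs, hP, hPl, hz⟩ := exists_linear_projection l hd hH hl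
    exact ih fun p hp => (h p hp).linear_projection (hK p hp) hv h0 hs hP hPl hz

/-- The homogenization of a polynomial with respect to a new variable `X 0`. -/
noncomputable def homogenization {K : Type*} [Field K] {M : ℕ} (Q : MvPolynomial (Fin M) K) :
    MvPolynomial (Fin (M + 1)) K :=
  ∑ i ∈ Finset.range (Q.totalDegree + 1),
    rename Fin.succ (homogeneousComponent i Q) * X 0 ^ (Q.totalDegree - i)

theorem aeval_homogenization {K A : Type*} [Field K] [CommRing A] [Algebra K A] {M : ℕ}
    (Q : MvPolynomial (Fin M) K) (y : Fin M → A) :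
    aeval (Fin.cons 1 y : Fin (M + 1) → A) (homogenization Q) = aeval y Q := by
  conv_rhs => rw [← sum_homogeneousComponent Q]
  rw [homogenization, map_sum, map_sum]
  refine Finset.sum_congr rfl fun i _ => ?_
  rw [map_mul, map_pow, aeval_X, Fin.cons_zero, one_pow, mul_one, aeval_rename]
  rfl

theorem isHomogeneous_homogenization {K : Type*} [Field K] {M : ℕ}
    (Q : MvPolynomial (Fin M) K) : (homogenization Q).IsHomogeneous Q.totalDegree := by
  refine IsHomogeneous.sum _ _ _ fun i hi => ?_
  have h1 : i + (Q.totalDegree - i) = Q.totalDegree := by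
    have := Finset.mem_range.mp hi; omega
  have h2 := ((homogeneousComponent_isHomogeneous i Q).rename_isHomogeneous
    (f := (Fin.succ : Fin M → Fin (M + 1)))).mul
    ((isHomogeneous_X K (0 : Fin (M + 1))).pow (Q.totalDegree - i))
  rwa [one_mul, h1] at h2

/-- A family without homogeneous relations has algebraically independent ratios. -/
theorem algebraicIndependent_of_no_relation {M : ℕ} {x : Fin M → F}
    (h : ∀ (d : ℕ) (H : MvPolynomial (Fin (M + 1)) K), H.IsHomogeneous d →
      aeval (Fin.cons 1 x : Fin (M + 1) → F) H = 0 → H = 0) : AlgebraicIndependent K x := by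
  rw [algebraicIndependent_iff]
  intro Q hQ
  have h0 := h _ _ (isHomogeneous_homogenization Q) (by rw [aeval_homogenization, hQ])
  have h3 := aeval_homogenization Q (X : Fin M → MvPolynomial (Fin M) K)
  rw [h0, map_zero, aeval_X_left_apply] at h3
  exact h3.symm

theorem exists_isTranscendenceBasis_visible [Infinite K] {𝒮 : Set (Valuation F ℤᵐ⁰ × ℕ)}
    (hK : ∀ p ∈ 𝒮, ∀ c : K, c ≠ 0 → p.1 (algebraMap K F c) = 1) {n : ℕ}
    (hn : Algebra.trdeg K F = n) {u₀ : Valuation F ℤᵐ⁰} (h1 : (u₀, n) ∈ 𝒮) {N : ℕ} {l : Fin N → F}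
    (h : ∀ p ∈ 𝒮, Visible K p.1 p.2 l) :
    ∃ x : Fin n → F, IsTranscendenceBasis K x ∧
      ∀ p ∈ 𝒮, Visible K p.1 p.2 (Fin.cons 1 x : Fin (n + 1) → F) := by
  obtain ⟨N, l, hl, hrel⟩ := exists_visible_of_no_relation hK h
  obtain ⟨k, hk, -, e, he⟩ := hl _ h1
  obtain ⟨M, rfl⟩ : ∃ M, N = M + 1 := ⟨N - 1, by have := k.pos; omega⟩
  have hl0 : l 0 ≠ 0 := by
    intro h0
    exact X_ne_zero (R := K) (0 : Fin (M + 1)) (hrel 1 (X 0) (isHomogeneous_X K _) (by rwa [aeval_X]))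
  let x : Fin M → F := fun i => (l 0)⁻¹ * l i.succ
  have hx : (Fin.cons 1 x : Fin (M + 1) → F) = fun i => (l 0)⁻¹ * l i := by
    funext i
    refine Fin.cases ?_ (fun i => ?_) i
    · rw [Fin.cons_zero, inv_mul_cancel₀ hl0]
    · rw [Fin.cons_succ]
  have hvis : ∀ p ∈ 𝒮, Visible K p.1 p.2 (Fin.cons 1 x : Fin (M + 1) → F) := fun p hp => by
    rw [hx]; exact (hl p hp).const_mul (inv_ne_zero hl0)
  have hind : AlgebraicIndependent K x := by
    refine algebraicIndependent_of_no_relation fun d H hd h0 => hrel d H hd ?_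
    rw [hx, aeval_mul_of_isHomogeneous hd] at h0
    exact (mul_eq_zero.mp h0).resolve_left (pow_ne_zero _ (inv_ne_zero hl0))
  have hle : M ≤ n := by
    have := hind.lift_cardinalMk_le_trdeg
    rw [hn] at this
    simpa using this
  have hind' : AlgebraicIndependent K (fun a => l (e a) / l k) := by
    rw [algebraicIndependent_iff]
    intro Q hQ
    by_contra hQ0
    have := he Q hQ0
    rw [hQ, map_zero] at this
    exact zero_ne_one this
  have hal : ∀ i, IsAlgebraic (Algebra.adjoin K (Set.range x)) ((l 0)⁻¹ * l i) := by
    intro i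
    rw [← congrFun hx i]
    refine Fin.cases ?_ (fun i => ?_) i
    · rw [Fin.cons_zero]; exact isAlgebraic_one
    · rw [Fin.cons_succ]
      exact isAlgebraic_algebraMap (⟨x i, Algebra.subset_adjoin ⟨i, rfl⟩⟩ :
        Algebra.adjoin K (Set.range x))
  obtain ⟨f, hf⟩ := hind'.exists_comp_of_isAlgebraic (c := x) fun a => by
    have : l (e a) / l k = ((l 0)⁻¹ * l (e a)) * ((l 0)⁻¹ * l k)⁻¹ := by field_simp
    rw [this]
    exact (hal _).mul (hal _).inv
  have hge : n ≤ M := by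
    have := Fintype.card_le_of_injective f (hf.injective.of_comp)
    simpa using this
  obtain rfl := le_antisymm hle hge
  refine ⟨x, hind.isTranscendenceBasis_of_lift_trdeg_le (by rw [hn]; simp) ?_, hvis⟩
  rw [hn]; simp

end VisibleFamilies

theorem exists_equiv_cons {n : ℕ} {e : Fin n → Fin (n + 1)} {k : Fin (n + 1)}
    (he : Function.Injective e) (hk : ∀ i, e i ≠ k) :
    ∃ σ : Fin (n + 1) ≃ Fin (n + 1), σ 0 = k ∧ ∀ i, σ i.succ = e i := by
  have hinj : Function.Injective (Fin.cons k e : Fin (n + 1) → Fin (n + 1)) := by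
    rw [Fin.cons_injective_iff]
    exact ⟨by rintro ⟨i, hi⟩; exact hk i hi, he⟩
  refine ⟨Equiv.ofBijective _ (Finite.injective_iff_bijective.mp hinj), ?_, fun i => ?_⟩
  · rw [Equiv.ofBijective_apply, Fin.cons_zero]
  · rw [Equiv.ofBijective_apply, Fin.cons_succ]

theorem exists_notMem_range_fin {n : ℕ} (e : Fin n → Fin (n + 1)) : ∃ k, ∀ i, e i ≠ k := by
  by_contra! h
  have := Fintype.card_le_of_surjective e h
  simp at this

section AlmostGeneric

variable {K E : Type*} [Field K] [Field E] [Algebra K E] {n : ℕ}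

theorem associated_of_aeval_cons_eq_zero {y : Fin n → E} (hy : AlgebraicIndependent K y) {ξ : E}
    {Q₁ Q₂ : MvPolynomial (Fin (n + 1)) K} (h₁ : Irreducible Q₁) (h₂ : Irreducible Q₂)
    (h₁0 : aeval (Fin.cons ξ y : Fin (n + 1) → E) Q₁ = 0)
    (h₂0 : aeval (Fin.cons ξ y : Fin (n + 1) → E) Q₂ = 0) : Associated Q₁ Q₂ := by
  let A := MvPolynomial (Fin n) K
  let G := FractionRing A
  let f : A →+* E := (aeval y : A →ₐ[K] E).toRingHom
  have hf : Function.Injective f := hy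
  let φ : G →+* E := IsFractionRing.lift hf
  have hφ : φ.comp (algebraMap A G) = f := by
    ext a <;> simp [φ]
  have key : ∀ Q : MvPolynomial (Fin (n + 1)) K, Irreducible Q →
      aeval (Fin.cons ξ y : Fin (n + 1) → E) Q = 0 →
      (finSuccEquiv K n Q).IsPrimitive ∧
        Irreducible ((finSuccEquiv K n Q).map (algebraMap A G)) ∧
        ((finSuccEquiv K n Q).map (algebraMap A G)).eval₂ φ ξ = 0 := by
    intro Q hQ h0
    have hirr : Irreducible (finSuccEquiv K n Q) :=
      (MulEquiv.irreducible_iff (finSuccEquiv K n)).mpr hQ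
    rw [aeval_cons_eq_eval, Polynomial.eval_map] at h0
    have hpr : (finSuccEquiv K n Q).IsPrimitive := by
      refine hirr.isPrimitive fun hd => ?_
      rw [Polynomial.eq_C_of_natDegree_eq_zero hd, Polynomial.eval₂_C] at h0
      have h2 := (map_eq_zero_iff f hf).mp h0
      refine hirr.ne_zero ?_
      rw [Polynomial.eq_C_of_natDegree_eq_zero hd, h2, map_zero]
    refine ⟨hpr, hpr.irreducible_iff_irreducible_map_fraction_map.mp hirr, ?_⟩
    rw [Polynomial.eval₂_map, hφ]
    exact h0
  obtain ⟨p₁, i₁, z₁⟩ := key Q₁ h₁ h₁0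
  obtain ⟨p₂, i₂, z₂⟩ := key Q₂ h₂ h₂0
  let := φ.toAlgebra
  have hd : (finSuccEquiv K n Q₁).map (algebraMap A G) ∣
      (finSuccEquiv K n Q₂).map (algebraMap A G) := by
    have d₁ := minpoly.dvd G ξ (p := (finSuccEquiv K n Q₁).map (algebraMap A G)) z₁
    have d₂ := minpoly.dvd G ξ (p := (finSuccEquiv K n Q₂).map (algebraMap A G)) z₂
    have hn : ¬ IsUnit (minpoly G ξ) := minpoly.not_isUnit G ξ
    exact ((i₁.dvd_iff.mp d₁).resolve_left hn).dvd.trans d₂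
  have h3 := p₁.dvd_of_fraction_map_dvd_fraction_map hd
  have h4 : Q₁ ∣ Q₂ := (map_dvd_iff (finSuccEquiv K n)).mp h3
  exact h₁.associated_of_dvd h₂ h4

theorem associated_of_aeval_eq_zero {c : Fin (n + 1) → E} {e : Fin n → Fin (n + 1)}
    (hc : AlgebraicIndependent K (c ∘ e))
    {Q₁ Q₂ : MvPolynomial (Fin (n + 1)) K} (h₁ : Irreducible Q₁) (h₂ : Irreducible Q₂)
    (h₁0 : aeval c Q₁ = 0) (h₂0 : aeval c Q₂ = 0) : Associated Q₁ Q₂ := by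
  obtain ⟨k, hk⟩ := exists_notMem_range_fin e
  obtain ⟨σ, -, hσ⟩ := exists_equiv_cons hc.injective.of_comp hk
  have hcσ : c = (Fin.cons (c (σ 0)) (c ∘ e) : Fin (n + 1) → E) ∘ σ.symm := by
    rw [← Equiv.comp_symm_eq, Equiv.symm_symm]
    funext i
    refine Fin.cases rfl (fun i => ?_) i
    rw [Fin.cons_succ, Function.comp_apply, hσ]; rfl
  rw [hcσ, ← aeval_rename] at h₁0 h₂0
  have hr : ∀ {Q : MvPolynomial (Fin (n + 1)) K}, Irreducible Q →
      Irreducible (rename σ.symm Q) := fun hQ =>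
    (MulEquiv.irreducible_iff (renameEquiv K σ.symm)).mpr hQ
  have h := associated_of_aeval_cons_eq_zero hc (hr h₁) (hr h₂) h₁0 h₂0
  have h' := h.map (renameEquiv K σ.symm).symm
  have hs : ∀ Q : MvPolynomial (Fin (n + 1)) K,
      (renameEquiv K σ.symm).symm (rename σ.symm Q) = Q := fun Q =>
    (renameEquiv K σ.symm).symm_apply_apply Q
  rwa [hs, hs] at h'

/-- A nonzero homogeneous polynomial does not vanish at a point with one coordinate `1` and the
others algebraically independent. -/
theorem aeval_ne_zero_of_isHomogeneous {c : Fin (n + 1) → E} {e : Fin n → Fin (n + 1)}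
    {k : Fin (n + 1)} (hk : c k = 1) (hc : AlgebraicIndependent K (c ∘ e)) {d : ℕ}
    {H : MvPolynomial (Fin (n + 1)) K} (hd : H.IsHomogeneous d) (hH : H ≠ 0) :
    aeval c H ≠ 0 := by
  intro h0
  have hke : ∀ i, e i ≠ k := by
    rintro i rfl
    exact (hc.transcendental i) (by rw [Function.comp_apply, hk]; exact isAlgebraic_one)
  obtain ⟨σ, hσ0, hσ⟩ := exists_equiv_cons hc.injective.of_comp hke
  let G := FractionRing (MvPolynomial (Fin (n + 1)) K)
  let D : MvPolynomial (Fin (n + 1)) K →ₐ[K] MvPolynomial (Fin n) K :=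
    aeval ((Fin.cons 1 X : Fin (n + 1) → MvPolynomial (Fin n) K) ∘ σ.symm)
  have hD : aeval (c ∘ e) (D H) = 0 := by
    rw [← AlgHom.comp_apply]
    have : (aeval (c ∘ e)).comp D = aeval c := by
      refine MvPolynomial.algHom_ext fun i => ?_
      obtain ⟨j, rfl⟩ := σ.surjective i
      rw [AlgHom.comp_apply, aeval_X, aeval_X, Function.comp_apply, Equiv.symm_apply_apply]
      refine Fin.cases ?_ (fun i => ?_) j
      · rw [Fin.cons_zero, map_one, hσ0, hk]
      · rw [Fin.cons_succ, aeval_X, hσ]; rfl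
    rw [this, h0]
  have hD0 : D H = 0 := hc (by rw [hD, map_zero])
  let x : Fin (n + 1) → G := fun i => algebraMap (MvPolynomial (Fin (n + 1)) K) G (X i)
  have hx : ∀ i, x i ≠ 0 := fun i =>
    (map_ne_zero_iff _ (IsFractionRing.injective _ G)).mpr (X_ne_zero i)
  have h1 : (aeval fun i => (x k)⁻¹ * x i : MvPolynomial (Fin (n + 1)) K →ₐ[K] G) =
      (aeval fun i => (x k)⁻¹ * x (e i)).comp D := by
    refine MvPolynomial.algHom_ext fun i => ?_
    obtain ⟨j, rfl⟩ := σ.surjective i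
    rw [AlgHom.comp_apply, aeval_X, aeval_X, Function.comp_apply, Equiv.symm_apply_apply]
    refine Fin.cases ?_ (fun i => ?_) j
    · rw [Fin.cons_zero, map_one, hσ0, inv_mul_cancel₀ (hx k)]
    · rw [Fin.cons_succ, aeval_X, hσ]
  have h2 : aeval (fun i => (x k)⁻¹ * x i) H = 0 := by
    rw [h1, AlgHom.comp_apply, hD0, map_zero]
  rw [aeval_mul_of_isHomogeneous hd] at h2
  have h3 := (mul_eq_zero.mp h2).resolve_left (pow_ne_zero _ (inv_ne_zero (hx k)))
  have h4 : aeval x H = algebraMap _ G H := by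
    have := aeval_algebraMap_apply (R := K) G (X : _ → MvPolynomial (Fin (n + 1)) K) H
    rwa [aeval_X_left_apply] at this
  rw [h4] at h3
  exact hH ((map_eq_zero_iff _ (IsFractionRing.injective _ G)).mp h3)

end AlmostGeneric

section Visible

variable {K F : Type*} [Field K] [Field F] [Algebra K F] {u : Valuation F ℤᵐ⁰}

/-- Values of irreducible polynomials at a family visible up to codimension one. -/
theorem Visible.exists_valuation_eq_pow (hK : ∀ c : K, c ≠ 0 → u (algebraMap K F c) = 1) {n : ℕ}
    {x : Fin (n + 1) → F} (h : Visible K u n (Fin.cons 1 x : Fin (n + 2) → F)) :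
    ∃ ρ : ℤᵐ⁰, 1 ≤ ρ ∧ (∀ i, u (x i) ≤ ρ) ∧ ∃ g : MvPolynomial (Fin (n + 1)) K,
      ∀ Q : MvPolynomial (Fin (n + 1)) K, Irreducible Q → ¬ Associated g Q →
        u (aeval x Q) = ρ ^ Q.totalDegree := by
  let := u.residueAlgebra hK
  obtain ⟨k, hk, hmax, e, he⟩ := h
  set l : Fin (n + 2) → F := Fin.cons 1 x with hl
  have hl0 : u (l 0) = 1 := by rw [hl, Fin.cons_zero, map_one]
  have h1ρ : 1 ≤ u (l k) := hl0 ▸ hmax 0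
  have hxρ : ∀ i, u (x i) ≤ u (l k) := fun i => hmax i.succ
  have hq : ∀ i, u (l i / l k) ≤ 1 := fun i => by
    rw [map_div₀]; exact div_le_one_of_le₀ (hmax i) zero_le
  have hlk : u (l k) ≠ 0 := u.ne_zero_iff.mpr hk
  let c : Fin (n + 1) → IsLocalRing.ResidueField u.valuationSubring :=
    fun i => u.residue (x i / l k)
  have hq0 : u (l 0 / l k) < 1 ∨ u (l k) = 1 := by
    rcases h1ρ.lt_or_eq with h | h
    · left
      rw [map_div₀, hl0]
      exact (div_lt_one₀ (zero_lt_iff.mpr hlk)).mpr h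
    · exact Or.inr h.symm
  have hind := (u.algebraicIndependent_residue_iff hK fun a => hq (e a)).mpr he
  have hqx : ∀ i, u (x i / l k) ≤ 1 := fun i => hq i.succ
  rcases hq0 with h0 | h1
  · obtain ⟨k', rfl⟩ : ∃ k', k = Fin.succ k' := by
      refine ⟨k.pred ?_, (Fin.succ_pred _ _).symm⟩
      rintro rfl
      rw [div_self hk, map_one] at h0
      exact lt_irrefl _ h0
    have hk' : c k' = 1 := by
      have : x k' / l k'.succ = 1 := div_self hk
      simp only [c, this]
      rw [u.residue_of_le (by rw [map_one])]
      exact map_one _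
    obtain ⟨e', he'⟩ := hind.exists_comp_of_isAlgebraic (c := c) fun a => by
      generalize e a = j
      refine Fin.cases ?_ (fun i => ?_) j
      · rw [(u.residue_eq_zero_iff (hq 0)).mpr h0]; exact isAlgebraic_zero
      · exact isAlgebraic_algebraMap (⟨c i, Algebra.subset_adjoin ⟨i, rfl⟩⟩ :
          Algebra.adjoin K (Set.range c))
    have hρ : 1 < u (l k'.succ) := by
      rw [map_div₀, hl0] at h0
      exact (div_lt_one₀ (zero_lt_iff.mpr hlk)).mp h0
    refine ⟨u (l k'.succ), h1ρ, hxρ, 0, fun Q hQ _ => ?_⟩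
    have hcomp : ∀ i, aeval x (homogeneousComponent i Q) =
        l k'.succ ^ i * aeval (fun j => x j / l k'.succ) (homogeneousComponent i Q) := fun i => by
      rw [← aeval_mul_of_isHomogeneous (homogeneousComponent_isHomogeneous i Q)]
      congr 2
      funext j
      rw [mul_div_cancel₀ _ hk]
    have hlead : u (aeval (fun j => x j / l k'.succ)
        (homogeneousComponent Q.totalDegree Q)) = 1 := by
      refine le_antisymm (u.aeval_le_one hK hqx _) ?_
      rw [← not_lt, ← u.residue_eq_zero_iff (u.aeval_le_one hK hqx _), ← u.aeval_residue hK hqx]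
      exact aeval_ne_zero_of_isHomogeneous hk' he' (homogeneousComponent_isHomogeneous _ Q)
        (homogeneousComponent_totalDegree_ne_zero hQ.ne_zero)
    have hsum := congrArg (aeval x) (sum_homogeneousComponent Q)
    rw [Finset.sum_range_succ, map_add, map_sum] at hsum
    have hd : u (aeval x (homogeneousComponent Q.totalDegree Q)) =
        u (l k'.succ) ^ Q.totalDegree := by
      rw [hcomp, map_mul, map_pow, hlead, mul_one]
    rw [← hsum, ← hd]
    refine u.map_add_eq_of_lt_right ?_
    refine u.map_sum_lt ?_ fun i hi => ?_
    · rw [hd]; exact pow_ne_zero _ hlk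
    · rw [hd, hcomp, map_mul, map_pow]
      refine lt_of_le_of_lt (mul_le_mul_right (u.aeval_le_one hK hqx _) _) ?_
      rw [mul_one]
      exact pow_lt_pow_right₀ hρ (Finset.mem_range.mp hi)
  · refine ⟨1, le_rfl, fun i => h1 ▸ hxρ i, ?_⟩
    have hx1 : ∀ i, u (x i) ≤ 1 := fun i => h1 ▸ hxρ i
    let b : Fin (n + 1) → IsLocalRing.ResidueField u.valuationSubring := fun i => u.residue (x i)
    have hl1 : ∀ j, IsAlgebraic (Algebra.adjoin K (Set.range b)) (u.residue (l j)) := by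
      intro j
      refine Fin.cases ?_ (fun i => ?_) j
      · rw [hl, Fin.cons_zero, u.residue_of_le (by rw [map_one])]
        exact isAlgebraic_one
      · exact isAlgebraic_algebraMap (⟨b i, Algebra.subset_adjoin ⟨i, rfl⟩⟩ :
          Algebra.adjoin K (Set.range b))
    have hrk : u.residue (l k) ≠ 0 := by
      rw [Ne, u.residue_eq_zero_iff h1.le, h1]; exact lt_irrefl _
    obtain ⟨e', he'⟩ := hind.exists_comp_of_isAlgebraic (c := b) fun a => by
      have h2 : u.residue (l (e a) / l k) * u.residue (l k) = u.residue (l (e a)) := by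
        rw [← Valuation.residue_mul (hq _) h1.le, div_mul_cancel₀ _ hk]
      rw [eq_div_of_mul_eq hrk h2, div_eq_mul_inv]
      exact (hl1 _).mul (hl1 _).inv
    by_cases hex : ∃ g : MvPolynomial (Fin (n + 1)) K, Irreducible g ∧ aeval b g = 0
    · obtain ⟨g, hg, hg0⟩ := hex
      refine ⟨g, fun Q hQ hgQ => ?_⟩
      rw [one_pow]
      refine le_antisymm (u.aeval_le_one hK hx1 _) ?_
      rw [← not_lt, ← u.residue_eq_zero_iff (u.aeval_le_one hK hx1 _), ← u.aeval_residue hK hx1]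
      exact fun h => hgQ (associated_of_aeval_eq_zero he' hg hQ hg0 h)
    · push Not at hex
      refine ⟨0, fun Q hQ _ => ?_⟩
      rw [one_pow]
      refine le_antisymm (u.aeval_le_one hK hx1 _) ?_
      rw [← not_lt, ← u.residue_eq_zero_iff (u.aeval_le_one hK hx1 _), ← u.aeval_residue hK hx1]
      exact hex Q hQ

end Visible

section ResidueIntegral

variable {K F : Type*} [Field K] [Field F] [Algebra K F] {u : Valuation F ℤᵐ⁰}

theorem exists_monic_finSuccEquiv {m : ℕ} {t : Fin m → F} {s : F}
    (hs : IsIntegral (Algebra.adjoin K (Set.range t)) s) :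
    ∃ P : MvPolynomial (Fin (m + 1)) K, (finSuccEquiv K m P).Monic ∧
      aeval (Fin.cons s t : Fin (m + 1) → F) P = 0 := by
  obtain ⟨p, hp, h0⟩ := hs
  let f : MvPolynomial (Fin m) K →ₐ[K] Algebra.adjoin K (Set.range t) :=
    (aeval t).codRestrict _ aeval_mem_adjoin
  have hf : Function.Surjective f := fun a => by
    obtain ⟨Q, hQ⟩ := exists_aeval_eq_of_mem_adjoin a.2
    exact ⟨Q, Subtype.ext hQ⟩
  have hl : p ∈ Polynomial.lifts f.toRingHom := by
    rw [Polynomial.lifts_iff_coeff_lifts]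
    exact fun i => hf _
  obtain ⟨q, hq, -, hqm⟩ := Polynomial.lifts_and_natDegree_eq_and_monic hl hp
  refine ⟨(finSuccEquiv K m).symm q, by rwa [AlgEquiv.apply_symm_apply], ?_⟩
  rw [aeval_cons_eq_eval, AlgEquiv.apply_symm_apply, Polynomial.eval_map]
  rw [← hq, Polynomial.eval₂_map] at h0
  exact h0

theorem Valuation.isIntegral_residue (hK : ∀ c : K, c ≠ 0 → u (algebraMap K F c) = 1) {m : ℕ}
    {t : Fin m → F} (ht : ∀ i, u (t i) ≤ 1) {s : F}
    (hs : IsIntegral (Algebra.adjoin K (Set.range t)) s) :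
    letI := u.residueAlgebra hK
    u s ≤ 1 ∧ IsIntegral (Algebra.adjoin K (Set.range fun i => u.residue (t i))) (u.residue s) := by
  let := u.residueAlgebra hK
  have h1 : u s ≤ 1 := by
    refine u.le_one_of_isIntegral (fun a ha => ?_) hs
    obtain ⟨Q, rfl⟩ := exists_aeval_eq_of_mem_adjoin ha
    exact u.aeval_le_one hK ht Q
  obtain ⟨P, hP, h0⟩ := exists_monic_finSuccEquiv hs
  refine ⟨h1, isIntegral_of_monic_finSuccEquiv hP ?_⟩
  have h2 := u.aeval_residue hK (x := (Fin.cons s t : Fin (m + 1) → F)) (fun i =>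
    Fin.cases h1 ht i) P
  rw [h0, (u.residue_eq_zero_iff (x := 0) (by rw [map_zero]; exact zero_le)).mpr
    (by rw [map_zero]; exact zero_lt_one)] at h2
  rw [← h2]
  congr 2
  funext i
  exact Fin.cases rfl (fun i => rfl) i

theorem visible_cons_one {r n : ℕ} {x : Fin n → F} (hx : ∀ i, u (x i) ≤ 1) (s : Fin r → Fin n)
    (hs : ∀ Q : MvPolynomial (Fin r) K, Q ≠ 0 → u (aeval (x ∘ s) Q) = 1) :
    Visible K u r (Fin.cons 1 x : Fin (n + 1) → F) := by
  refine ⟨0, one_ne_zero, fun i => ?_, fun a => (s a).succ, ?_⟩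
  · rw [Fin.cons_zero, map_one]
    refine Fin.cases ?_ (fun i => ?_) i
    · rw [Fin.cons_zero, map_one]
    · rw [Fin.cons_succ]; exact hx i
  · simpa only [Fin.cons_zero, Fin.cons_succ, div_one, Function.comp_def] using hs

end ResidueIntegral

theorem exists_isTranscendenceBasis_extension {K L : Type*} [Field K] [Field L] [Algebra K L]
    {n m : ℕ} {y : Fin n → L} (hy : AlgebraicIndependent K y) (hm : Algebra.trdeg K L = m) :
    ∃ (t : Fin m → L) (e : Fin n → Fin m), IsTranscendenceBasis K t ∧ ∀ i, t (e i) = y i := by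
  obtain ⟨s, hys, hs⟩ := exists_isTranscendenceBasis_superset hy.coe_range
  have hc := hs.cardinalMk_eq_trdeg
  rw [hm] at hc
  have : Finite s := Cardinal.lt_aleph0_iff_finite.mp (hc ▸ Cardinal.natCast_lt_aleph0)
  have e : Fin m ≃ s := by
    refine (Finite.equivFinOfCardEq ?_).symm
    rw [Nat.card, hc, Cardinal.toNat_natCast]
  refine ⟨fun i => e i, fun i => e.symm ⟨y i, hys ⟨i, rfl⟩⟩, hs.comp_equiv e, fun i => ?_⟩
  simp

theorem exists_comp_mem_range {n m : ℕ} {e₀ : Fin (n + 1) → Fin (m + 1)}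
    (he₀ : Function.Injective e₀) {e : Fin m → Fin (m + 1)} (he : Function.Injective e) :
    ∃ s : Fin n → Fin (n + 1), Function.Injective s ∧ ∀ i, e₀ (s i) ∈ Set.range e := by
  obtain ⟨k, hk⟩ := exists_notMem_range_fin e
  obtain ⟨σ, h0, hσ⟩ := exists_equiv_cons he hk
  have hr : ∀ j, j ≠ k → j ∈ Set.range e := by
    intro j hj
    obtain ⟨i, rfl⟩ := σ.surjective j
    have hi : i ≠ 0 := fun h => hj (h ▸ h0)
    exact ⟨i.pred hi, by rw [← hσ, Fin.succ_pred]⟩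
  by_cases h : ∃ k₀, e₀ k₀ = k
  · obtain ⟨k₀, rfl⟩ := h
    exact ⟨k₀.succAbove, k₀.succAbove_right_injective, fun i =>
      hr _ fun h => k₀.succAbove_ne i (he₀ h)⟩
  · push Not at h
    exact ⟨Fin.succ, Fin.succ_injective _, fun i => hr _ (h _)⟩

section Places

variable {K F L : Type*} [Field K] [Field F] [Field L] [Algebra K F] [Algebra K L] [CharZero K]
  [Algebra.EssFiniteType K L] {m n : ℕ} {z : Fin (m + 1) → L} (hz : IsTranscendenceBasis K z)
  (j : Fin (m + 1))
include hz

theorem finite_allPlaces_not_visible (ψ : F →ₐ[K] L) {x : Fin (n + 1) → F}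
    (hx : AlgebraicIndependent K x) :
    {w ∈ allPlaces K z j | ¬ Visible K (w.comap (ψ : F →+* L)) n
      (Fin.cons 1 x : Fin (n + 2) → F)}.Finite := by
  have hm : Algebra.trdeg K L = (m + 1 : ℕ) := by
    have := hz.lift_cardinalMk_eq_trdeg
    simpa using this.symm
  have hψ : Function.Injective ψ := ψ.toRingHom.injective
  obtain ⟨t, e₀, ht, hte₀⟩ := exists_isTranscendenceBasis_extension (hx.map' hψ) hm
  have he₀ : Function.Injective e₀ := by
    intro a b hab
    have := congrArg t hab
    rw [hte₀, hte₀] at this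
    exact (hx.map' hψ).injective this
  choose c hc0 hc using fun i => exists_aeval_mul_isIntegral ht (z i)
  have hct : ∀ i, aeval t (c i) ≠ 0 := fun i h => hc0 i (ht.1 (by rw [h, map_zero]))
  refine (((finite_placesOver_infinity hz j).union
    (Set.finite_iUnion fun i => finite_allPlaces_ne_one hz j (hct i))).union
    (Set.finite_iUnion fun i => finite_allPlaces_ne_one hz j (ht.1.ne_zero i))).subset ?_
  rintro w ⟨hw, hvis⟩
  by_contra hcon
  simp only [Set.mem_union, Set.mem_iUnion, not_or, not_exists] at hcon
  obtain ⟨⟨h1, h2⟩, h3⟩ := hcon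
  have h2' : ∀ i, w (aeval t (c i)) = 1 := fun i => by
    by_contra h; exact h2 i ⟨hw, h⟩
  have h3' : ∀ i, w (t i) ≤ 1 := fun i => by
    by_contra h; exact h3 i ⟨hw, fun h' => h h'.le⟩
  have hfin : w ∈ finitePlaces K z := hw.resolve_right h1
  have hK : ∀ c : K, c ≠ 0 → w (algebraMap K L c) = 1 := fun c hc => allPlaces_algebraMap hz j hw hc
  let := w.residueAlgebra hK
  obtain ⟨t', i, ht', hi⟩ := allPlaces_exists_succAbove hz j hw
  obtain rfl := ht' hfin
  have hzw : ∀ i, w (t' i) ≤ 1 := fun i =>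
    le_one_of_isIntegral_of_mem_finitePlaces hz hfin
      (isIntegral_algebraMap (x := (⟨t' i, Algebra.subset_adjoin ⟨i, rfl⟩⟩ :
        Algebra.adjoin K (Set.range t'))))
  have hind := (w.algebraicIndependent_residue_iff hK (x := t' ∘ i.succAbove)
    fun i => hzw _).mpr hi
  have hint := fun i => w.isIntegral_residue hK h3' (hc i)
  have halg : ∀ i, IsAlgebraic (Algebra.adjoin K (Set.range fun i => w.residue (t i)))
      (w.residue (t' i)) := by
    intro i
    have h4 : w.residue (aeval t (c i) * t' i) =
        w.residue (aeval t (c i)) * w.residue (t' i) := w.residue_mul (h2' i).le (hzw i)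
    have h5 : w.residue (aeval t (c i)) ≠ 0 := by
      rw [Ne, w.residue_eq_zero_iff (h2' i).le, h2']; exact lt_irrefl _
    have h6 : w.residue (t' i) = (w.residue (aeval t (c i)))⁻¹ *
        w.residue (aeval t (c i) * t' i) := by rw [h4, inv_mul_cancel_left₀ h5]
    rw [h6]
    refine IsAlgebraic.mul (IsAlgebraic.inv ?_) (hint i).2.isAlgebraic
    rw [← w.aeval_residue hK h3']
    exact isAlgebraic_algebraMap (⟨_, aeval_mem_adjoin (c i)⟩ :
      Algebra.adjoin K (Set.range fun i => w.residue (t i)))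
  obtain ⟨e, he⟩ := hind.exists_comp_of_isAlgebraic fun a => halg (i.succAbove a)
  obtain ⟨s, hs, hse⟩ := exists_comp_mem_range he₀ he.injective.of_comp
  choose f hf using hse
  have hf' : Function.Injective f := fun a b hab => by
    have := congrArg e hab
    rw [hf, hf] at this
    exact hs (he₀ this)
  have hfin' := (w.algebraicIndependent_residue_iff hK (x := t ∘ e₀ ∘ s) fun i => h3' _).mp (by
    have h6 : (fun i => w.residue ((t ∘ e₀ ∘ s) i)) = ((fun i => w.residue (t i)) ∘ e) ∘ f :=
      funext fun i => by simp [hf]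
    rw [h6]
    exact he.comp f hf')
  refine hvis (visible_cons_one (fun i => ?_) s fun Q hQ => ?_)
  · rw [Valuation.comap_apply]
    have := h3' (e₀ i)
    rwa [hte₀] at this
  · rw [Valuation.comap_apply]
    have h7 := hfin' Q hQ
    have h8 : t ∘ e₀ ∘ s = ψ ∘ (x ∘ s) := by funext i; simp [hte₀]
    rw [h8] at h7
    rw [← h7]
    congr 1
    exact (comp_aeval_apply (x ∘ s) ψ Q)

theorem exists_isTranscendenceBasis_valuation_eq_pow {ι : Type*} [Finite ι]
    (hF : Algebra.trdeg K F = (n + 1 : ℕ)) (φ : ι → F →ₐ[K] L) :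
    ∃ x : Fin (n + 1) → F, IsTranscendenceBasis K x ∧ ∀ a, ∀ w ∈ allPlaces K z j,
      ∃ ρ : ℤᵐ⁰, 1 ≤ ρ ∧ (∀ i, w (φ a (x i)) ≤ ρ) ∧ ∃ g : MvPolynomial (Fin (n + 1)) K,
        ∀ Q : MvPolynomial (Fin (n + 1)) K, Irreducible Q → ¬ Associated g Q →
          w (φ a (aeval x Q)) = ρ ^ Q.totalDegree := by
  classical
  have hm : Algebra.trdeg K L = (m + 1 : ℕ) := by
    have := hz.lift_cardinalMk_eq_trdeg
    simpa using this.symm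
  obtain ⟨x₀, -, hx₀, -⟩ := exists_isTranscendenceBasis_extension (K := K) (L := F) (n := 0)
    (m := n + 1) (y := Fin.elim0) (algebraicIndependent_empty_type_iff.mpr
      (algebraMap K F).injective) hF
  let 𝒱 : Set (Valuation F ℤᵐ⁰ × ℕ) :=
    {p | ∃ a, ∃ w ∈ allPlaces K z j, p = (w.comap (φ a : F →+* L), n)}
  let B : Set (Valuation F ℤᵐ⁰ × ℕ) := ⋃ a, (fun w => (w.comap (φ a : F →+* L), n)) ''
    {w ∈ allPlaces K z j | ¬ Visible K (w.comap (φ a : F →+* L)) n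
      (Fin.cons 1 x₀ : Fin (n + 2) → F)}
  have hB : B.Finite := Set.finite_iUnion fun a =>
    (finite_allPlaces_not_visible hz j (φ a) hx₀.1).image _
  have hKw : ∀ a, ∀ w ∈ allPlaces K z j, ∀ c : K, c ≠ 0 →
      (w.comap (φ a : F →+* L)) (algebraMap K F c) = 1 := by
    intro a w hw c hc
    rw [Valuation.comap_apply, ← allPlaces_algebraMap hz j hw hc]
    exact congrArg w ((φ a).commutes c)
  have hgood : ∀ p ∈ insert ((1 : Valuation F ℤᵐ⁰), n + 1) 𝒱, p ∉ B →
      Visible K p.1 p.2 (Fin.cons 1 x₀ : Fin (n + 2) → F) := by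
    rintro p (rfl | ⟨a, w, hw, rfl⟩) hpB
    · refine visible_cons_one (fun i => ?_) id fun Q hQ => ?_
      · exact Valuation.one_apply_le_one _
      · rw [Function.comp_id, Valuation.one_apply_of_ne_zero]
        exact fun h => hQ (hx₀.1 (by rw [h, map_zero]))
    · by_contra hvis
      exact hpB (Set.mem_iUnion.mpr ⟨a, w, ⟨hw, hvis⟩, rfl⟩)
  have hbad : ∀ p ∈ B, ∃ (N : ℕ) (l : Fin N → F), Visible K p.1 p.2 l := by
    intro p hp
    obtain ⟨a, w, ⟨hw, -⟩, rfl⟩ := Set.mem_iUnion.mp hp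
    let := (φ a).toRingHom.toAlgebra
    have : IsScalarTower K F L := IsScalarTower.of_algebraMap_eq fun c => ((φ a).commutes c).symm
    obtain ⟨t, i, -, hi⟩ := allPlaces_exists_succAbove hz j hw
    have hb : ∀ k, w ((t ∘ i.succAbove) k) ≤ 1 := fun k => by
      have := hi (X k) (X_ne_zero k)
      rw [aeval_X] at this
      exact this.le
    obtain ⟨s, hs, hs'⟩ := w.exists_residually_independent (F := F)
      (fun c hc => allPlaces_algebraMap hz j hw hc) hm hF hb hi
    exact ⟨_, _, visible_cons_one (x := s) hs id hs'⟩
  have hK𝒮 : ∀ p ∈ insert ((1 : Valuation F ℤᵐ⁰), n + 1) 𝒱, ∀ c : K, c ≠ 0 →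
      p.1 (algebraMap K F c) = 1 := by
    rintro p (rfl | ⟨a, w, hw, rfl⟩)
    · intro c hc
      exact Valuation.one_apply_of_ne_zero ((map_ne_zero_iff _ (algebraMap K F).injective).mpr hc)
    · exact hKw a w hw
  obtain ⟨N, l, hl⟩ := exists_forall_visible (K := K) hB (l₀ := (Fin.cons 1 x₀ : Fin (n + 2) → F))
    ⟨0, one_ne_zero⟩ (fun p hp => hgood p hp.1 hp.2) hbad
  obtain ⟨x, hx, hvis⟩ := exists_isTranscendenceBasis_visible hK𝒮 hF (Set.mem_insert _ _) hl
  exact ⟨x, hx, fun a w hw => (hvis _ (Set.mem_insert_of_mem _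
    ⟨a, w, hw, rfl⟩)).exists_valuation_eq_pow (hKw a w hw)⟩

end Places

section Transfer

variable {R M F : Type*} [CommRing R] [CommRing M] [Field F] (α : R →+* F) (β : M →+* F)

theorem exists_transfer_prime {h : R} (hβ : ∀ b, ∃ (N : ℕ) (r : R), α h ^ N * β b = α r)
    {P : Ideal R} (hPp : P.IsPrime) (hα : Function.Injective α) (hP : h ∉ P) :
    ∃ 𝔓 : Ideal M, 𝔓.IsPrime ∧ ∀ (b : M) (N : ℕ) (r : R), α h ^ N * β b = α r →
      (b ∈ 𝔓 ↔ r ∈ P) := by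
  have key : ∀ {b : M} {N N' : ℕ} {r r' : R}, α h ^ N * β b = α r → α h ^ N' * β b = α r' →
      r ∈ P → r' ∈ P := by
    intro b N N' r r' h1 h2 hr
    have h3 : h ^ N * r' = h ^ N' * r := hα (by
      rw [map_mul, map_mul, map_pow, map_pow, ← h1, ← h2]; ring)
    refine (hPp.mem_or_mem (h3 ▸ P.mul_mem_left _ hr : h ^ N * r' ∈ P)).resolve_left
      fun h4 => hP (hPp.mem_of_pow_mem _ h4)
  let 𝔓 : Ideal M :=
    { carrier := {b | ∃ (N : ℕ) (r : R), r ∈ P ∧ α h ^ N * β b = α r}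
      zero_mem' := ⟨0, 0, P.zero_mem, by simp⟩
      add_mem' := by
        rintro b b' ⟨N, r, hr, h1⟩ ⟨N', r', hr', h1'⟩
        refine ⟨N + N', h ^ N' * r + h ^ N * r',
          P.add_mem (P.mul_mem_left _ hr) (P.mul_mem_left _ hr'), ?_⟩
        rw [map_add α, map_mul, map_mul, map_add, map_pow, map_pow, ← h1, ← h1']
        ring
      smul_mem' := by
        rintro a b ⟨N, r, hr, h1⟩
        obtain ⟨N', r', h1'⟩ := hβ a
        refine ⟨N' + N, r' * r, P.mul_mem_left _ hr, ?_⟩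
        rw [smul_eq_mul, map_mul, map_mul, ← h1, ← h1']
        ring }
  have hmem : ∀ (b : M) (N : ℕ) (r : R), α h ^ N * β b = α r → (b ∈ 𝔓 ↔ r ∈ P) := by
    intro b N r h1
    refine ⟨?_, fun hr => ⟨N, r, hr, h1⟩⟩
    rintro ⟨N', r', hr', h1'⟩
    exact key h1' h1 hr'
  refine ⟨𝔓, ⟨?_, ?_⟩, hmem⟩
  · rw [Ne, Ideal.eq_top_iff_one, hmem 1 0 1 (by simp)]
    exact fun h1 => hPp.ne_top ((Ideal.eq_top_iff_one _).mpr h1)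
  · intro a b hab
    obtain ⟨N, r, h1⟩ := hβ a
    obtain ⟨N', r', h1'⟩ := hβ b
    rw [hmem a N r h1, hmem b N' r' h1']
    rw [hmem (a * b) (N + N') (r * r') (by rw [map_mul, map_mul, ← h1, ← h1']; ring)] at hab
    exact hPp.mem_or_mem hab

theorem transfer_mem_iff {h : R} {P : Ideal R} (hPp : P.IsPrime)
    {𝔓 : Ideal M} (h𝔓 : ∀ (b : M) (N : ℕ) (r : R), α h ^ N * β b = α r → (b ∈ 𝔓 ↔ r ∈ P))
    {c : M} (hc : c ∉ 𝔓) (hβ : ∃ (N : ℕ) (r : R), α h ^ N * β c = α r) {b : M} {N : ℕ} {r : R}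
    (hb : β c ^ N * α r = β b) : b ∈ 𝔓 ↔ r ∈ P := by
  obtain ⟨k, s, hs⟩ := hβ
  rw [h𝔓 c k s hs] at hc
  rw [h𝔓 b (k * N) (s ^ N * r) (by rw [map_mul, map_pow, ← hs, ← hb]; ring)]
  exact ⟨fun h1 => (hPp.mem_or_mem h1).resolve_left fun h2 => hc (hPp.mem_of_pow_mem _ h2),
    fun h1 => P.mul_mem_left _ h1⟩

end Transfer

theorem exists_clearing_denominators {K R M F : Type*} [Field K] [CommRing R] [CommRing M]
    [Field F] [Algebra K R] [Algebra K M] [Algebra K F] [Algebra.FiniteType K M]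
    (α : R →ₐ[K] F) (β : M →ₐ[K] F)
    (hα : ∀ s : F, ∃ r r', α r' ≠ 0 ∧ α r' * s = α r) :
    ∃ h : R, α h ≠ 0 ∧ ∀ b, ∃ (N : ℕ) (r : R), α h ^ N * β b = α r := by
  classical
  obtain ⟨s, hs⟩ := (Algebra.FiniteType.out : (⊤ : Subalgebra K M).FG)
  choose f g hg hfg using hα
  refine ⟨∏ b ∈ s, g (β b), ?_, fun b => ?_⟩
  · rw [map_prod]
    exact Finset.prod_ne_zero_iff.mpr fun b _ => hg _
  have hb : b ∈ Algebra.adjoin K (s : Set M) := hs ▸ Algebra.mem_top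
  induction hb using Algebra.adjoin_induction with
  | mem b hb =>
    refine ⟨1, (∏ b' ∈ s.erase b, g (β b')) * f (β b), ?_⟩
    rw [map_mul, ← hfg, ← Finset.mul_prod_erase s (fun b => g (β b)) hb, map_mul]
    ring
  | algebraMap a => exact ⟨0, algebraMap K R a, by simp⟩
  | add a b _ _ ha hb =>
    obtain ⟨N, r, h1⟩ := ha
    obtain ⟨N', r', h1'⟩ := hb
    refine ⟨N + N', (∏ b ∈ s, g (β b)) ^ N' * r + (∏ b ∈ s, g (β b)) ^ N * r', ?_⟩
    rw [map_add α, map_mul α, map_mul α, map_add, map_pow, map_pow, ← h1, ← h1']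
    ring
  | mul a b _ _ ha hb =>
    obtain ⟨N, r, h1⟩ := ha
    obtain ⟨N', r', h1'⟩ := hb
    refine ⟨N + N', r * r', ?_⟩
    rw [map_mul, map_mul, ← h1, ← h1']
    ring

section Correspondence

variable (K : Type*) {A R F : Type*} [Field K] [CommRing A] [IsDomain A] [UniqueFactorizationMonoid A]
  [Algebra K A] [Algebra.FiniteType K A] [Field F] [Algebra A F] [FaithfulSMul A F] [Algebra K F]
  [IsScalarTower K A F] [CommRing R] [IsDomain R] [Algebra K R] [Algebra.FiniteType K R]
  [Algebra R F] [IsScalarTower K R F] [IsFractionRing R F]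

include K in
theorem exists_prime_correspondence_adjoin {y : F} (hy : IsIntegral A y)
    (hgen : ∀ s : F, ∃ b b' : Algebra.adjoin A {y}, (b' : F) ≠ 0 ∧ (b' : F) * s = b) :
    ∃ (h : R) (c : Algebra.adjoin A {y}), h ≠ 0 ∧
      (∀ b : Algebra.adjoin A {y}, ∃ (N : ℕ) (r : R),
        algebraMap R F h ^ N * (b : F) = algebraMap R F r) ∧
      (∀ r : R, ∃ (N : ℕ) (b : Algebra.adjoin A {y}), (c : F) ^ N * algebraMap R F r = b) ∧
      (∃ (N : ℕ) (r : R), algebraMap R F h ^ N * (c : F) = algebraMap R F r ∧ r ∣ h ^ (N + 1)) ∧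
      ∀ P : Ideal R, HeightOnePrime P → h ∉ P → ∃ 𝔓 : Ideal (Algebra.adjoin A {y}),
        𝔓.IsPrime ∧ (∃ q : A, Irreducible q ∧ ∀ a, algebraMap A _ a ∈ 𝔓 ↔ q ∣ a) ∧
        (∀ (b : Algebra.adjoin A {y}) (N : ℕ) (r : R),
          algebraMap R F h ^ N * (b : F) = algebraMap R F r → (b ∈ 𝔓 ↔ r ∈ P)) ∧
        (∀ (r : R) (N : ℕ) (b : Algebra.adjoin A {y}), (c : F) ^ N * algebraMap R F r = b →
          (b ∈ 𝔓 ↔ r ∈ P)) := by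
  have hfin : Algebra.FiniteType K (Algebra.adjoin A {y}) := by
    have : Algebra.FiniteType A (Algebra.adjoin A {y}) :=
      (Subalgebra.fg_iff_finiteType _).mp ⟨{y}, by simp⟩
    exact Algebra.FiniteType.trans (S := A) inferInstance inferInstance
  have hint : Algebra.IsIntegral A (Algebra.adjoin A {y}) :=
    Algebra.IsIntegral.adjoin fun x hx => by rw [Set.mem_singleton_iff.mp hx]; exact hy
  let α : R →ₐ[K] F := IsScalarTower.toAlgHom K R F
  let β : Algebra.adjoin A {y} →ₐ[K] F := (Algebra.adjoin A {y}).val.restrictScalars K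
  have hα : Function.Injective α := IsFractionRing.injective R F
  have hβ : Function.Injective β := Subtype.val_injective
  obtain ⟨h₀, hh₀, h1⟩ := exists_clearing_denominators α β fun s => by
    obtain ⟨r, r', hr', rfl⟩ := IsFractionRing.div_surjective (A := R) s
    have h0 := IsFractionRing.to_map_ne_zero_of_mem_nonZeroDivisors (K := F) hr'
    exact ⟨r, r', h0, mul_div_cancel₀ _ h0⟩
  obtain ⟨c, hc, h2⟩ := exists_clearing_denominators β α hgen
  obtain ⟨k, s, hs⟩ := h1 c
  have hs0 : s ≠ 0 := by
    rintro rfl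
    rw [map_zero] at hs
    exact (mul_ne_zero (pow_ne_zero _ hh₀) hc) hs
  have hh0 : h₀ ≠ 0 := fun h => hh₀ (by rw [h, map_zero])
  have h1' : ∀ b, ∃ (N : ℕ) (r : R), α (h₀ * s) ^ N * β b = α r := fun b => by
    obtain ⟨N, r, hN⟩ := h1 b
    exact ⟨N, s ^ N * r, by rw [map_mul, map_mul, map_pow, ← hN]; ring⟩
  have hcs : α (h₀ * s) ^ k * β c = α (s ^ (k + 1)) := by
    rw [map_mul, map_pow, pow_succ, ← hs]; ring
  have hsh : s ^ (k + 1) ∣ (h₀ * s) ^ (k + 1) := pow_dvd_pow_of_dvd (dvd_mul_left s h₀) _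
  refine ⟨h₀ * s, c, mul_ne_zero hh0 hs0, h1', h2, ⟨k, s ^ (k + 1), hcs, hsh⟩, ?_⟩
  intro P hP hhP
  have h_ne : α (h₀ * s) ≠ 0 := (map_ne_zero_iff _ hα).mpr (mul_ne_zero hh0 hs0)
  generalize h₀ * s = h at *
  have hsP : s ^ (k + 1) ∉ P := fun h3 => hhP (hP.1.mem_of_pow_mem _ (P.mem_of_dvd hsh h3))
  obtain ⟨𝔓, h𝔓, hT⟩ := exists_transfer_prime α.toRingHom β.toRingHom h1' hP.1 hα hhP
  have hc𝔓 : c ∉ 𝔓 := fun h3 => hsP ((hT c k _ hcs).mp h3)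
  have hT' : ∀ (r : R) (N : ℕ) (b : Algebra.adjoin A {y}), (c : F) ^ N * algebraMap R F r = b →
      (b ∈ 𝔓 ↔ r ∈ P) := fun r N b hb =>
    transfer_mem_iff α.toRingHom β.toRingHom hP.1 hT hc𝔓 (h1' c) hb
  refine ⟨𝔓, h𝔓, ?_, hT, hT'⟩
  have hne : 𝔓.comap (algebraMap A _) ≠ ⊥ := by
    obtain ⟨r, hr, hr0⟩ := Submodule.exists_mem_ne_zero_of_ne_bot hP.2.1
    obtain ⟨N, b, hb⟩ := h2 r
    refine Ideal.comap_ne_bot_of_integral_mem (x := b) ?_ ((hT' r N b hb).mpr hr)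
      (hint.isIntegral b)
    rintro rfl
    rw [map_zero] at hb
    exact mul_ne_zero (pow_ne_zero _ hc) ((map_ne_zero_iff _ hα).mpr hr0) hb
  have hpp : (𝔓.comap (algebraMap A _)).IsPrime := Ideal.comap_isPrime _ _
  obtain ⟨q, hq, hqp⟩ := hpp.exists_mem_prime_of_ne_bot hne
  refine ⟨q, hqp.irreducible, fun a => ⟨fun ha => ?_, fun ha =>
    Ideal.mem_of_dvd (𝔓.comap (algebraMap A _)) ha hq⟩⟩
  have hqI : (Ideal.span {q}).IsPrime := (Ideal.span_singleton_prime hqp.ne_zero).mpr hqp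
  have : 𝔓.LiesOver (𝔓.comap (algebraMap A _)) := ⟨rfl⟩
  obtain ⟨𝔮, h𝔮𝔓, h𝔮, h𝔮q⟩ := 𝔓.exists_ideal_le_liesOver_of_le (p := Ideal.span {q})
    (q := 𝔓.comap (algebraMap A _)) ((Ideal.span_singleton_le_iff_mem _).mpr hq)
  have hq𝔮 : ∀ a, algebraMap A _ a ∈ 𝔮 ↔ q ∣ a := fun a => by
    rw [← Ideal.mem_span_singleton, h𝔮q.over, Ideal.mem_comap]
  have hc𝔮 : c ∉ 𝔮 := fun h3 => hc𝔓 (h𝔮𝔓 h3)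
  obtain ⟨P', hP', hU⟩ := exists_transfer_prime β.toRingHom α.toRingHom h2 h𝔮 hβ hc𝔮
  have hle : P' ≤ P := fun r hr => by
    obtain ⟨N, b, hb⟩ := h2 r
    exact (hT' r N b hb).mp (h𝔮𝔓 ((hU r N b hb).mp hr))
  have hU' : ∀ (b : Algebra.adjoin A {y}) (N : ℕ) (r : R),
      algebraMap R F h ^ N * (b : F) = algebraMap R F r → (r ∈ P' ↔ b ∈ 𝔮) := fun b N r hr =>
    transfer_mem_iff β.toRingHom α.toRingHom h𝔮 hU (fun h3 => hhP (hle h3)) (h2 h) hr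
  have hP'ne : P' ≠ ⊥ := by
    obtain ⟨N, r, hr⟩ := h1' (algebraMap A _ q)
    have hr' := (hU' _ N r hr).mpr ((hq𝔮 q).mpr dvd_rfl)
    rintro rfl
    rw [Ideal.mem_bot] at hr'
    rw [hr', map_zero] at hr
    refine mul_ne_zero (pow_ne_zero _ h_ne) (fun h3 => hqp.ne_zero ?_) hr
    exact FaithfulSMul.algebraMap_injective A F (h3.trans (map_zero _).symm)
  have hPP : P' = P := by
    by_contra hne'
    exact hP'ne (hP.2.2 P' hP' (lt_of_le_of_ne hle hne'))
  obtain ⟨N, r, hr⟩ := h1' (algebraMap A _ a)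
  rw [← hq𝔮, ← hU' _ N r hr, hPP, ← hT _ N r hr]
  exact ha

end Correspondence

section Correspondence

variable (K : Type*) {A R F : Type*} [Field K] [CommRing A] [IsDomain A] [UniqueFactorizationMonoid A]
  [Algebra K A] [Algebra.FiniteType K A] [Field F] [Algebra A F] [FaithfulSMul A F] [Algebra K F]
  [IsScalarTower K A F] [CommRing R] [IsDomain R] [Algebra K R] [Algebra.FiniteType K R]
  [Algebra R F] [IsScalarTower K R F] [IsFractionRing R F]

/-- A valuation of `F` which is centred on `R`, outside of the zero locus of `h`. -/
def CentredOff (h : R) (v : Valuation F ℤᵐ⁰) : Prop :=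
  (∀ r : R, v (algebraMap R F r) ≤ 1) ∧ v (algebraMap R F h) = 1

include K in
theorem exists_prime_correspondence {y : F} (hy : IsIntegral A y)
    (hgen : ∀ s : F, ∃ b b' : Polynomial A, Polynomial.aeval y b' ≠ 0 ∧
      Polynomial.aeval y b' * s = Polynomial.aeval y b) :
    ∃ (h : R) (𝔓 : Ideal R → Ideal (Polynomial A)), h ≠ 0 ∧
      (∀ v : Valuation F ℤᵐ⁰, CentredOff h v → ∀ b : Polynomial A,
        v (Polynomial.aeval y b) ≤ 1) ∧
      (∀ r : R, ∃ b : Polynomial A,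
        (∀ v : Valuation F ℤᵐ⁰, CentredOff h v →
          (v (algebraMap R F r) < 1 ↔ v (Polynomial.aeval y b) < 1)) ∧
        ∀ P, HeightOnePrime P → h ∉ P → (b ∈ 𝔓 P ↔ r ∈ P)) ∧
      (∀ b : Polynomial A, ∃ r : R, (Polynomial.aeval y b ≠ 0 → r ≠ 0) ∧
        (∀ v : Valuation F ℤᵐ⁰, CentredOff h v →
          (v (algebraMap R F r) < 1 ↔ v (Polynomial.aeval y b) < 1)) ∧
        ∀ P, HeightOnePrime P → h ∉ P → (b ∈ 𝔓 P ↔ r ∈ P)) ∧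
      ∀ P, HeightOnePrime P → h ∉ P → (𝔓 P).IsPrime ∧
        (∃ q : A, Irreducible q ∧ ∀ a, Polynomial.C a ∈ 𝔓 P ↔ q ∣ a) ∧
        ∀ b : Polynomial A, Polynomial.aeval y b = 0 → b ∈ 𝔓 P := by
  classical
  obtain ⟨e, he⟩ : ∃ e : Polynomial A →ₐ[A] Algebra.adjoin A {y},
      ∀ b, (e b : F) = Polynomial.aeval y b := by
    refine ⟨(Polynomial.aeval y).codRestrict _ fun b => ?_, fun b => rfl⟩
    exact Polynomial.aeval_mem_adjoin_singleton _ _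
  have he' : ∀ b : Algebra.adjoin A {y}, ∃ b', e b' = b := fun b => by
    have h1 : (b : F) ∈ (Polynomial.aeval (R := A) y).range := by
      rw [← Algebra.adjoin_singleton_eq_range_aeval]; exact b.2
    obtain ⟨b', hb'⟩ := h1
    exact ⟨b', Subtype.ext ((he b').trans hb')⟩
  obtain ⟨h, c, hh, h1, h2, ⟨N₀, r₀, hr₀, hd⟩, h3⟩ :=
    exists_prime_correspondence_adjoin K (R := R) hy fun s => by
      obtain ⟨b, b', hb', hs⟩ := hgen s
      exact ⟨e b, e b', by rwa [he], by rw [he, he]; exact hs⟩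
  choose! 𝔓 h4 h5 h6 h7 using h3
  have hvc : ∀ v : Valuation F ℤᵐ⁰, CentredOff h v → v c = 1 := by
    rintro v ⟨hv, hvh⟩
    obtain ⟨r₁, hr₁⟩ := hd
    have h8 := congrArg v (congrArg (algebraMap R F) hr₁)
    rw [map_pow, map_mul, map_pow, map_mul, hvh, one_pow] at h8
    have h9 : v (algebraMap R F r₀) = 1 := by
      refine le_antisymm (hv _) (h8.trans_le ?_)
      exact mul_le_of_le_one_right' (hv _)
    rw [← hr₀, map_mul, map_pow, hvh, one_pow, one_mul] at h9
    exact h9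
  refine ⟨h, fun P => (𝔓 P).comap e, hh, ?_, fun r => ?_, fun b => ?_, fun P hP hhP =>
    ⟨?_, ?_, fun b hb => ?_⟩⟩
  · rintro v ⟨hv, hvh⟩ b
    obtain ⟨N, r, hr⟩ := h1 (e b)
    rw [he] at hr
    have := hv r
    rwa [← hr, map_mul, map_pow, hvh, one_pow, one_mul] at this
  · obtain ⟨N, b, hb⟩ := h2 r
    obtain ⟨b, rfl⟩ := he' b
    refine ⟨b, fun v hv => ?_, fun P hP hhP => h7 P hP hhP r N _ hb⟩
    rw [he] at hb
    rw [← hb, map_mul, map_pow, hvc v hv, one_pow, one_mul]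
  · obtain ⟨N, r, hr⟩ := h1 (e b)
    refine ⟨r, ?_, fun v hv => ?_, fun P hP hhP => h6 P hP hhP _ N r hr⟩
    · rintro hb rfl
      rw [map_zero, he] at hr
      exact mul_ne_zero (pow_ne_zero _ ((map_ne_zero_iff _ (IsFractionRing.injective R F)).mpr hh))
        hb hr
    · rw [← hr, map_mul, map_pow, hv.2, one_pow, one_mul, he]
  · have := h4 P hP hhP
    exact Ideal.comap_isPrime _ _
  · obtain ⟨q, hq, hq'⟩ := h5 P hP hhP
    refine ⟨q, hq, fun a => ?_⟩
    rw [← hq', Ideal.mem_comap]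
    rw [← Polynomial.algebraMap_eq, AlgHom.commutes]
  · have : e b = 0 := Subtype.ext (by rw [he]; exact hb)
    rw [Ideal.mem_comap, this]
    exact zero_mem _

end Correspondence

theorem HeightOnePrime.finite_mem {R : Type*} [CommRing R] [IsDomain R] [IsNoetherianRing R]
    {r : R} (hr : r ≠ 0) : {P : Ideal R | HeightOnePrime P ∧ r ∈ P}.Finite := by
  refine (Ideal.finite_minimalPrimes_of_isNoetherianRing R (Ideal.span {r})).subset ?_
  rintro P ⟨hP, hrP⟩
  refine ⟨⟨hP.1, (Ideal.span_singleton_le_iff_mem _).mpr hrP⟩, fun Q hQ hQP => ?_⟩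
  by_contra hne
  have h0 := hP.2.2 Q hQ.1 (lt_of_le_not_ge hQP hne)
  subst h0
  exact hr (by simpa using hQ.2)

section Hypersurface

variable {R S : Type*} [CommRing R] [CommRing S]

theorem IsHypersurfaceIdeal.ne_bot [IsDomain R] {I : Ideal R} (hI : IsHypersurfaceIdeal I) :
    I ≠ ⊥ := by
  rintro rfl
  exact (hI.2.2 ⊥ ⟨⟨Ideal.isPrime_bot, bot_le⟩, fun _ _ _ => bot_le⟩).2.1 rfl

theorem IsHypersurfaceIdeal.sInf_minimalPrimes {I : Ideal R} (hI : IsHypersurfaceIdeal I) :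
    sInf I.minimalPrimes = I := by
  rw [Ideal.sInf_minimalPrimes, hI.1.radical]

theorem comap_mem_minimalPrimes_of_properTransform_eq [IsDomain R] [IsDomain S] [IsNoetherianRing S]
    {f₁ f₂ : R →+* S} (hf₁ : Function.Injective f₁) (hf₂ : Function.Injective f₂) {I : Ideal R}
    (hI : I ≠ ⊥) (h : properTransform f₁ I = properTransform f₂ I) {Q : Ideal S} (hQp : Q.IsPrime)
    (hQ : ∀ Q' : Ideal S, Q'.IsPrime → Q' ≠ ⊥ → Q' ≤ Q → Q' = Q)
    (h1 : Q.comap f₁ ∈ I.minimalPrimes) : Q.comap f₂ ∈ I.minimalPrimes := by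
  have hmap : ∀ {f : R →+* S}, Function.Injective f → ∀ Q' : Ideal S, I.map f ≤ Q' → Q' ≠ ⊥ := by
    rintro f hf Q' hle rfl
    obtain ⟨r, hr, hr0⟩ := Submodule.exists_mem_ne_zero_of_ne_bot hI
    have h2 := hle (Ideal.mem_map_of_mem f hr)
    rw [Ideal.mem_bot] at h2
    exact hr0 (hf (h2.trans (map_zero f).symm))
  have h3 : properTransform f₁ I ≤ Q := by
    refine sInf_le ⟨⟨⟨hQp, Ideal.map_le_iff_le_comap.mpr h1.1.2⟩, fun Q' hQ' hle => ?_⟩, h1⟩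
    exact (hQ Q' hQ'.1 (hmap hf₁ Q' hQ'.2) hle).ge
  rw [h, properTransform] at h3
  have hfin : {Q : Ideal S | Q ∈ (I.map f₂).minimalPrimes ∧ Q.comap f₂ ∈ I.minimalPrimes}.Finite :=
    (Ideal.finite_minimalPrimes_of_isNoetherianRing S (I.map f₂)).subset fun Q hQ => hQ.1
  rw [← hfin.coe_toFinset, ← Finset.inf_id_eq_sInf, hQp.inf_le'] at h3
  obtain ⟨Q', hQ', hle⟩ := h3
  rw [Set.Finite.mem_toFinset] at hQ'
  rw [← hQ Q' hQ'.1.1.1 (hmap hf₂ Q' hQ'.1.1.2) hle]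
  exact hQ'.2

end Hypersurface

section Centre

variable {R L : Type*} [CommRing R] [Field L]

/-- The centre of a valuation which is at most one on the image of a ring. -/
def Valuation.centre (w : Valuation L ℤᵐ⁰) (f : R →+* L) (hw : ∀ r, w (f r) ≤ 1) : Ideal R where
  carrier := {r | w (f r) < 1}
  zero_mem' := by simp
  add_mem' ha hb := by
    rw [Set.mem_ofPred_eq, map_add]
    exact w.map_add_lt ha hb
  smul_mem' a b hb := by
    rw [Set.mem_ofPred_eq, smul_eq_mul, map_mul, map_mul]
    exact (mul_le_of_le_one_left' (hw a)).trans_lt hb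

theorem Valuation.mem_centre {w : Valuation L ℤᵐ⁰} {f : R →+* L} {hw : ∀ r, w (f r) ≤ 1} {r : R} :
    r ∈ w.centre f hw ↔ w (f r) < 1 := Iff.rfl

theorem Valuation.centre_isPrime (w : Valuation L ℤᵐ⁰) (f : R →+* L) (hw : ∀ r, w (f r) ≤ 1) :
    (w.centre f hw).IsPrime := by
  refine ⟨?_, fun {a b} hab => ?_⟩
  · rw [Ne, Ideal.eq_top_iff_one, w.mem_centre, map_one, map_one]
    exact lt_irrefl _
  · by_contra! h
    rw [w.mem_centre, w.mem_centre, not_lt, not_lt] at h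
    rw [w.mem_centre, map_mul, map_mul, le_antisymm (hw a) h.1, le_antisymm (hw b) h.2,
      one_mul] at hab
    exact lt_irrefl _ hab

end Centre

theorem eq_centre_of_mem_finitePlaces {K S L : Type*} [Field K] [CharZero K] [CommRing S]
    [IsDomain S] [Algebra K S] [Field L] [Algebra K L] [Algebra.EssFiniteType K L] [Algebra S L]
    [IsScalarTower K S L] {m : ℕ} {g : MvPolynomial (Fin m) K →ₐ[K] S}
    (hg : (g : MvPolynomial (Fin m) K →+* S).IsIntegral)
    (hz : IsTranscendenceBasis K fun i => algebraMap S L (g (X i))) {w : Valuation L ℤᵐ⁰}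
    (hw : w ∈ finitePlaces K fun i => algebraMap S L (g (X i)))
    (hwS : ∀ s, w (algebraMap S L s) ≤ 1) {Q : Ideal S} (hQ : Q.IsPrime) (hQ0 : Q ≠ ⊥)
    (hle : Q ≤ w.centre (algebraMap S L) hwS) : Q = w.centre (algebraMap S L) hwS := by
  obtain ⟨p, hp, hwp⟩ := exists_irreducible_of_mem_finitePlaces _ hw
  have hlt : ∀ a, w (algebraMap S L (g a)) < 1 ↔ p ∣ a := fun a => by
    rw [← (isPlacesOver_placesOver hz hp).aeval_lt_one_iff w hwp a]
    have : (aeval fun i => algebraMap S L (g (X i))) a = algebraMap S L (g a) := by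
      exact (comp_aeval_apply X ((IsScalarTower.toAlgHom K S L).comp g) a).symm.trans (by simp)
    rw [this]
  let := (g : MvPolynomial (Fin m) K →+* S).toAlgebra
  have hpQ : g p ∈ Q := by
    obtain ⟨s, hs, hs0⟩ := Submodule.exists_mem_ne_zero_of_ne_bot hQ0
    have hne := Ideal.comap_ne_bot_of_integral_mem hs0 hs (hg s)
    have hpr : (Q.comap (algebraMap (MvPolynomial (Fin m) K) S)).IsPrime := Ideal.comap_isPrime _ _
    obtain ⟨q, hq, hqp⟩ := hpr.exists_mem_prime_of_ne_bot hne
    have hpq := (hlt q).mp (hle hq)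
    exact Ideal.mem_of_dvd (Q.comap (algebraMap (MvPolynomial (Fin m) K) S))
      (hp.associated_of_dvd hqp.irreducible hpq).symm.dvd hq
  by_contra hne
  obtain ⟨s, hs, hsQ⟩ := SetLike.exists_of_lt (lt_of_le_of_ne hle hne)
  have h1 := Ideal.comap_lt_comap_of_integral_mem_sdiff hle ⟨hs, hsQ⟩ (hg s)
  refine h1.not_ge fun a ha => ?_
  exact Ideal.mem_of_dvd (Q.comap (algebraMap (MvPolynomial (Fin m) K) S)) ((hlt a).mp ha) hpQ

theorem MvPolynomial.exists_not_dvd_pderiv {σ K : Type*} [Field K] [CharZero K]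
    {q : MvPolynomial σ K} (hq : Irreducible q) : ∃ i, ¬ q ∣ pderiv i q := by
  classical
  have hd : q.totalDegree ≠ 0 := fun h => by
    rw [totalDegree_eq_zero_iff_eq_C] at h
    refine hq.not_isUnit (h ▸ IsUnit.map C (isUnit_iff_ne_zero.mpr fun h0 => hq.ne_zero ?_))
    rw [h, h0, C_0]
  obtain ⟨s, hs, hsd⟩ := Finset.exists_mem_eq_sup q.support
    (Finset.nonempty_iff_ne_empty.mpr (support_eq_empty.not.mpr hq.ne_zero))
    fun s => s.sum fun _ e => e
  have hs0 : s ≠ 0 := by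
    rintro rfl
    exact hd (hsd.trans Finsupp.sum_zero_index)
  obtain ⟨i, hi⟩ := Finsupp.ne_iff.mp hs0
  refine ⟨i, fun hdvd => ?_⟩
  have hsi : s - Finsupp.single i 1 + Finsupp.single i 1 = s := by
    refine tsub_add_cancel_of_le ?_
    rw [Finsupp.single_le_iff]
    exact Nat.one_le_iff_ne_zero.mpr hi
  have hne : pderiv i q ≠ 0 := fun h => by
    have h1 := coeff_pderiv (i := i) q (s - Finsupp.single i 1)
    rw [h, hsi, coeff_zero] at h1
    exact mul_ne_zero (mem_support_iff.mp hs) (Nat.cast_add_one_ne_zero _) h1.symm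
  obtain ⟨r, hr⟩ := hdvd
  have hr0 : r ≠ 0 := by rintro rfl; exact hne (by rw [hr, mul_zero])
  have h2 : (pderiv i q).totalDegree < q.totalDegree := by
    rw [totalDegree, Finset.sup_lt_iff (by rw [bot_eq_zero]; omega)]
    intro m hm
    rw [mem_support_iff, coeff_pderiv] at hm
    have h3 := le_totalDegree (mem_support_iff.mpr (left_ne_zero_of_mul hm))
    rw [Finsupp.sum_add_index' (fun _ => rfl) (fun _ _ _ => rfl), Finsupp.sum_single_index rfl] at h3
    omega
  rw [hr, totalDegree_mul_of_isDomain hq.ne_zero hr0] at h2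
  omega

section Values

variable {K F : Type*} [Field K] [Field F] [Algebra K F] {ι : Type*} {x : ι → F}
  {v : Valuation F ℤᵐ⁰}

theorem lt_one_iff_dvd_of_prime_values (hv1 : ∀ Q : MvPolynomial ι K, v (aeval x Q) ≤ 1)
    {g : MvPolynomial ι K}
    (hv : ∀ Q : MvPolynomial ι K, Irreducible Q → ¬ Associated g Q → 1 ≤ v (aeval x Q))
    {q : MvPolynomial ι K} (hq : Irreducible q) (hvq : v (aeval x q) < 1)
    (Q : MvPolynomial ι K) : v (aeval x Q) < 1 ↔ q ∣ Q := by
  constructor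
  · intro hQ
    induction Q using UniqueFactorizationMonoid.induction_on_prime with
    | h₁ => exact dvd_zero q
    | h₂ u hu =>
      obtain ⟨u', hu'⟩ := hu.exists_right_inv
      have h1 : v (aeval x u) * v (aeval x u') = 1 := by
        rw [← map_mul, ← map_mul, hu', map_one, map_one]
      have h2 := (mul_le_of_le_one_right' (hv1 u')).trans_lt hQ
      exact absurd h1 h2.ne
    | h₃ a p ha hp ih =>
      rw [map_mul, map_mul] at hQ
      by_cases h1 : v (aeval x p) < 1
      · have h2 : ∀ r, Irreducible r → v (aeval x r) < 1 → Associated g r := fun r hr h3 => by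
          by_contra h4
          exact (hv r hr h4).not_gt h3
        exact (((h2 q hq hvq).symm.trans (h2 p hp.irreducible h1)).dvd).mul_right a
      · refine (ih ?_).mul_left p
        rwa [le_antisymm (hv1 p) (not_lt.mp h1), one_mul] at hQ
  · rintro ⟨r, rfl⟩
    rw [map_mul, map_mul]
    exact (mul_le_of_le_one_right' (hv1 r)).trans_lt hvq

end Values

section Derivations

variable {K L : Type*} [Field K] [Field L] [Algebra K L] {w : Valuation L ℤᵐ⁰}
  {D : Derivation K L L} (hD : ∀ u, w u ≤ 1 → w (D u) ≤ 1)
include hD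

theorem Derivation.valuation_lt_one {π : L} (hπ : w π = WithZero.exp (-1 : ℤ)) {s : L}
    (hs : w s ≤ WithZero.exp (-2 : ℤ)) : w (D s) < 1 := by
  have hπ0 : π ≠ 0 := by
    rintro rfl
    rw [map_zero] at hπ
    exact WithZero.exp_ne_zero hπ.symm
  have hπ1 : w π < 1 := by
    rw [hπ, ← WithZero.exp_zero, WithZero.exp_lt_exp]; norm_num
  obtain ⟨t, rfl⟩ : ∃ t, s = π * (π * t) := ⟨s / π / π, by field_simp⟩
  have ht : w t ≤ 1 := by
    rw [map_mul, map_mul, ← mul_assoc, hπ, ← WithZero.exp_add] at hs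
    norm_num only at hs
    rw [show (WithZero.exp (-2 : ℤ)) = WithZero.exp (-2 : ℤ) * 1 from (mul_one _).symm,
      mul_assoc, one_mul] at hs
    exact (mul_le_mul_iff_right₀ WithZero.exp_pos).mp hs
  rw [D.leibniz, smul_eq_mul, smul_eq_mul]
  refine w.map_add_lt ?_ ?_
  · rw [map_mul]
    refine (mul_le_of_le_one_right' (hD _ ?_)).trans_lt hπ1
    rw [map_mul]
    exact mul_le_one' hπ1.le ht
  · rw [map_mul]
    refine (mul_le_of_le_one_right' (hD _ hπ1.le)).trans_lt ?_
    rw [map_mul]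
    exact (mul_le_of_le_one_right' ht).trans_lt hπ1

theorem Derivation.valuation_logDeriv_sub_le_one {s t : L} (hs : s ≠ 0) (hst : w s = w t) :
    w (D s / s - D t / t) ≤ 1 := by
  have ht : t ≠ 0 := fun h => by
    rw [h, map_zero, map_eq_zero] at hst
    exact hs hst
  have h1 : w (s / t) = 1 := by
    rw [map_div₀, hst, div_self ((map_ne_zero w).mpr ht)]
  have h2 : D s / s - D t / t = D (s / t) / (s / t) := by
    have h3 : D s = D (s / t * t) := by rw [div_mul_cancel₀ _ ht]
    rw [h3, D.leibniz, smul_eq_mul, smul_eq_mul]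
    field_simp
    ring
  rw [h2, map_div₀, h1, div_one]
  exact hD _ h1.le

end Derivations

theorem WithZero.le_exp_neg_two_of_lt_one {a : ℤᵐ⁰} (h1 : a < 1) (h2 : a ≠ WithZero.exp (-1 : ℤ)) :
    a ≤ WithZero.exp (-2 : ℤ) := by
  by_cases h0 : a = 0
  · rw [h0]; exact zero_le
  rw [← WithZero.exp_log h0] at h1 h2 ⊢
  rw [← WithZero.exp_zero, WithZero.exp_lt_exp] at h1
  rw [WithZero.exp_le_exp]
  have : WithZero.log a ≠ -1 := fun h => h2 (by rw [h])
  omega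

theorem valuation_eq_exp_neg_one {K F L ι : Type*} [Field K] [CharZero K] [Field F] [Algebra K F]
    [Fintype ι] [DecidableEq ι] [Field L] [Algebra K L] {w : Valuation L ℤᵐ⁰} {x : ι → F} {φ : F →ₐ[K] L}
    {E : ι → Derivation K L L} (hE : ∀ i u, w u ≤ 1 → w (E i u) ≤ 1)
    (hEx : ∀ i j, E i (φ (x j)) = if j = i then 1 else 0) {π : L}
    (hπ : w π = WithZero.exp (-1 : ℤ)) {q : MvPolynomial ι K} (hq : Irreducible q)
    (hlt : ∀ Q : MvPolynomial ι K, w (φ (aeval x Q)) < 1 ↔ q ∣ Q) :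
    w (φ (aeval x q)) = WithZero.exp (-1 : ℤ) := by
  obtain ⟨i, hi⟩ := exists_not_dvd_pderiv hq
  by_contra hne
  have h1 : w (φ (aeval x q)) ≤ WithZero.exp (-2 : ℤ) :=
    WithZero.le_exp_neg_two_of_lt_one ((hlt q).mpr dvd_rfl) hne
  refine hi ((hlt _).mp ?_)
  have h2 := (E i).valuation_lt_one (hE i) hπ h1
  have h3 : E i (φ (aeval x q)) = φ (aeval x (pderiv i q)) := by
    rw [show φ (aeval x q) = _ from (comp_aeval_apply x φ q), (E i).map_mvPolynomial_aeval, Finset.sum_eq_single i]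
    · rw [hEx, if_pos rfl, mul_one]
      exact (comp_aeval_apply x φ _).symm
    · intro j _ hj; rw [hEx, if_neg hj, mul_zero]
    · simp
  rwa [h3] at h2

section PrimeKernel

variable {K : Type*} [Field K] {n : ℕ}

/-- `N` is a system of numerators, of controlled degree, of logarithmic differentials with a
pole along the prime `P` over `q` only. -/
structure IsPrimeKernel (G : Polynomial (MvPolynomial (Fin (n + 1)) K)) (c : ℕ)
    (P : Ideal (Polynomial (MvPolynomial (Fin (n + 1)) K))) (q : MvPolynomial (Fin (n + 1)) K)
    (N : Fin (n + 1) → Polynomial (MvPolynomial (Fin (n + 1)) K)) : Prop where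
  isPrime : P.IsPrime
  irreducible : Irreducible q
  C_mem_iff : ∀ a, Polynomial.C a ∈ P ↔ q ∣ a
  natDegree_le : ∀ i, (N i).natDegree ≤ G.natDegree
  totalDegree_le : ∀ i k, ((N i).coeff k).totalDegree ≤
    (q.totalDegree - 1) + c * (G.natDegree + 1)
  sub_mem : ∀ i, N i - Polynomial.C (pderiv i q) * Polynomial.derivative G ∈ P
  mem_of_ne : ∀ i, ∀ P' : Ideal (Polynomial (MvPolynomial (Fin (n + 1)) K)), P'.IsPrime →
    (∀ a, Polynomial.C a ∈ P' ↔ q ∣ a) → G ∈ P' → P' ≠ P → N i ∈ P'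

theorem exists_isPrimeKernel [CharZero K] {G : Polynomial (MvPolynomial (Fin (n + 1)) K)}
    (hG : G.Monic) {c : ℕ} (hGdeg : ∀ i, (G.coeff i).totalDegree ≤ c)
    {P : Ideal (Polynomial (MvPolynomial (Fin (n + 1)) K))} (hPp : P.IsPrime)
    {q : MvPolynomial (Fin (n + 1)) K} (hq : Irreducible q)
    (hP : ∀ a, Polynomial.C a ∈ P ↔ q ∣ a) (hGP : G ∈ P) :
    ∃ N, IsPrimeKernel G c P q N := by
  obtain ⟨N, hN⟩ := exists_prime_kernel hG hGdeg hP hGP hq.ne_zero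
  exact ⟨N, hPp, hq, hP, fun i => (hN i).1, fun i => (hN i).2.1, fun i => (hN i).2.2.1,
    fun i => (hN i).2.2.2⟩

variable {F : Type*} [Field F] [Algebra K F] (x : Fin (n + 1) → F) (y : F)

/-- Evaluation of a polynomial over `K[X₀, …, Xₙ]` at `(x, y)`. -/
noncomputable def evalPair : Polynomial (MvPolynomial (Fin (n + 1)) K) →+* F :=
  Polynomial.eval₂RingHom (aeval x : MvPolynomial (Fin (n + 1)) K →ₐ[K] F).toRingHom y

@[simp]
theorem evalPair_C (a : MvPolynomial (Fin (n + 1)) K) : evalPair x y (Polynomial.C a) = aeval x a :=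
  Polynomial.eval₂_C _ _

/-- The coefficients `N / (q ∂G)` at `(x, y)`. -/
noncomputable def kernelForm (G : Polynomial (MvPolynomial (Fin (n + 1)) K))
    (q : MvPolynomial (Fin (n + 1)) K)
    (N : Fin (n + 1) → Polynomial (MvPolynomial (Fin (n + 1)) K)) (i : Fin (n + 1)) : F :=
  evalPair x y (N i) / (aeval x q * evalPair x y (Polynomial.derivative G))

variable {x y} {G : Polynomial (MvPolynomial (Fin (n + 1)) K)} {c : ℕ}

theorem IsPrimeKernel.valuation_le {P : Ideal (Polynomial (MvPolynomial (Fin (n + 1)) K))}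
    {q : MvPolynomial (Fin (n + 1)) K}
    {N : Fin (n + 1) → Polynomial (MvPolynomial (Fin (n + 1)) K)} (h : IsPrimeKernel G c P q N)
    {u : Valuation F ℤᵐ⁰} (hK : ∀ a : K, u (algebraMap K F a) ≤ 1) {ρ : ℤᵐ⁰} (hρ : 1 ≤ ρ)
    (hx : ∀ i, u (x i) ≤ ρ) (hq : u (aeval x q) = ρ ^ q.totalDegree) (i : Fin (n + 1)) :
    u (kernelForm x y G q N i) ≤
      ρ ^ (c * (G.natDegree + 1)) * (max 1 (u y)) ^ G.natDegree /
        u (evalPair x y (Polynomial.derivative G)) := by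
  have hρ0 : (0 : ℤᵐ⁰) < ρ := zero_lt_one.trans_le hρ
  have hnum : u (evalPair x y (N i)) ≤
      ρ ^ q.totalDegree * (ρ ^ (c * (G.natDegree + 1)) * (max 1 (u y)) ^ G.natDegree) := by
    rw [evalPair, Polynomial.coe_eval₂RingHom, Polynomial.eval₂_eq_sum_range]
    refine u.map_sum_le fun k hk => ?_
    rw [map_mul, map_pow, ← mul_assoc, ← pow_add]
    refine mul_le_mul' ?_ ?_
    · refine (Valuation.aeval_le_pow_totalDegree u hK hρ hx _).trans ?_
      refine pow_le_pow_right₀ hρ ((h.totalDegree_le i k).trans ?_)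
      omega
    · refine (pow_le_pow_left₀ zero_le (le_max_right 1 (u y)) k).trans ?_
      refine pow_le_pow_right₀ (le_max_left _ _) ?_
      have := h.natDegree_le i
      have := Finset.mem_range.mp hk
      omega
  rw [kernelForm, map_div₀, map_mul, hq, ← div_div]
  refine div_le_div_of_nonneg_right ?_ zero_le
  rw [div_le_iff₀ (pow_pos hρ0 _), mul_comm]
  exact hnum

section Good

variable {P : Ideal (Polynomial (MvPolynomial (Fin (n + 1)) K))} {q : MvPolynomial (Fin (n + 1)) K}
    {N : Fin (n + 1) → Polynomial (MvPolynomial (Fin (n + 1)) K)} (h : IsPrimeKernel G c P q N)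
    {u : Valuation F ℤᵐ⁰}
    (hu : ∀ b : Polynomial (MvPolynomial (Fin (n + 1)) K), u (evalPair x y b) ≤ 1)
    (hG' : u (evalPair x y (Polynomial.derivative G)) = 1)
    (hmult : ∀ q : MvPolynomial (Fin (n + 1)) K, Irreducible q →
      (∀ Q : MvPolynomial (Fin (n + 1)) K, u (aeval x Q) < 1 ↔ q ∣ Q) →
      u (aeval x q) = WithZero.exp (-1 : ℤ))
include h hG' hmult

theorem IsPrimeKernel.valuation_le_one (hGy : evalPair x y G = 0) {g : MvPolynomial (Fin (n + 1)) K}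
    (hv : ∀ Q : MvPolynomial (Fin (n + 1)) K, Irreducible Q → ¬ Associated g Q →
      1 ≤ u (aeval x Q))
    (hne : u.centre (evalPair x y) hu ≠ P) (i : Fin (n + 1)) :
    u (kernelForm x y G q N i) ≤ 1 := by
  rw [kernelForm, map_div₀, map_mul, hG', mul_one]
  by_cases hq : u (aeval x q) < 1
  · have h1 := lt_one_iff_dvd_of_prime_values (x := x) (v := u)
      (fun Q => by rw [← evalPair_C x y]; exact hu _) hv h.irreducible hq
    have h2 := hmult q h.irreducible h1
    have h3 := h.mem_of_ne i _ (Valuation.centre_isPrime u (evalPair x y) hu)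
      (fun a => by rw [Valuation.mem_centre, evalPair_C, h1])
      (by rw [Valuation.mem_centre, hGy, map_zero]; exact zero_lt_one) hne
    rw [Valuation.mem_centre] at h3
    rw [h2]
    refine div_le_one_of_le₀ ?_ zero_le
    by_contra h4
    refine absurd (WithZero.le_exp_neg_two_of_lt_one h3 fun h5 => h4 h5.le) fun h5 => h4 ?_
    refine h5.trans ?_
    rw [WithZero.exp_le_exp]; norm_num
  · exact div_le_one_of_le₀ ((hu _).trans (not_lt.mp hq)) zero_le

theorem IsPrimeKernel.valuation_sub_le_one (hc : u.centre (evalPair x y) hu = P)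
    (i : Fin (n + 1)) :
    u (kernelForm x y G q N i - aeval x (pderiv i q) / aeval x q) ≤ 1 := by
  have h1 : ∀ Q : MvPolynomial (Fin (n + 1)) K, u (aeval x Q) < 1 ↔ q ∣ Q := fun Q => by
    rw [← h.C_mem_iff, ← hc, Valuation.mem_centre, evalPair_C]
  have h2 := hmult q h.irreducible h1
  have hq0 : aeval x q ≠ 0 := fun h0 => by
    rw [h0, map_zero] at h2
    exact WithZero.exp_ne_zero h2.symm
  have hG0 : evalPair x y (Polynomial.derivative G) ≠ 0 := fun h0 => by
    rw [h0, map_zero] at hG'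
    exact zero_ne_one hG'
  have h3 : kernelForm x y G q N i - aeval x (pderiv i q) / aeval x q =
      evalPair x y (N i - Polynomial.C (pderiv i q) * Polynomial.derivative G) /
        (aeval x q * evalPair x y (Polynomial.derivative G)) := by
    rw [kernelForm, map_sub, map_mul, evalPair_C]
    field_simp
  have h4 := h.sub_mem i
  rw [← hc, Valuation.mem_centre] at h4
  rw [h3, map_div₀, map_mul, hG', mul_one, h2]
  refine div_le_one_of_le₀ ?_ zero_le
  by_contra h5
  refine absurd (WithZero.le_exp_neg_two_of_lt_one h4 fun h6 => h5 h6.le) fun h6 => h5 ?_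
  refine h6.trans ?_
  rw [WithZero.exp_le_exp]; norm_num

end Good

theorem linearIndependent_kernelForm [CharZero K] {κ : Type*}
    {P : κ → Ideal (Polynomial (MvPolynomial (Fin (n + 1)) K))}
    {q : κ → MvPolynomial (Fin (n + 1)) K}
    {N : κ → Fin (n + 1) → Polynomial (MvPolynomial (Fin (n + 1)) K)}
    (h : ∀ k, IsPrimeKernel G c (P k) (q k) (N k)) (hP : Function.Injective P)
    (hx : AlgebraicIndependent K x) (hker : ∀ k b, evalPair x y b = 0 → b ∈ P k)
    (hG' : ∀ k, Polynomial.derivative G ∉ P k) (hG : evalPair x y G = 0) :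
    LinearIndependent K fun k => kernelForm x y G (q k) (N k) := by
  classical
  rw [linearIndependent_iff']
  intro s l hl k₀ hk₀
  by_contra hl0
  obtain ⟨i, hi⟩ := exists_not_dvd_pderiv (h k₀).irreducible
  have hprime := (h k₀).irreducible.prime
  set Θ := ∏ k ∈ s.filter fun k => ¬ Associated (q k) (q k₀), q k with hΘ
  have hΘq : ¬ q k₀ ∣ Θ := fun hd => by
    obtain ⟨k, hk, hkd⟩ := hprime.exists_mem_finset_dvd hd
    exact (Finset.mem_filter.mp hk).2
      ((h k₀).irreducible.associated_of_dvd (h k).irreducible hkd).symm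
  have hdvd : ∀ k ∈ s, q k ∣ q k₀ * Θ := fun k hk => by
    by_cases ha : Associated (q k) (q k₀)
    · exact ha.dvd.mul_right _
    · exact (Finset.dvd_prod_of_mem q (Finset.mem_filter.mpr ⟨hk, ha⟩)).mul_left _
  choose! e he using hdvd
  have hx0 : ∀ a : MvPolynomial (Fin (n + 1)) K, a ≠ 0 → aeval x a ≠ 0 := fun a ha h0 =>
    ha (hx (by rw [h0, map_zero]))
  have hG0 : evalPair x y (Polynomial.derivative G) ≠ 0 := fun h0 => hG' k₀ (hker k₀ _ h0)
  have hsum : ∑ k ∈ s, Polynomial.C (C (l k)) * Polynomial.C (e k) * N k i ∈ P k₀ := by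
    refine hker k₀ _ ?_
    have h1 := congrArg (· * (aeval x (q k₀ * Θ) * evalPair x y (Polynomial.derivative G)))
      (congrFun hl i)
    simp only [Finset.sum_apply, Pi.smul_apply, Pi.zero_apply, zero_mul, Finset.sum_mul] at h1
    rw [map_sum, ← h1]
    refine Finset.sum_congr rfl fun k hk => ?_
    have := hx0 _ (h k).irreducible.ne_zero
    rw [he k hk, map_mul, map_mul, map_mul, evalPair_C, evalPair_C, aeval_C, kernelForm,
      Algebra.smul_def]
    field_simp
  rw [← Finset.add_sum_erase _ _ hk₀] at hsum
  have hrest : ∑ k ∈ s.erase k₀, Polynomial.C (C (l k)) * Polynomial.C (e k) * N k i ∈ P k₀ := by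
    refine sum_mem fun k hk => ?_
    rw [Finset.mem_erase] at hk
    by_cases ha : Associated (q k) (q k₀)
    · refine (P k₀).mul_mem_left _ ((h k).mem_of_ne i _ (h k₀).isPrime (fun a => ?_)
        (hker _ _ hG) fun h1 => hk.1 (hP h1).symm)
      rw [(h k₀).C_mem_iff, ha.dvd_iff_dvd_left]
    · refine (P k₀).mul_mem_right _ ((P k₀).mul_mem_left _ (((h k₀).C_mem_iff _).mpr ?_))
      have h1 : q k₀ ∣ q k * e k := he k hk.2 ▸ dvd_mul_right _ _
      refine (hprime.dvd_or_dvd h1).resolve_left fun h2 => ha ?_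
      exact ((h k₀).irreducible.associated_of_dvd (h k).irreducible h2).symm
  have hmain := (Submodule.add_mem_iff_left _ hrest).mp hsum
  have hp := (h k₀).isPrime
  have he0 : e k₀ = Θ := (mul_left_cancel₀ (h k₀).irreducible.ne_zero (he k₀ hk₀)).symm
  rw [he0] at hmain
  rcases hp.mem_or_mem hmain with h1 | h1
  · rcases hp.mem_or_mem h1 with h2 | h2
    · rw [(h k₀).C_mem_iff] at h2
      exact (h k₀).irreducible.not_isUnit (isUnit_of_dvd_unit h2 ((isUnit_iff_ne_zero.mpr hl0).map C))
    · exact hΘq (((h k₀).C_mem_iff _).mp h2)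
  · have h2 := (Submodule.sub_mem_iff_right _ h1).mp ((h k₀).sub_mem i)
    rcases hp.mem_or_mem h2 with h3 | h3
    · exact hi (((h k₀).C_mem_iff _).mp h3)
    · exact hG' k₀ h3

end PrimeKernel

theorem finite_of_linearIndependent_of_map_mem {K κ V W : Type*} [Field K] [AddCommGroup V]
    [Module K V] [AddCommGroup W] [Module K W] {ω : κ → V} (hω : LinearIndependent K ω)
    {H : V →ₗ[K] W} (hker : FiniteDimensional K (LinearMap.ker H)) (W' : Submodule K W)
    [FiniteDimensional K W'] {𝒜 : Set (Finset κ)} (h : ∀ A ∈ 𝒜, H (∑ k ∈ A, ω k) ∈ W') :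
    𝒜.Finite := by
  classical
  let Λ : (κ →₀ K) →ₗ[K] W := H ∘ₗ Finsupp.linearCombination K ω
  have hk : FiniteDimensional K (LinearMap.ker Λ) := by
    refine FiniteDimensional.of_injective (V₂ := LinearMap.ker H)
      ((Finsupp.linearCombination K ω).restrict (p := LinearMap.ker Λ) fun a ha => ha) ?_
    intro a b hab
    exact Subtype.ext (hω (congrArg Subtype.val hab))
  have hU : (W'.comap Λ).FG := by
    refine Submodule.fg_of_fg_map_of_fg_inf_ker Λ ?_ ?_
    · have : (W'.comap Λ).map Λ ≤ W' := Submodule.map_comap_le _ _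
      have := Submodule.finiteDimensional_of_le this
      exact (Submodule.fg_iff_finiteDimensional _).mpr this
    · have : W'.comap Λ ⊓ LinearMap.ker Λ ≤ LinearMap.ker Λ := inf_le_right
      have := Submodule.finiteDimensional_of_le this
      exact (Submodule.fg_iff_finiteDimensional _).mpr this
  obtain ⟨t, ht⟩ := hU
  refine (Finset.finite_toSet (t.biUnion Finsupp.support).powerset).subset fun A hA => ?_
  rw [Finset.mem_coe, Finset.mem_powerset]
  have h1 : (∑ k ∈ A, Finsupp.single k (1 : K)) ∈ W'.comap Λ := by
    rw [Submodule.mem_comap]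
    have : Λ (∑ k ∈ A, Finsupp.single k (1 : K)) = H (∑ k ∈ A, ω k) := by
      simp [Λ]
    rw [this]
    exact h A hA
  have h2 : W'.comap Λ ≤ Finsupp.supported K K (t.biUnion Finsupp.support : Finset κ) := by
    rw [← ht, Submodule.span_le]
    intro u hu
    rw [SetLike.mem_coe, Finsupp.mem_supported]
    exact_mod_cast Finset.subset_biUnion_of_mem Finsupp.support hu
  have h3 := (Finsupp.mem_supported K _).mp (h2 h1)
  intro k hk
  refine Finset.mem_coe.mp (h3 ?_)
  rw [Finset.mem_coe, Finsupp.mem_support_iff, Finsupp.finsetSum_apply,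
    Finset.sum_eq_single k]
  · simp
  · intro k' _ hne; simp [hne]
  · intro h; exact absurd hk h

section Local

variable {K F : Type*} [Field K] [Field F] [Algebra K F] {n : ℕ}

/-- The good valuations: those at which all forms `kernelForm` have at most a simple pole,
prescribed by the centre. -/
structure IsGoodValuation (x : Fin (n + 1) → F) (y : F)
    (G : Polynomial (MvPolynomial (Fin (n + 1)) K)) (u : Valuation F ℤᵐ⁰) : Prop where
  le_one : ∀ b : Polynomial (MvPolynomial (Fin (n + 1)) K), u (evalPair x y b) ≤ 1
  derivative : u (evalPair x y (Polynomial.derivative G)) = 1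
  uniformizer : ∀ q : MvPolynomial (Fin (n + 1)) K, Irreducible q →
      (∀ Q : MvPolynomial (Fin (n + 1)) K, u (aeval x Q) < 1 ↔ q ∣ Q) →
      u (aeval x q) = WithZero.exp (-1 : ℤ)
  values : ∃ g : MvPolynomial (Fin (n + 1)) K, ∀ Q : MvPolynomial (Fin (n + 1)) K,
      Irreducible Q → ¬ Associated g Q → 1 ≤ u (aeval x Q)

variable {x : Fin (n + 1) → F} {y : F} {G : Polynomial (MvPolynomial (Fin (n + 1)) K)} {c : ℕ}
  {κ : Type*} {P : κ → Ideal (Polynomial (MvPolynomial (Fin (n + 1)) K))}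
  {q : κ → MvPolynomial (Fin (n + 1)) K}
  {N : κ → Fin (n + 1) → Polynomial (MvPolynomial (Fin (n + 1)) K)}
  (h : ∀ k, IsPrimeKernel G c (P k) (q k) (N k)) (hG : evalPair x y G = 0)
  {u : Valuation F ℤᵐ⁰} (hu : IsGoodValuation x y G u)

include h hG hu

theorem IsGoodValuation.sum_le_one {A : Finset κ}
    (hA : ∀ k ∈ A, u.centre (evalPair x y) hu.le_one ≠ P k) (i : Fin (n + 1)) :
    u ((∑ k ∈ A, kernelForm x y G (q k) (N k)) i) ≤ 1 := by
  obtain ⟨g, hg⟩ := hu.values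
  rw [Finset.sum_apply]
  exact u.map_sum_le fun k hk => (h k).valuation_le_one hu.le_one hu.derivative hu.uniformizer hG
    hg (hA k hk) i

theorem IsGoodValuation.sum_sub_le_one (hP : Function.Injective P) {A : Finset κ} {k : κ}
    (hk : k ∈ A) (hkc : u.centre (evalPair x y) hu.le_one = P k) (i : Fin (n + 1)) :
    u ((∑ k ∈ A, kernelForm x y G (q k) (N k)) i -
      aeval x (pderiv i (q k)) / aeval x (q k)) ≤ 1 := by
  classical
  rw [← Finset.add_sum_erase _ _ hk, Pi.add_apply, add_sub_right_comm]
  refine (u.map_add _ _).trans (max_le ?_ ?_)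
  · exact (h k).valuation_sub_le_one hu.le_one hu.derivative hu.uniformizer hkc i
  · refine hu.sum_le_one h hG (fun k' hk' hc => ?_) i
    exact (Finset.mem_erase.mp hk').1 (hP (hc.symm.trans hkc))

theorem IsGoodValuation.apply_of_centre_eq {k : κ}
    (hkc : u.centre (evalPair x y) hu.le_one = P k) :
    u (aeval x (q k)) = WithZero.exp (-1 : ℤ) := by
  refine hu.uniformizer _ (h k).irreducible fun Q => ?_
  rw [← (h k).C_mem_iff, ← hkc, Valuation.mem_centre, evalPair_C]

theorem IsGoodValuation.sum_le_exp_one (hP : Function.Injective P) (A : Finset κ)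
    (i : Fin (n + 1)) :
    u ((∑ k ∈ A, kernelForm x y G (q k) (N k)) i) ≤ WithZero.exp (1 : ℤ) := by
  have he : (1 : ℤᵐ⁰) ≤ WithZero.exp (1 : ℤ) := by
    rw [← WithZero.exp_zero, WithZero.exp_le_exp]; norm_num
  by_cases hA : ∃ k ∈ A, u.centre (evalPair x y) hu.le_one = P k
  · obtain ⟨k, hk, hkc⟩ := hA
    have h1 := hu.sum_sub_le_one h hG hP hk hkc i
    rw [← sub_add_cancel ((∑ k ∈ A, kernelForm x y G (q k) (N k)) i)
      (aeval x (pderiv i (q k)) / aeval x (q k))]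
    refine (u.map_add _ _).trans (max_le (h1.trans he) ?_)
    rw [map_div₀, hu.apply_of_centre_eq h hG hkc, WithZero.exp_neg, div_inv_eq_mul]
    refine mul_le_of_le_one_left' ?_
    rw [← evalPair_C x y]
    exact hu.le_one _
  · push Not at hA
    exact (hu.sum_le_one h hG hA i).trans he

end Local

section Compare

variable {K F L : Type*} [Field K] [Field F] [Algebra K F] [Field L] [Algebra K L] {n : ℕ}

/-- The difference of the pullbacks along `φ₁` and `φ₂` of `∑ e i dxᵢ`, written in the basis
`dφ₁(xᵢ)`. -/
noncomputable def compareForms (φ₁ φ₂ : F →ₐ[K] L) (θ : Fin (n + 1) → Fin (n + 1) → L) :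
    (Fin (n + 1) → F) →ₗ[K] (Fin (n + 1) → L) where
  toFun e i := φ₁ (e i) - ∑ j, φ₂ (e j) * θ i j
  map_add' e e' := by
    funext i
    simp only [Pi.add_apply, map_add, add_mul, Finset.sum_add_distrib]
    ring
  map_smul' a e := by
    funext i
    simp only [Pi.smul_apply, map_smul, RingHom.id_apply, smul_sub, Finset.smul_sum,
      smul_mul_assoc]

theorem compareForms_apply (φ₁ φ₂ : F →ₐ[K] L) (θ : Fin (n + 1) → Fin (n + 1) → L)
    (e : Fin (n + 1) → F) (i : Fin (n + 1)) :
    compareForms φ₁ φ₂ θ e i = φ₁ (e i) - ∑ j, φ₂ (e j) * θ i j := rfl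

variable {φ₁ φ₂ : F →ₐ[K] L} {w : Valuation L ℤᵐ⁰}

theorem valuation_compareForms_le {θ : Fin (n + 1) → Fin (n + 1) → L} {e : Fin (n + 1) → F}
    {B : ℤᵐ⁰} {i : Fin (n + 1)} (h₁ : w (φ₁ (e i)) ≤ B)
    (h₂ : ∀ j, w (φ₂ (e j)) * w (θ i j) ≤ B) : w (compareForms φ₁ φ₂ θ e i) ≤ B := by
  rw [compareForms_apply]
  refine (w.map_sub _ _).trans (max_le h₁ (w.map_sum_le fun j _ => ?_))
  rw [map_mul]
  exact h₂ j

theorem valuation_compareForms_le_one {x : Fin (n + 1) → F} {E : Fin (n + 1) → Derivation K L L}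
    (hE : ∀ i u, w u ≤ 1 → w (E i u) ≤ 1)
    (hEx : ∀ i j, E i (φ₁ (x j)) = if j = i then 1 else 0) (hx : ∀ j, w (φ₂ (x j)) ≤ 1)
    {q q' : MvPolynomial (Fin (n + 1)) K} (hq : aeval x q ≠ 0)
    (hqq' : w (φ₁ (aeval x q)) = w (φ₂ (aeval x q'))) {e : Fin (n + 1) → F}
    (h₁ : ∀ i, w (φ₁ (e i - aeval x (pderiv i q) / aeval x q)) ≤ 1)
    (h₂ : ∀ i, w (φ₂ (e i - aeval x (pderiv i q') / aeval x q')) ≤ 1) (i : Fin (n + 1)) :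
    w (compareForms φ₁ φ₂ (fun i j => E i (φ₂ (x j))) e i) ≤ 1 := by
  have hd : ∀ (φ : F →ₐ[K] L) (Q : MvPolynomial (Fin (n + 1)) K),
      E i (φ (aeval x Q)) = ∑ j, φ (aeval x (pderiv j Q)) * E i (φ (x j)) := fun φ Q => by
    rw [show φ (aeval x Q) = _ from (comp_aeval_apply x φ Q), (E i).map_mvPolynomial_aeval]
    refine Finset.sum_congr rfl fun j _ => ?_
    rw [show φ (aeval x (pderiv j Q)) = _ from (comp_aeval_apply x φ _)]
  have hd₁ : E i (φ₁ (aeval x q)) = φ₁ (aeval x (pderiv i q)) := by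
    rw [hd, Finset.sum_eq_single i]
    · rw [hEx, if_pos rfl, mul_one]
    · intro j _ hj; rw [hEx, if_neg hj, mul_zero]
    · simp
  have hsplit : compareForms φ₁ φ₂ (fun i j => E i (φ₂ (x j))) e i =
      φ₁ (e i - aeval x (pderiv i q) / aeval x q) -
      ∑ j, φ₂ (e j - aeval x (pderiv j q') / aeval x q') * E i (φ₂ (x j)) +
      (E i (φ₁ (aeval x q)) / φ₁ (aeval x q) - E i (φ₂ (aeval x q')) / φ₂ (aeval x q')) := by
    rw [hd₁, hd φ₂, compareForms_apply]
    simp only [map_sub, sub_mul, Finset.sum_sub_distrib, map_div₀, Finset.sum_div,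
      div_mul_eq_mul_div]
    ring
  rw [hsplit]
  refine (w.map_add _ _).trans (max_le ((w.map_sub _ _).trans (max_le (h₁ i) ?_)) ?_)
  · refine w.map_sum_le fun j _ => ?_
    rw [map_mul]
    exact mul_le_one' (h₂ j) (hE i _ (hx j))
  · exact (E i).valuation_logDeriv_sub_le_one (hE i) ((map_ne_zero φ₁).mpr hq) hqq'

end Compare

section Finiteness

variable {K L : Type*} [Field K] [CharZero K] [Field L] [Algebra K L] [Algebra.EssFiniteType K L] {F : Type*} [Field F] [Algebra K F]
  {n : ℕ} {x : Fin (n + 1) → F} {y : F} {G : Polynomial (MvPolynomial (Fin (n + 1)) K)} {c : ℕ}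
  {κ : Type*} {P : κ → Ideal (Polynomial (MvPolynomial (Fin (n + 1)) K))}
  {q : κ → MvPolynomial (Fin (n + 1)) K}
  {N : κ → Fin (n + 1) → Polynomial (MvPolynomial (Fin (n + 1)) K)}
  (h : ∀ k, IsPrimeKernel G c (P k) (q k) (N k)) (hG : evalPair x y G = 0)
  (hP : Function.Injective P) {φ₁ φ₂ : F →ₐ[K] L} {E : Fin (n + 1) → Derivation K L L}
  (hEx : ∀ i j, E i (φ₁ (x j)) = if j = i then 1 else 0)

include h hG hP in
theorem valuation_compareForms_sum_le_exp_one {w : Valuation L ℤᵐ⁰}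
    (hw₁ : IsGoodValuation x y G (w.comap φ₁.toRingHom))
    (hw₂ : IsGoodValuation x y G (w.comap φ₂.toRingHom))
    (hE : ∀ i u, w u ≤ 1 → w (E i u) ≤ 1) (A : Finset κ) (i : Fin (n + 1)) :
    w (compareForms φ₁ φ₂ (fun i j => E i (φ₂ (x j)))
      (∑ k ∈ A, kernelForm x y G (q k) (N k)) i) ≤ WithZero.exp (1 : ℤ) := by
  refine valuation_compareForms_le (hw₁.sum_le_exp_one h hG hP A i) fun j => ?_
  refine (mul_le_of_le_one_right' (hE i _ ?_)).trans (hw₂.sum_le_exp_one h hG hP A j)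
  simpa using hw₂.le_one (Polynomial.C (X j))

include h hG hP hEx in
theorem valuation_compareForms_sum_le_one {w : Valuation L ℤᵐ⁰}
    (hw₁ : IsGoodValuation x y G (w.comap φ₁.toRingHom))
    (hw₂ : IsGoodValuation x y G (w.comap φ₂.toRingHom))
    (hE : ∀ i u, w u ≤ 1 → w (E i u) ≤ 1) {A : Finset κ}
    (hA : (∃ k ∈ A, ∀ b, b ∈ P k ↔ w (φ₁ (evalPair x y b)) < 1) ↔
      ∃ k ∈ A, ∀ b, b ∈ P k ↔ w (φ₂ (evalPair x y b)) < 1) (i : Fin (n + 1)) :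
    w (compareForms φ₁ φ₂ (fun i j => E i (φ₂ (x j)))
      (∑ k ∈ A, kernelForm x y G (q k) (N k)) i) ≤ 1 := by
  have hx : ∀ j, w (φ₂ (x j)) ≤ 1 := fun j => by simpa using hw₂.le_one (Polynomial.C (X j))
  by_cases hA₁ : ∃ k ∈ A, ∀ b, b ∈ P k ↔ w (φ₁ (evalPair x y b)) < 1
  · obtain ⟨k', hk', hkc'⟩ := hA.mp hA₁
    obtain ⟨k, hk, hkc⟩ := hA₁
    have h1 : (w.comap φ₁.toRingHom).centre (evalPair x y) hw₁.le_one = P k :=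
      Ideal.ext fun b => (hkc b).symm
    have h2 : (w.comap φ₂.toRingHom).centre (evalPair x y) hw₂.le_one = P k' :=
      Ideal.ext fun b => (hkc' b).symm
    have h3 := hw₁.apply_of_centre_eq h hG h1
    have h4 := hw₂.apply_of_centre_eq h hG h2
    refine valuation_compareForms_le_one hE hEx hx (q := q k) (q' := q k') ?_ (h3.trans h4.symm)
      (hw₁.sum_sub_le_one h hG hP hk h1) (hw₂.sum_sub_le_one h hG hP hk' h2) i
    intro h0
    rw [h0, map_zero] at h3
    exact WithZero.exp_ne_zero h3.symm
  · have hA₂ : ¬ ∃ k ∈ A, ∀ b, b ∈ P k ↔ w (φ₂ (evalPair x y b)) < 1 := fun h2 => hA₁ (hA.mpr h2)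
    push Not at hA₁ hA₂
    refine valuation_compareForms_le (hw₁.sum_le_one h hG (fun k hk hc => ?_) i) fun j =>
      mul_le_one' (hw₂.sum_le_one h hG (fun k hk hc => ?_) j) (hE i _ (hx j))
    · obtain ⟨b, hb⟩ := hA₁ k hk
      have : b ∈ P k ↔ w (φ₁ (evalPair x y b)) < 1 := by rw [← hc]; exact Iff.rfl
      grind
    · obtain ⟨b, hb⟩ := hA₂ k hk
      have : b ∈ P k ↔ w (φ₂ (evalPair x y b)) < 1 := by rw [← hc]; exact Iff.rfl
      grind

variable {m : ℕ} {z : Fin m → L} (hz : IsTranscendenceBasis K z) (j : Fin m)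
include hz

include h in
theorem exists_kernelForm_sum_le {φ : F →ₐ[K] L} {w : Valuation L ℤᵐ⁰}
    (hw : w ∈ allPlaces K z j)
    (hρ : ∃ ρ : ℤᵐ⁰, 1 ≤ ρ ∧ (∀ i, w (φ (x i)) ≤ ρ) ∧
      ∀ k, w (φ (aeval x (q k))) = ρ ^ (q k).totalDegree) :
    ∃ B : ℤᵐ⁰, ∀ (A : Finset κ) i, w (φ ((∑ k ∈ A, kernelForm x y G (q k) (N k)) i)) ≤ B := by
  obtain ⟨ρ, hρ, hx, hq⟩ := hρ
  refine ⟨ρ ^ (c * (G.natDegree + 1)) * (max 1 (w (φ y))) ^ G.natDegree /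
    w (φ (evalPair x y (Polynomial.derivative G))), fun A i => ?_⟩
  rw [Finset.sum_apply, map_sum]
  refine w.map_sum_le fun k _ => ?_
  refine (h k).valuation_le (u := w.comap φ.toRingHom) (fun a => ?_) hρ hx (hq k) i
  rw [Valuation.comap_apply]
  change w (φ (algebraMap K F a)) ≤ 1
  rw [φ.commutes]
  rcases eq_or_ne a 0 with rfl | ha
  · rw [map_zero, map_zero]; exact zero_le
  · exact (allPlaces_algebraMap hz j hw ha).le

include h hG hP hEx in
theorem finite_of_correspondence (hx : AlgebraicIndependent K x)
    (hker : ∀ k b, evalPair x y b = 0 → b ∈ P k) (hG' : ∀ k, Polynomial.derivative G ∉ P k)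
    {T₁ T₂ : Set (Valuation L ℤᵐ⁰)} (hT₁ : (allPlaces K z j ∩ T₁).Finite)
    (hT₂ : (allPlaces K z j ∩ T₂).Finite)
    (hgood₁ : ∀ w ∈ allPlaces K z j, w ∉ T₁ → IsGoodValuation x y G (w.comap φ₁.toRingHom))
    (hgood₂ : ∀ w ∈ allPlaces K z j, w ∉ T₁ → IsGoodValuation x y G (w.comap φ₂.toRingHom))
    (hE : ∀ w ∈ allPlaces K z j, w ∉ T₁ → ∀ i u, w u ≤ 1 → w (E i u) ≤ 1)
    (hbad₁ : ∀ w ∈ allPlaces K z j, w ∈ T₁ → ∃ ρ : ℤᵐ⁰, 1 ≤ ρ ∧ (∀ i, w (φ₁ (x i)) ≤ ρ) ∧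
      ∀ k, w (φ₁ (aeval x (q k))) = ρ ^ (q k).totalDegree)
    (hbad₂ : ∀ w ∈ allPlaces K z j, w ∈ T₁ → ∃ ρ : ℤᵐ⁰, 1 ≤ ρ ∧ (∀ i, w (φ₂ (x i)) ≤ ρ) ∧
      ∀ k, w (φ₂ (aeval x (q k))) = ρ ^ (q k).totalDegree)
    {𝒜 : Set (Finset κ)}
    (h𝒜 : ∀ w ∈ allPlaces K z j, w ∉ T₁ → w ∉ T₂ → ∀ A ∈ 𝒜,
      (∃ k ∈ A, ∀ b, b ∈ P k ↔ w (φ₁ (evalPair x y b)) < 1) ↔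
        ∃ k ∈ A, ∀ b, b ∈ P k ↔ w (φ₂ (evalPair x y b)) < 1)
    (hfin : FiniteDimensional K
      (LinearMap.ker (compareForms φ₁ φ₂ fun i j => E i (φ₂ (x j))))) :
    𝒜.Finite := by
  classical
  have hB : ∀ w, ∃ B : ℤᵐ⁰, w ∈ allPlaces K z j → (w ∉ T₁ → w ∉ T₂ → B ≤ 1) ∧
      ∀ A ∈ 𝒜, ∀ i, w (compareForms φ₁ φ₂ (fun i j => E i (φ₂ (x j)))
        (∑ k ∈ A, kernelForm x y G (q k) (N k)) i) ≤ B := by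
    intro w
    by_cases hw : w ∈ allPlaces K z j
    swap
    · exact ⟨1, fun h => absurd h hw⟩
    by_cases h1 : w ∈ T₁
    · obtain ⟨B₁, hB₁⟩ := exists_kernelForm_sum_le (y := y) h hz j hw (hbad₁ w hw h1)
      obtain ⟨B₂, hB₂⟩ := exists_kernelForm_sum_le (y := y) h hz j hw (hbad₂ w hw h1)
      obtain ⟨M, hM⟩ := (Set.finite_range fun p : Fin (n + 1) × Fin (n + 1) =>
        w (E p.1 (φ₂ (x p.2)))).bddAbove
      refine ⟨max B₁ (B₂ * M), fun _ => ⟨fun h => absurd h1 h, fun A _ i => ?_⟩⟩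
      refine valuation_compareForms_le ((hB₁ A i).trans (le_max_left _ _)) fun j => ?_
      exact (mul_le_mul' (hB₂ A j) (hM ⟨(i, j), rfl⟩)).trans (le_max_right _ _)
    by_cases h2 : w ∈ T₂
    · exact ⟨WithZero.exp 1, fun _ => ⟨fun _ h => absurd h2 h, fun A _ i =>
        valuation_compareForms_sum_le_exp_one h hG hP (hgood₁ w hw h1) (hgood₂ w hw h1)
          (hE w hw h1) A i⟩⟩
    · exact ⟨1, fun _ => ⟨fun _ _ => le_rfl, fun A hA i =>
        valuation_compareForms_sum_le_one h hG hP hEx (hgood₁ w hw h1) (hgood₂ w hw h1)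
          (hE w hw h1) (h𝒜 w hw h1 h2 A hA) i⟩⟩
  choose B hB using hB
  obtain ⟨W, hW, hWB⟩ := exists_finiteDimensional_of_bounded hz j B
    ((hT₁.union hT₂).subset fun w hw => by
      obtain ⟨hw, h1⟩ := hw
      by_contra h2
      simp only [Set.mem_union, Set.mem_inter_iff, hw, true_and, not_or] at h2
      exact h1.not_ge ((hB w hw).1 h2.1 h2.2))
  let W' : Submodule K (Fin (n + 1) → L) :=
    LinearMap.range (LinearMap.compLeft W.subtype (Fin (n + 1)))
  have hW' : FiniteDimensional K W' := inferInstance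
  have hmem : ∀ A ∈ 𝒜, compareForms φ₁ φ₂ (fun i j => E i (φ₂ (x j)))
      (∑ k ∈ A, kernelForm x y G (q k) (N k)) ∈ W' := fun A hA =>
    ⟨fun i => ⟨_, hWB _ fun w hw => (hB w hw).2 A hA i⟩, rfl⟩
  have hli := linearIndependent_kernelForm h hP hx hker hG' hG
  exact finite_of_linearIndependent_of_map_mem (K := K) (κ := κ) (V := Fin (n + 1) → F)
    (W := Fin (n + 1) → L) hli (H := compareForms φ₁ φ₂ (fun i j => E i (φ₂ (x j)))) hfin W' hmem
end Finiteness

section FixedField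

variable {K F L : Type*} [Field K] [Field F] [Algebra K F] [Field L] [Algebra K L] {n : ℕ}
  {φ₁ φ₂ : F →ₐ[K] L} {θ : Fin (n + 1) → Fin (n + 1) → L}
  (hfix : ∀ g : F, φ₁ g = φ₂ g → ∃ c : K, algebraMap K F c = g)
include hfix

theorem linearIndependent_of_mem_ker_compareForms {ι : Type*} {ω : ι → Fin (n + 1) → F}
    (hω : LinearIndependent K ω) (hker : ∀ k, ω k ∈ LinearMap.ker (compareForms φ₁ φ₂ θ)) :
    LinearIndependent F ω := by
  classical
  have hker' : ∀ k i, φ₁ (ω k i) = ∑ j, φ₂ (ω k j) * θ i j := fun k i => by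
    have := congrFun (hker k) i
    rwa [compareForms_apply, Pi.zero_apply, sub_eq_zero] at this
  rw [linearIndependent_iff_finset_linearIndependent]
  intro s
  change LinearIndepOn F ω (s : Set ι)
  induction s using Finset.induction_on with
  | empty => rw [Finset.coe_empty]; exact linearIndepOn_empty F ω
  | insert a s ha ih =>
    rw [Finset.coe_insert, linearIndepOn_insert (by exact_mod_cast ha)]
    refine ⟨ih, fun hmem => ?_⟩
    rw [Submodule.mem_span_image_finset_iff_exists_fun'] at hmem
    obtain ⟨c, hc⟩ := hmem
    have hc' : ∀ i, ω a i = ∑ k ∈ s, c k * ω k i := fun i => by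
      rw [← hc]; simp
    have h1 : ∀ i, ∑ k ∈ s, (φ₁ (c k) - φ₂ (c k)) * φ₁ (ω k i) = 0 := fun i => by
      have h2 := congrArg φ₁ (hc' i)
      rw [hker'] at h2
      simp only [sub_mul, Finset.sum_sub_distrib, sub_eq_zero]
      rw [map_sum] at h2
      simp only [map_mul] at h2
      rw [← h2]
      simp only [hc', map_sum, map_mul, Finset.sum_mul, hker', Finset.mul_sum]
      rw [Finset.sum_comm]
      exact Finset.sum_congr rfl fun k _ => Finset.sum_congr rfl fun j _ => by ring
    have h3 : ∀ k ∈ s, φ₁ (c k) = φ₂ (c k) := fun k hk => by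
      obtain ⟨g, hg⟩ := (Finsupp.linearCombination F fun k : s => ω k).exists_leftInverse_of_injective
        (LinearMap.ker_eq_bot.mpr ih)
      have h4 : ∀ l : s, ∑ i, g (Pi.single i 1) ⟨k, hk⟩ * ω l i = if l = ⟨k, hk⟩ then 1 else 0 := by
        intro l
        have h5 := congrArg (· ⟨k, hk⟩) (LinearMap.congr_fun hg (Finsupp.single l 1))
        simp only [LinearMap.comp_apply, Finsupp.linearCombination_single, one_smul,
          LinearMap.id_apply, Finsupp.single_apply] at h5
        rw [← h5]
        conv_rhs => rw [show ω l = ∑ i, ω l i • Pi.single i (1 : F) by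
          funext i; simp [Finset.sum_apply, Pi.single_apply]]
        rw [map_sum, Finsupp.finsetSum_apply]
        refine Finset.sum_congr rfl fun i _ => ?_
        rw [map_smul, Finsupp.smul_apply, smul_eq_mul, mul_comm]
      have h6 : ∑ i, φ₁ (g (Pi.single i 1) ⟨k, hk⟩) *
          ∑ l ∈ s, (φ₁ (c l) - φ₂ (c l)) * φ₁ (ω l i) = 0 :=
        Finset.sum_eq_zero fun i _ => by rw [h1, mul_zero]
      simp only [Finset.mul_sum] at h6
      rw [Finset.sum_comm, Finset.sum_eq_single k] at h6
      · have h7 := congrArg φ₁ (h4 ⟨k, hk⟩)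
        rw [if_pos rfl, map_sum, map_one] at h7
        simp only [map_mul] at h7
        have h8 : (φ₁ (c k) - φ₂ (c k)) * 1 = 0 := by
          rw [← h7, Finset.mul_sum, ← h6]
          exact Finset.sum_congr rfl fun i _ => by ring
        rwa [mul_one, sub_eq_zero] at h8
      · intro l hl hlk
        have h7 := congrArg φ₁ (h4 ⟨l, hl⟩)
        rw [if_neg (fun h => hlk (congrArg Subtype.val h)), map_sum, map_zero] at h7
        simp only [map_mul] at h7
        rw [← mul_zero (φ₁ (c l) - φ₂ (c l)), ← h7, Finset.mul_sum]
        exact Finset.sum_congr rfl fun i _ => by ring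
      · exact fun h => absurd hk h
    have h8 : ω a ∈ Submodule.span K (ω '' (s : Set ι)) := by
      rw [← hc]
      refine sum_mem fun k hk => ?_
      obtain ⟨d, hd⟩ := hfix _ (h3 k hk)
      rw [← hd, algebraMap_smul]
      exact Submodule.smul_mem _ _ (Submodule.subset_span ⟨k, hk, rfl⟩)
    exact hω.notMem_span_image (by exact_mod_cast ha) h8

theorem finiteDimensional_ker_compareForms :
    FiniteDimensional K (LinearMap.ker (compareForms φ₁ φ₂ θ)) := by
  let b := Module.Free.chooseBasis K (LinearMap.ker (compareForms φ₁ φ₂ θ))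
  have h1 := linearIndependent_of_mem_ker_compareForms hfix (θ := θ)
    (b.linearIndependent.map' (Submodule.subtype _) (Submodule.ker_subtype _)) fun k => (b k).2
  have := h1.finite
  exact Module.Finite.of_basis b

end FixedField

theorem HeightOnePrime.exists_transcendental {K R : Type*} [Field K] [CommRing R] [IsDomain R]
    [Algebra K R] {P : Ideal R} (hP : HeightOnePrime P) : ∃ r : R, Transcendental K r := by
  obtain ⟨r, hr, hr0⟩ := Submodule.exists_mem_ne_zero_of_ne_bot hP.2.1
  exact ⟨r, fun h => hP.1.ne_top (Ideal.eq_top_of_isUnit_mem P hr (h.isIntegral.isUnit hr0))⟩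

theorem aeval_algebraMap_apply_X {K R : Type*} [Field K] [CommRing R] [Algebra K R] {m : ℕ}
    (g : MvPolynomial (Fin m) K →ₐ[K] R) (F : Type*) [Field F] [Algebra R F] [Algebra K F]
    [IsScalarTower K R F] (Q : MvPolynomial (Fin m) K) :
    aeval (fun i => algebraMap R F (g (X i))) Q = algebraMap R F (g Q) := by
  have := comp_aeval_apply (fun i => (X i : MvPolynomial (Fin m) K))
    ((IsScalarTower.toAlgHom K R F).comp g) Q
  simpa using this.symm

theorem isIntegral_adjoin_of_isIntegral {K R : Type*} [Field K] [CommRing R] [Algebra K R] {m : ℕ}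
    {g : MvPolynomial (Fin m) K →ₐ[K] R} (F : Type*) [Field F] [Algebra R F] [Algebra K F]
    [IsScalarTower K R F] (hg : (g : MvPolynomial (Fin m) K →+* R).IsIntegral) (s : R) :
    IsIntegral (Algebra.adjoin K (Set.range fun i => algebraMap R F (g (X i))))
      (algebraMap R F s) := by
  obtain ⟨p, hp, hps⟩ := hg s
  let ψ : MvPolynomial (Fin m) K →+* Algebra.adjoin K
      (Set.range fun i => algebraMap R F (g (X i))) :=
    (((IsScalarTower.toAlgHom K R F).comp g).codRestrict _ (fun Q => by
      rw [Algebra.adjoin_range_eq_range_aeval]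
      exact ⟨Q, aeval_algebraMap_apply_X g F Q⟩)).toRingHom
  refine ⟨p.map ψ, hp.map ψ, ?_⟩
  rw [Polynomial.eval₂_map]
  have := congrArg (algebraMap R F) hps
  rw [map_zero, Polynomial.hom_eval₂] at this
  exact this

theorem exists_isIntegral_algHom_mvPolynomial {K R : Type*} [Field K] [CommRing R] [IsDomain R]
    [Algebra K R] [Algebra.FiniteType K R] (F : Type*) [Field F] [Algebra R F] [Algebra K F]
    [IsScalarTower K R F] [IsFractionRing R F] {r : R} (hr : Transcendental K r) :
    ∃ (m : ℕ) (g : MvPolynomial (Fin (m + 1)) K →ₐ[K] R),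
      (g : MvPolynomial (Fin (m + 1)) K →+* R).IsIntegral ∧
        IsTranscendenceBasis K fun i => algebraMap R F (g (X i)) := by
  obtain ⟨m, g, hg, hgi⟩ := exists_integral_inj_algHom_of_fg K R
  have hind : AlgebraicIndependent K fun i => algebraMap R F (g (X i)) := by
    intro a b hab
    rw [aeval_algebraMap_apply_X g F, aeval_algebraMap_apply_X g F] at hab
    exact hg (IsFractionRing.injective R F hab)
  have hbas : IsTranscendenceBasis K fun i => algebraMap R F (g (X i)) := by
    rw [hind.isTranscendenceBasis_iff_isAlgebraic]
    have : FaithfulSMul (Algebra.adjoin K (Set.range fun i => algebraMap R F (g (X i)))) F :=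
      inferInstance
    refine ⟨fun s => ?_⟩
    obtain ⟨a, b, hb, rfl⟩ := IsFractionRing.div_surjective (A := R) s
    rw [div_eq_mul_inv]
    exact (isIntegral_adjoin_of_isIntegral F hgi a).isAlgebraic.mul
      (isIntegral_adjoin_of_isIntegral F hgi b).isAlgebraic.inv
  cases m with
  | zero =>
    exfalso
    apply hr
    obtain ⟨p, hp, hps⟩ := hgi r
    refine ⟨p.map (isEmptyAlgEquiv K (Fin 0)).toAlgHom.toRingHom, (hp.map _).ne_zero, ?_⟩
    have hcomp : (algebraMap K R).comp (isEmptyAlgEquiv K (Fin 0)).toAlgHom.toRingHom = g.toRingHom := by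
      refine RingHom.ext fun a => ?_
      obtain ⟨c, rfl⟩ := C_surjective (Fin 0) a
      have h1 : isEmptyAlgEquiv K (Fin 0) (C c) = c := (isEmptyAlgEquiv K (Fin 0)).commutes c
      exact (congrArg (algebraMap K R) h1).trans (g.commutes c).symm
    rw [Polynomial.aeval_def, Polynomial.eval₂_map, hcomp]
    exact hps
  | succ m => exact ⟨m, g, hgi, hbas⟩

theorem IsTranscendenceBasis.exists_integral_generator {K F : Type*} [Field K] [CharZero K] [Field F]
    [Algebra K F] [Algebra.EssFiniteType K F] {n : ℕ} {x : Fin (n + 1) → F}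
    (hx : IsTranscendenceBasis K x) :
    ∃ (y : F) (G : Polynomial (MvPolynomial (Fin (n + 1)) K)), G.Monic ∧ evalPair x y G = 0 ∧
      evalPair x y (Polynomial.derivative G) ≠ 0 ∧
      ∀ s : F, ∃ b b' : Polynomial (MvPolynomial (Fin (n + 1)) K), evalPair x y b' ≠ 0 ∧
        evalPair x y b' * s = evalPair x y b := by
  let _ : Algebra (MvPolynomial (Fin (n + 1)) K) F := (aeval x).toRingHom.toAlgebra
  have hinj : Function.Injective (algebraMap (MvPolynomial (Fin (n + 1)) K) F) := hx.1
  have : FaithfulSMul (MvPolynomial (Fin (n + 1)) K) F :=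
    (faithfulSMul_iff_algebraMap_injective _ _).2 hinj
  have := hx.finiteDimensional_adjoin
  have : CharZero F := charZero_of_injective_algebraMap (algebraMap K F).injective
  obtain ⟨α, hα⟩ := Field.exists_primitive_element (IntermediateField.adjoin K (Set.range x)) F
  have hadj : IsAlgebraic (MvPolynomial (Fin (n + 1)) K) α := by
    obtain ⟨p, hp, hpα⟩ := hx.isAlgebraic.isAlgebraic α
    have hsymm : Function.Injective hx.1.aevalEquiv.symm.toAlgHom.toRingHom :=
      hx.1.aevalEquiv.symm.injective
    refine ⟨p.map hx.1.aevalEquiv.symm.toAlgHom.toRingHom,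
      (Polynomial.map_ne_zero_iff hsymm).2 hp, ?_⟩
    have hcomp : (algebraMap (MvPolynomial (Fin (n + 1)) K) F).comp
        hx.1.aevalEquiv.symm.toAlgHom.toRingHom =
          algebraMap (Algebra.adjoin K (Set.range x)) F := by
      refine RingHom.ext fun s => ?_
      have := hx.1.algebraMap_aevalEquiv (hx.1.aevalEquiv.symm s)
      rw [AlgEquiv.apply_symm_apply] at this
      exact this.symm
    rw [Polynomial.aeval_def, Polynomial.eval₂_map, hcomp]
    exact hpα
  obtain ⟨a, ha0, ha⟩ := hadj.exists_integral_multiple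
  have ha0' : aeval x a ≠ 0 := fun h => ha0 (hinj (h.trans (map_zero (algebraMap _ F)).symm))
  set y : F := a • α with hy
  have hy' : y = aeval x a * α := Algebra.smul_def a α
  have htop : IntermediateField.adjoin K (Set.range x ∪ {y}) = ⊤ := by
    have h1 : IntermediateField.adjoin K (Set.range x ∪ {α}) = ⊤ := by
      rw [← IntermediateField.adjoin_adjoin_left, hα, IntermediateField.restrictScalars_top]
    rw [← top_le_iff, ← h1, IntermediateField.adjoin_le_iff]
    have hsub := IntermediateField.subset_adjoin K (Set.range x ∪ {y})
    rintro s (hs | rfl)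
    · exact hsub (Or.inl hs)
    · have hα' : s = y / aeval x a := by rw [hy', mul_div_cancel_left₀ _ ha0']
      rw [hα']
      refine div_mem (hsub (Or.inr rfl)) ?_
      have h2 : aeval x a ∈ Algebra.adjoin K (Set.range x) := by
        rw [Algebra.adjoin_range_eq_range_aeval]
        exact ⟨a, rfl⟩
      exact IntermediateField.algebra_adjoin_le_adjoin K _
        (Algebra.adjoin_mono Set.subset_union_left h2)
  have hrange : ∀ s ∈ Algebra.adjoin K (Set.range x ∪ {y}),
      ∃ b : Polynomial (MvPolynomial (Fin (n + 1)) K), evalPair x y b = s := by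
    intro s hs
    induction hs using Algebra.adjoin_induction with
    | mem s hs =>
      rcases hs with ⟨i, rfl⟩ | rfl
      · exact ⟨Polynomial.C (X i), by simp⟩
      · exact ⟨Polynomial.X, by simp [evalPair]⟩
    | algebraMap c => exact ⟨Polynomial.C (C c), by simp⟩
    | add s t _ _ hs ht =>
      obtain ⟨b, rfl⟩ := hs
      obtain ⟨b', rfl⟩ := ht
      exact ⟨b + b', map_add _ _ _⟩
    | mul s t _ _ hs ht =>
      obtain ⟨b, rfl⟩ := hs
      obtain ⟨b', rfl⟩ := ht
      exact ⟨b * b', map_mul _ _ _⟩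
  have hG := minpoly.monic ha
  have hGy : Polynomial.aeval y (minpoly (MvPolynomial (Fin (n + 1)) K) y) = 0 := minpoly.aeval _ _
  refine ⟨y, minpoly (MvPolynomial (Fin (n + 1)) K) y, hG, hGy, fun h => ?_, fun s => ?_⟩
  · have hd : Polynomial.derivative (minpoly (MvPolynomial (Fin (n + 1)) K) y) ≠ 0 := fun h0 => by
      have h1 := Polynomial.derivative_eq_zero.1 h0
      rw [hG.natDegree_eq_zero.1 h1, map_one] at hGy
      exact one_ne_zero hGy
    exact absurd (minpoly.IsIntegrallyClosed.degree_le_of_ne_zero hd h)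
      (not_le.2 (Polynomial.degree_derivative_lt hG.ne_zero))
  · have hs : s ∈ IntermediateField.adjoin K (Set.range x ∪ {y}) := htop ▸ IntermediateField.mem_top
    obtain ⟨r, hr, t, ht, rfl⟩ := IntermediateField.mem_adjoin_iff_div.1 hs
    obtain ⟨b, rfl⟩ := hrange r hr
    obtain ⟨b', rfl⟩ := hrange t ht
    by_cases h0 : evalPair x y b' = 0
    · exact ⟨0, 1, by simp, by simp [h0]⟩
    · exact ⟨b, b', h0, mul_div_cancel₀ _ h0⟩

theorem exists_evalPair_correspondence {K F R : Type*} [Field K] [Field F] [Algebra K F]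
    [CommRing R] [IsDomain R] [Algebra K R] [Algebra.FiniteType K R] [Algebra R F]
    [IsScalarTower K R F] [IsFractionRing R F] {n : ℕ} {x : Fin (n + 1) → F}
    (hx : AlgebraicIndependent K x) {y : F} {G : Polynomial (MvPolynomial (Fin (n + 1)) K)}
    (hG : G.Monic) (hGy : evalPair x y G = 0)
    (hgen : ∀ s : F, ∃ b b' : Polynomial (MvPolynomial (Fin (n + 1)) K), evalPair x y b' ≠ 0 ∧
      evalPair x y b' * s = evalPair x y b) :
    ∃ (h : R) (𝔓 : Ideal R → Ideal (Polynomial (MvPolynomial (Fin (n + 1)) K))), h ≠ 0 ∧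
      (∀ v : Valuation F ℤᵐ⁰, CentredOff h v →
        ∀ b : Polynomial (MvPolynomial (Fin (n + 1)) K), v (evalPair x y b) ≤ 1) ∧
      (∀ r : R, ∃ b : Polynomial (MvPolynomial (Fin (n + 1)) K), (∀ v : Valuation F ℤᵐ⁰, CentredOff h v →
          (v (algebraMap R F r) < 1 ↔ v (evalPair x y b) < 1)) ∧
        ∀ P : Ideal R, HeightOnePrime P → h ∉ P → (b ∈ 𝔓 P ↔ r ∈ P)) ∧
      (∀ b : Polynomial (MvPolynomial (Fin (n + 1)) K), ∃ r : R, (evalPair x y b ≠ 0 → r ≠ 0) ∧ (∀ v : Valuation F ℤᵐ⁰, CentredOff h v →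
          (v (algebraMap R F r) < 1 ↔ v (evalPair x y b) < 1)) ∧
        ∀ P : Ideal R, HeightOnePrime P → h ∉ P → (b ∈ 𝔓 P ↔ r ∈ P)) ∧
      ∀ P : Ideal R, HeightOnePrime P → h ∉ P → (𝔓 P).IsPrime ∧
        (∃ q, Irreducible q ∧ ∀ a, Polynomial.C a ∈ 𝔓 P ↔ q ∣ a) ∧
        ∀ b : Polynomial (MvPolynomial (Fin (n + 1)) K), evalPair x y b = 0 → b ∈ 𝔓 P := by
  let _ : Algebra (MvPolynomial (Fin (n + 1)) K) F := (aeval x).toRingHom.toAlgebra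
  have : FaithfulSMul (MvPolynomial (Fin (n + 1)) K) F :=
    (faithfulSMul_iff_algebraMap_injective _ _).2 hx
  have : IsScalarTower K (MvPolynomial (Fin (n + 1)) K) F :=
    .of_algebraMap_eq fun c => ((aeval x).commutes c).symm
  exact exists_prime_correspondence K (y := y) ⟨G, hG, hGy⟩ hgen

theorem isGoodValuation_comap {K F L : Type*} [Field K] [CharZero K] [Field F] [Algebra K F]
    [Field L] [Algebra K L] {n : ℕ} {x : Fin (n + 1) → F} {y : F}
    {G : Polynomial (MvPolynomial (Fin (n + 1)) K)} {φ : F →ₐ[K] L}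
    {E : Fin (n + 1) → Derivation K L L}
    (hEx : ∀ i j, E i (φ (x j)) = if j = i then 1 else 0) {w : Valuation L ℤᵐ⁰}
    (hE : ∀ i u, w u ≤ 1 → w (E i u) ≤ 1) {π : L} (hπ : w π = WithZero.exp (-1 : ℤ))
    (hle : ∀ b : Polynomial (MvPolynomial (Fin (n + 1)) K), w (φ (evalPair x y b)) ≤ 1)
    (hG : w (φ (evalPair x y (Polynomial.derivative G))) = 1)
    {ρ : ℤᵐ⁰} (hρ : 1 ≤ ρ) {g : MvPolynomial (Fin (n + 1)) K}
    (hg : ∀ Q, Irreducible Q → ¬ Associated g Q → w (φ (aeval x Q)) = ρ ^ Q.totalDegree) :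
    IsGoodValuation x y G (w.comap φ.toRingHom) where
  le_one := hle
  derivative := hG
  uniformizer _ hq hlt := valuation_eq_exp_neg_one hE hEx hπ hq hlt
  values := ⟨g, fun Q hQ hgQ => (hg Q hQ hgQ).symm ▸ one_le_pow₀ hρ⟩

section Correspondence

variable {K R F S L : Type*} [Field K] [CommRing R] [Field F] [Algebra K F] [Algebra R F]
  [CommRing S] [Field L] [Algebra K L] [Algebra S L] {n : ℕ} {x : Fin (n + 1) → F}
  {y : F} {h : R} {𝔓 : Ideal R → Ideal (Polynomial (MvPolynomial (Fin (n + 1)) K))}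
  (h₁ : ∀ r : R, ∃ b : Polynomial (MvPolynomial (Fin (n + 1)) K),
    (∀ v : Valuation F ℤᵐ⁰, CentredOff h v →
      (v (algebraMap R F r) < 1 ↔ v (evalPair x y b) < 1)) ∧
    ∀ P : Ideal R, HeightOnePrime P → h ∉ P → (b ∈ 𝔓 P ↔ r ∈ P))
  (h₂ : ∀ b : Polynomial (MvPolynomial (Fin (n + 1)) K), ∃ r : R,
    (evalPair x y b ≠ 0 → r ≠ 0) ∧
    (∀ v : Valuation F ℤᵐ⁰, CentredOff h v →
      (v (algebraMap R F r) < 1 ↔ v (evalPair x y b) < 1)) ∧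
    ∀ P : Ideal R, HeightOnePrime P → h ∉ P → (b ∈ 𝔓 P ↔ r ∈ P))

include h₁ in
theorem eq_of_correspondence_eq {P P' : Ideal R} (hP : HeightOnePrime P) (hhP : h ∉ P)
    (hP' : HeightOnePrime P') (hhP' : h ∉ P') (heq : 𝔓 P = 𝔓 P') : P = P' := by
  ext r
  obtain ⟨b, -, hb⟩ := h₁ r
  rw [← hb P hP hhP, ← hb P' hP' hhP', heq]

include h₁ h₂ in
theorem forall_mem_iff_eq_comap_centre {φ : F →ₐ[K] L} {f : R →+* S}
    (hφ : ∀ r, φ (algebraMap R F r) = algebraMap S L (f r)) {w : Valuation L ℤᵐ⁰}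
    (hwS : ∀ s, w (algebraMap S L s) ≤ 1) (hw : CentredOff h (w.comap φ.toRingHom))
    {P : Ideal R} (hP : HeightOnePrime P) (hhP : h ∉ P) :
    (∀ b, b ∈ 𝔓 P ↔ w (φ (evalPair x y b)) < 1) ↔
      (w.centre (algebraMap S L) hwS).comap f = P := by
  have key : ∀ r, r ∈ (w.centre (algebraMap S L) hwS).comap f ↔
      (w.comap φ.toRingHom) (algebraMap R F r) < 1 := fun r => by
    rw [Ideal.mem_comap, Valuation.mem_centre, ← hφ]
    rfl
  constructor
  · intro H
    ext r
    obtain ⟨b, hb, hb'⟩ := h₁ r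
    rw [key, hb _ hw, ← hb' P hP hhP, H]
    rfl
  · rintro hPQ b
    obtain ⟨r, -, hr, hr'⟩ := h₂ b
    rw [hr' P hP hhP, ← hPQ, key, hr _ hw]
    rfl

end Correspondence

theorem Set.Finite.of_minimalPrimes {R ι : Type*} [CommRing R] {ℋ : Set (Ideal R)}
    (hℋ : ∀ I ∈ ℋ, IsHypersurfaceIdeal I) {𝔅 : Set (Ideal R)} (h𝔅 : 𝔅.Finite)
    {A : Ideal R → ι} (hA : (A '' ℋ).Finite)
    (hinj : ∀ I ∈ ℋ, ∀ J ∈ ℋ, A I = A J → I.minimalPrimes \ 𝔅 ⊆ J.minimalPrimes) :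
    ℋ.Finite := by
  refine Set.Finite.of_finite_image (f := fun I => (A I, I.minimalPrimes ∩ 𝔅)) ?_ ?_
  · refine (hA.prod h𝔅.finite_subsets).subset ?_
    rintro _ ⟨I, hI, rfl⟩
    exact ⟨⟨I, hI, rfl⟩, Set.inter_subset_right⟩
  · have hle : ∀ I ∈ ℋ, ∀ J ∈ ℋ, A I = A J → I.minimalPrimes ∩ 𝔅 = J.minimalPrimes ∩ 𝔅 →
        I.minimalPrimes ⊆ J.minimalPrimes := by
      intro I hI J hJ h1 h2 P hP
      by_cases hPB : P ∈ 𝔅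
      · exact (h2.subset ⟨hP, hPB⟩).1
      · exact hinj I hI J hJ h1 ⟨hP, hPB⟩
    intro I hI J hJ hIJ
    obtain ⟨h1, h2⟩ := Prod.mk.inj hIJ
    rw [← (hℋ I hI).sInf_minimalPrimes, ← (hℋ J hJ).sInf_minimalPrimes,
      (hle I hI J hJ h1 h2).antisymm (hle J hJ I hI h1.symm h2.symm)]

theorem finite_setOf_properTransform_eq {K R S F L : Type*} [Field K] [CharZero K] [CommRing R]
    [IsDomain R] [Algebra K R] [Algebra.FiniteType K R] [CommRing S] [IsDomain S] [Algebra K S]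
    [Algebra.FiniteType K S] [Field F] [Algebra K F] [Algebra R F] [IsScalarTower K R F]
    [IsFractionRing R F] [Algebra.EssFiniteType K F] [Field L] [Algebra K L] [Algebra S L]
    [IsScalarTower K S L] [IsFractionRing S L] [Algebra.EssFiniteType K L]
    {f : Bool → R →ₐ[K] S} (φ : Bool → F →ₐ[K] L)
    (hφ : ∀ a r, φ a (algebraMap R F r) = algebraMap S L (f a r))
    (hfix : ∀ g : F, φ false g = φ true g → ∃ c : K, algebraMap K F c = g) :
    {I : Ideal R | IsHypersurfaceIdeal I ∧ properTransform (f false : R →+* S) I =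
      properTransform (f true : R →+* S) I}.Finite := by
  classical
  have : IsNoetherianRing R := Algebra.FiniteType.isNoetherianRing K R
  have : IsNoetherianRing S := Algebra.FiniteType.isNoetherianRing K S
  have hf : ∀ a, Function.Injective (f a) := fun a r s hrs => by
    refine IsFractionRing.injective R F ((φ a).injective ?_)
    change φ a _ = φ a _
    rw [hφ, hφ, hrs]
  by_contra hinf
  obtain ⟨I₀, hI₀, -⟩ := Set.Infinite.nonempty hinf
  obtain ⟨P₀, hP₀⟩ := I₀.nonempty_minimalPrimes hI₀.2.1
  obtain ⟨r₀, hr₀⟩ := (hI₀.2.2 P₀ hP₀).exists_transcendental (K := K)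
  obtain ⟨n, g', hg', hbas⟩ := exists_isIntegral_algHom_mvPolynomial F hr₀
  have htr : Algebra.trdeg K F = (n + 1 : ℕ) := by
    have := hbas.lift_cardinalMk_eq_trdeg
    simpa using this.symm
  obtain ⟨m, g, hg, hz⟩ := exists_isIntegral_algHom_mvPolynomial L
    (r := f false r₀) fun h => hr₀ ((isAlgebraic_algHom_iff (f false) (hf false)).1 h)
  set z := fun i => algebraMap S L (g (X i)) with hzdef
  obtain ⟨x, hx, hval⟩ := exists_isTranscendenceBasis_valuation_eq_pow hz 0 htr φ
  obtain ⟨y, G, hG, hGy, hG', hgen⟩ := hx.exists_integral_generator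
  obtain ⟨h, 𝔓, hh, hle, h₁, h₂, h𝔓⟩ := exists_evalPair_correspondence (R := R) hx.1 hG hGy hgen
  have hExists : ∀ a i, ∃ D : Derivation K L L, ∀ j, D (φ a (x j)) = if j = i then 1 else 0 :=
    fun a i => AlgebraicIndependent.exists_derivation (t := fun j => φ a (x j))
      (hx.1.map' (φ a).injective) _
  choose E hE using hExists
  have hval' : ∀ a w, ∃ u : MvPolynomial (Fin (n + 1)) K, w ∈ allPlaces K z 0 → ∃ ρ, 1 ≤ ρ ∧
      (∀ i, w (φ a (x i)) ≤ ρ) ∧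
        ∀ Q, Irreducible Q → ¬ Associated u Q → w (φ a (aeval x Q)) = ρ ^ Q.totalDegree := by
    intro a w
    by_cases hw : w ∈ allPlaces K z 0
    · obtain ⟨ρ, h1, h2, u, hu⟩ := hval a w hw
      exact ⟨u, fun _ => ⟨ρ, h1, h2, hu⟩⟩
    · exact ⟨0, fun h => absurd h hw⟩
  choose u hu using hval'
  choose r hr0 hr1 hr2 using h₂
  set T₁ : Set (Valuation L ℤᵐ⁰) := {w | ¬ (w ∈ finitePlaces K z ∧
    ∀ a, (∀ i s, w s ≤ 1 → w (E a i s) ≤ 1) ∧ w (φ a (algebraMap R F h)) = 1 ∧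
      w (φ a (evalPair x y (Polynomial.derivative G))) = 1)} with hT₁
  have hne : ∀ a s, s ≠ 0 → φ a (algebraMap R F s) ≠ 0 := fun a s hs => by simpa using hs
  have hT₁fin : (allPlaces K z 0 ∩ T₁).Finite := by
    have h1 := (finite_placesOver_infinity hz 0).union (Set.finite_iUnion fun a =>
      ((Set.finite_iUnion fun i => finite_allPlaces_not_derivation_stable hz 0 (E a i)).union
        ((finite_allPlaces_ne_one hz 0 (hne a h hh)).union
          (finite_allPlaces_ne_one hz 0 ((map_ne_zero (φ a)).2 hG')))))
    refine h1.subset ?_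
    rintro w ⟨hw, hwT⟩
    by_contra hcon
    simp only [Set.mem_union, Set.mem_iUnion, Set.mem_ofPred_eq, not_or, not_exists, not_and,
      not_not] at hcon
    exact hwT ⟨hw.resolve_right hcon.1, fun a => ⟨fun i => (hcon.2 a).1 i hw, (hcon.2 a).2.1 hw,
      (hcon.2 a).2.2 hw⟩⟩
  set 𝓡 : Set R := {s | s ≠ 0 ∧ (s = h ∨ s = r (Polynomial.derivative G) ∨
    ∃ a, ∃ w ∈ allPlaces K z 0 ∩ T₁, s = r (Polynomial.C (u a w)))} with h𝓡
  have h𝓡fin : 𝓡.Finite := by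
    refine ((Set.finite_singleton h).union ((Set.finite_singleton (r (Polynomial.derivative G))).union
      (Set.finite_iUnion fun a => hT₁fin.image fun w => r (Polynomial.C (u a w))))).subset ?_
    rintro s ⟨-, rfl | rfl | ⟨a, w, hw, rfl⟩⟩
    · exact Or.inl rfl
    · exact Or.inr (Or.inl rfl)
    · exact Or.inr (Or.inr (Set.mem_iUnion.2 ⟨a, w, hw, rfl⟩))
  set T₂ : Set (Valuation L ℤᵐ⁰) := {w | ∃ s ∈ 𝓡, ∃ a, w (φ a (algebraMap R F s)) ≠ 1} with hT₂
  have hT₂fin : (allPlaces K z 0 ∩ T₂).Finite := by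
    refine (h𝓡fin.biUnion (t := fun s => ⋃ a, {w | w ∈ allPlaces K z 0 ∧
      w (φ a (algebraMap R F s)) ≠ 1}) fun s hs => Set.finite_iUnion fun a =>
        finite_allPlaces_ne_one hz 0 (hne a s hs.1)).subset ?_
    rintro w ⟨hw, s, hs, a, ha⟩
    exact Set.mem_biUnion hs (Set.mem_iUnion.2 ⟨a, hw, ha⟩)
  let κ := {P : Ideal R // HeightOnePrime P ∧ ∀ s ∈ 𝓡, s ∉ P}
  have hhκ : ∀ k : κ, h ∉ k.1 := fun k => k.2.2 h ⟨hh, Or.inl rfl⟩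
  have hprime : ∀ k : κ, _ := fun k => h𝔓 k.1 k.2.1 (hhκ k)
  choose hPp hPq hker using hprime
  choose q hq hqdvd using hPq
  have hN : ∀ k, ∃ N, IsPrimeKernel G (G.support.sup fun i => (G.coeff i).totalDegree) (𝔓 k.1)
      (q k) N := fun k => exists_isPrimeKernel hG (fun i => by
        by_cases hi : i ∈ G.support
        · exact Finset.le_sup (f := fun i => (G.coeff i).totalDegree) hi
        · simp [Polynomial.notMem_support_iff.1 hi]) (hPp k) (hq k) (hqdvd k) (hker k G hGy)
  choose N hN using hN
  have hcent : ∀ w ∈ allPlaces K z 0, w ∉ T₁ → ∃ hwS : ∀ s, w (algebraMap S L s) ≤ 1,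
      ∀ a, CentredOff h (w.comap (φ a).toRingHom) := by
    intro w hw hwT
    rw [hT₁, Set.mem_ofPred_eq, not_not] at hwT
    have hwS : ∀ s, w (algebraMap S L s) ≤ 1 := fun s =>
      le_one_of_isIntegral_of_mem_finitePlaces hz hwT.1 (isIntegral_adjoin_of_isIntegral L hg s)
    refine ⟨hwS, fun a => ⟨fun s => ?_, (hwT.2 a).2.1⟩⟩
    show w (φ a (algebraMap R F s)) ≤ 1
    rw [hφ]
    exact hwS _
  have hgood : ∀ a, ∀ w ∈ allPlaces K z 0, w ∉ T₁ →
      IsGoodValuation x y G (w.comap (φ a).toRingHom) := by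
    intro a w hw hwT
    obtain ⟨-, hwc⟩ := hcent w hw hwT
    obtain ⟨π, hπ⟩ := allPlaces_exists_uniformizer hz 0 hw
    obtain ⟨ρ, hρ, -, hρu⟩ := hu a w hw
    rw [hT₁, Set.mem_ofPred_eq, not_not] at hwT
    exact isGoodValuation_comap (fun i j => hE a i j) (hwT.2 a).1 hπ (hle _ (hwc a))
      (hwT.2 a).2.2 hρ hρu
  have hbad : ∀ a, ∀ w ∈ allPlaces K z 0, w ∈ T₁ → ∃ ρ, 1 ≤ ρ ∧ (∀ i, w (φ a (x i)) ≤ ρ) ∧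
      ∀ k, w (φ a (aeval x (q k))) = ρ ^ (q k).totalDegree := by
    intro a w hw hwT
    obtain ⟨ρ, hρ, hρx, hρu⟩ := hu a w hw
    refine ⟨ρ, hρ, hρx, fun k => hρu _ (hq k) fun hass => ?_⟩
    have hu0 : evalPair x y (Polynomial.C (u a w)) ≠ 0 := by
      rw [evalPair_C]
      intro h0
      have : u a w = 0 := hx.1 (h0.trans (map_zero _).symm)
      rw [this] at hass
      exact (hq k).ne_zero (hass.symm.eq_zero_iff.2 rfl)
    refine k.2.2 (r (Polynomial.C (u a w))) ⟨hr0 _ hu0, Or.inr (Or.inr ⟨a, w, ⟨hw, hwT⟩, rfl⟩)⟩ ?_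
    rw [← hr2 _ k.1 k.2.1 (hhκ k), hqdvd]
    exact hass.symm.dvd
  have hminfin : ∀ I : Ideal R, {k : κ | k.1 ∈ I.minimalPrimes}.Finite := fun I =>
    (I.finite_minimalPrimes_of_isNoetherianRing R).preimage Subtype.val_injective.injOn
  have h𝒜 := finite_of_correspondence (𝒜 := (fun I => (hminfin I).toFinset) ''
    {I : Ideal R | IsHypersurfaceIdeal I ∧ properTransform (f false : R →+* S) I =
      properTransform (f true : R →+* S) I}) hN hGy
    (fun k l hkl => Subtype.ext (eq_of_correspondence_eq h₁ k.2.1 (hhκ k) l.2.1 (hhκ l) hkl))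
    (φ₁ := φ false) (φ₂ := φ true) (E := E false) (fun i j => hE false i j) hz 0 hx.1 hker
    ?_ hT₁fin hT₂fin (hgood false) (hgood true) ?_ (hbad false) (hbad true) ?_
    (finiteDimensional_ker_compareForms hfix)
  · refine hinf (Set.Finite.of_minimalPrimes (fun I hI => hI.1)
      (𝔅 := {P | HeightOnePrime P ∧ ∃ s ∈ 𝓡, s ∈ P}) ?_ h𝒜 ?_)
    · refine (h𝓡fin.biUnion (t := fun s => {P | HeightOnePrime P ∧ s ∈ P}) fun s hs =>
        HeightOnePrime.finite_mem hs.1).subset ?_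
      rintro P ⟨hP, s, hs, hsP⟩
      exact Set.mem_biUnion hs ⟨hP, hsP⟩
    · rintro I hI J hJ hIJ P ⟨hP, hPB⟩
      have hPκ : ∀ s ∈ 𝓡, s ∉ P := fun s hs hsP => hPB ⟨hI.1.2.2 P hP, s, hs, hsP⟩
      have : (⟨P, hI.1.2.2 P hP, hPκ⟩ : κ) ∈ (hminfin I).toFinset :=
        (hminfin I).mem_toFinset.2 hP
      rw [show (hminfin I).toFinset = (hminfin J).toFinset from hIJ] at this
      exact (hminfin J).mem_toFinset.1 this
  · intro k hk
    rw [hr2 _ k.1 k.2.1 (hhκ k)] at hk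
    exact k.2.2 _ ⟨hr0 _ hG', Or.inr (Or.inl rfl)⟩ hk
  · intro w hw hwT
    rw [hT₁, Set.mem_ofPred_eq, not_not] at hwT
    exact (hwT.2 false).1
  · rintro w hw hw₁ hw₂ _ ⟨I, hI, rfl⟩
    obtain ⟨hwS, hwc⟩ := hcent w hw hw₁
    have hwfin : w ∈ finitePlaces K z := by
      rw [hT₁, Set.mem_ofPred_eq, not_not] at hw₁
      exact hw₁.1
    have h₂ : ∀ b : Polynomial (MvPolynomial (Fin (n + 1)) K), ∃ s : R,
        (evalPair x y b ≠ 0 → s ≠ 0) ∧ (∀ v : Valuation F ℤᵐ⁰, CentredOff h v →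
          (v (algebraMap R F s) < 1 ↔ v (evalPair x y b) < 1)) ∧
        ∀ P : Ideal R, HeightOnePrime P → h ∉ P → (b ∈ 𝔓 P ↔ s ∈ P) :=
      fun b => ⟨r b, hr0 b, hr1 b, hr2 b⟩
    have key : ∀ a, (∃ k ∈ (hminfin I).toFinset, ∀ b, b ∈ 𝔓 k.1 ↔
        w (φ a (evalPair x y b)) < 1) ↔
          (w.centre (algebraMap S L) hwS).comap (f a : R →+* S) ∈ I.minimalPrimes := by
      intro a
      constructor
      · rintro ⟨k, hk, hkb⟩
        rw [forall_mem_iff_eq_comap_centre h₁ h₂ (hφ a) hwS (hwc a) k.2.1 (hhκ k)] at hkb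
        rw [show (w.centre (algebraMap S L) hwS).comap (f a : R →+* S) = k.1 from hkb]
        exact (hminfin I).mem_toFinset.1 hk
      · intro hmem
        have hone := hI.1.2.2 _ hmem
        have havoid : ∀ s ∈ 𝓡, s ∉ (w.centre (algebraMap S L) hwS).comap (f a : R →+* S) := by
          intro s hs hsQ
          refine hw₂ ⟨s, hs, a, ?_⟩
          rw [hφ]
          exact ne_of_lt hsQ
        refine ⟨⟨_, hone, havoid⟩, (hminfin I).mem_toFinset.2 hmem, ?_⟩
        exact (forall_mem_iff_eq_comap_centre h₁ h₂ (hφ a) hwS (hwc a) hone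
          (havoid h ⟨hh, Or.inl rfl⟩)).2 rfl
    have hQ : ∀ Q' : Ideal S, Q'.IsPrime → Q' ≠ ⊥ → Q' ≤ w.centre (algebraMap S L) hwS →
        Q' = w.centre (algebraMap S L) hwS := fun Q' h1 h2 h3 =>
      eq_centre_of_mem_finitePlaces hg hz hwfin hwS h1 h2 h3
    have hQp := w.centre_isPrime (algebraMap S L) hwS
    have hf' : ∀ a, Function.Injective (f a : R →+* S) := hf
    exact (key false).trans (Iff.trans
      ⟨comap_mem_minimalPrimes_of_properTransform_eq (hf' false) (hf' true) hI.1.ne_bot hI.2 hQp hQ,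
        comap_mem_minimalPrimes_of_properTransform_eq (hf' true) (hf' false) hI.1.ne_bot hI.2.symm
          hQp hQ⟩ (key true).symm)

/-- **Corollary 7.3.** Let `φ₁, φ₂ : Z → X` be dominant rational maps with irreducible
generic fibres, between algebraic varieties over an algebraically closed field of
characteristic zero.  If infinitely many hypersurfaces `H` on `X` satisfy `φ₁*H = φ₂*H`,
then there is a nonconstant rational function `g = a/b ∈ K(X) \ K` with `g∘φ₁ = g∘φ₂`. -/
theorem main_reduced_irreducible_fibres
    (K : Type*) [Field K] [IsAlgClosed K] [CharZero K]
    (R : Type*) [CommRing R] [IsDomain R] [Algebra K R] [Algebra.FiniteType K R]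
    (S : Type*) [CommRing S] [IsDomain S] [Algebra K S] [Algebra.FiniteType K S]
    (f₁ f₂ : R →ₐ[K] S)
    (hdom₁ : Function.Injective f₁) (hdom₂ : Function.Injective f₂)
    (hirr₁ : FracRelAlgClosedVia (f₁ : R →+* S))
    (hirr₂ : FracRelAlgClosedVia (f₂ : R →+* S))
    (hinv : {I : Ideal R | IsHypersurfaceIdeal I ∧
        properTransform (f₁ : R →+* S) I = properTransform (f₂ : R →+* S) I}.Infinite) :
    ∃ a b : R, b ≠ 0 ∧ (∀ c : K, a ≠ algebraMap K R c * b) ∧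
      f₁ a * f₂ b = f₂ a * f₁ b := by
  by_contra hcon
  push Not at hcon
  have : Algebra.EssFiniteType K (FractionRing R) := essFiniteType_fractionRing K R
  have : Algebra.EssFiniteType K (FractionRing S) := essFiniteType_fractionRing K S
  let f : Bool → R →ₐ[K] S := fun a => cond a f₂ f₁
  have hf : ∀ a, Function.Injective ((IsScalarTower.toAlgHom K S (FractionRing S)).comp (f a)) := by
    have hS := IsFractionRing.injective S (FractionRing S)
    rintro (_ | _)
    exacts [hS.comp hdom₁, hS.comp hdom₂]
  let φ : Bool → FractionRing R →ₐ[K] FractionRing S := fun a => IsFractionRing.liftAlgHom (hf a)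
  have hφ : ∀ a r, φ a (algebraMap R (FractionRing R) r) =
      algebraMap S (FractionRing S) (f a r) := fun a r =>
    IsFractionRing.lift_algebraMap (hf a) r
  refine hinv (finite_setOf_properTransform_eq (f := f) φ hφ fun u hu => ?_)
  obtain ⟨a, b, hb, rfl⟩ := IsFractionRing.div_surjective (A := R) u
  have hb0 := nonZeroDivisors.ne_zero hb
  by_contra hc
  push Not at hc
  refine hcon a b hb0 (fun c hac => hc c ?_) ?_
  · have hb' : algebraMap R (FractionRing R) b ≠ 0 := by simpa using hb0
    rw [eq_div_iff hb', hac, map_mul, ← IsScalarTower.algebraMap_apply]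
  · have hne : ∀ i, φ i (algebraMap R (FractionRing R) b) ≠ 0 := fun i => by simpa using hb0
    rw [map_div₀, map_div₀, div_eq_div_iff (hne _) (hne _)] at hu
    simp only [hφ, ← map_mul] at hu
    exact IsFractionRing.injective S (FractionRing S) hu
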